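/- arXiv:2505.07221 — 4 statements merged into one kernel-verified Lean document; each statement's English description precedes it below -/
import Mathlib

section
/- For every integer k ≥ 2, the ℤ-submodule of ℝ spanned by {ζ*(κ) : κ ∈ I^adm_k} equals the ℤ-submodule spanned by {ζ*(l) : l ∈ I^{≥2}_k}. -/
open scoped Classical

/-- Multiple zeta value of an index given as a list `(k₁, …, k_r)`:
`ζ(k) = ∑_{0 < n₁ < ⋯ < n_r} 1/(n₁^{k₁} ⋯ n_r^{k_r})`. -/
noncomputable def mzvL (k : List ℕ) : ℝ :=
  ∑' n : {n : Fin k.length → ℕ // StrictMono n ∧ ∀ i, 0 < n i},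
    ∏ i, (1 : ℝ) / ((n.1 i : ℝ) ^ k.get i)

/-- The finite set of coarsenings of an index `k = (k₁, …, k_r)`: all indices `l ⪯ k`
obtained by partitioning `k` into consecutive blocks and replacing each block by the
sum of its entries. -/
def coarsenings : List ℕ → Finset (List ℕ)
  | [] => {[]}
  | a :: k =>
      (coarsenings k).image (fun l => a :: l) ∪
      (coarsenings k).image (fun l => match l with
        | [] => [a]
        | c :: t => (a + c) :: t)

/-- Multiple zeta star value `ζ⋆(k) = ∑_{l ⪯ k} ζ(l)`. -/
noncomputable def mzvStarL (k : List ℕ) : ℝ :=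
  ∑ l ∈ coarsenings k, mzvL l

/-! ### Filtration on lower triangular matrices -/

/-- `Fil d A`: the matrix `A` is supported at least `d` steps below the diagonal. -/
def Fil {K : ℕ} {R : Type*} [Ring R] (d : ℕ) (A : Matrix (Fin (K+1)) (Fin (K+1)) R) : Prop :=
  ∀ i j, i.val < j.val + d → A i j = 0

section FilLemmas
variable {K : ℕ} {R : Type*} [CommRing R] {A B : Matrix (Fin (K+1)) (Fin (K+1)) R} {d e : ℕ}

lemma Fil.mul (hA : Fil d A) (hB : Fil e B) : Fil (d+e) (A*B) := by
  intro i j hij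
  rw [Matrix.mul_apply]
  apply Finset.sum_eq_zero
  intro l _
  by_cases h : i.val < l.val + d
  · rw [hA i l h, zero_mul]
  · rw [hB l j (by omega), mul_zero]

lemma Fil.add (hA : Fil d A) (hB : Fil d B) : Fil d (A+B) := by
  intro i j h
  simp [hA i j h, hB i j h]

lemma Fil.sub (hA : Fil d A) (hB : Fil d B) : Fil d (A-B) := by
  intro i j h
  simp [hA i j h, hB i j h]

lemma Fil.smul (c : R) (hA : Fil d A) : Fil d (c • A) := by
  intro i j h
  simp [hA i j h]

lemma Fil.mono (hA : Fil d A) (h : e ≤ d) : Fil e A := fun i j hij => hA i j (by omega)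

lemma Fil.eq_zero (hA : Fil d A) (h : K + 1 ≤ d) : A = 0 := by
  ext i j
  exact hA i j (by have := i.2; omega)

lemma fil_zero : Fil d (0 : Matrix (Fin (K+1)) (Fin (K+1)) R) := fun _ _ _ => rfl

lemma fil_one : Fil 0 (1 : Matrix (Fin (K+1)) (Fin (K+1)) R) := by
  intro i j h
  apply Matrix.one_apply_ne
  intro hh
  rw [hh] at h
  omega

lemma Fil.any (A : Matrix (Fin (K+1)) (Fin (K+1)) R) (hA : Fil 1 A) (n : ℕ) : Fil n (A^n) := by
  induction n with
  | zero => simpa using fil_one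
  | succ n ih => rw [pow_succ]; exact ih.mul hA

/-- inverse of `1 - A` for strictly lower triangular `A` -/
lemma Fil.exists_inv (hA : Fil 1 A) :
    ∃ U, Fil 0 U ∧ Fil 1 (U - 1) ∧ Fil 2 (U - 1 - A) ∧ U * (1 - A) = 1 ∧ (1 - A) * U = 1 := by
  have hz : A^(K+1) = 0 := (Fil.any A hA (K+1)).eq_zero le_rfl
  obtain ⟨U, hU1, hU2⟩ : ∃ U, U * (1 - A) = 1 ∧ (1 - A) * U = 1 := by
    refine ⟨∑ i ∈ Finset.range (K+1), A^i, ?_, ?_⟩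
    · rw [geom_sum_mul_neg, hz, sub_zero]
    · rw [mul_neg_geom_sum, hz, sub_zero]
  have key : ∀ n, Fil 0 (∑ i ∈ Finset.range n, A^i) := by
    intro n
    induction n with
    | zero => simpa using fil_zero
    | succ n ih => rw [Finset.sum_range_succ]; exact ih.add ((Fil.any A hA n).mono (by omega))
  have hU : U = ∑ i ∈ Finset.range (K+1), A^i := by
    have : (∑ i ∈ Finset.range (K+1), A^i) * (1-A) = 1 := by
      rw [geom_sum_mul_neg, hz, sub_zero]
    exact (left_inv_eq_right_inv this hU2).symm
  have h0 : Fil 0 U := hU ▸ key _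
  have e1 : U - 1 = U * A := by
    have : U - U * A = 1 := by rw [← hU1, mul_sub, mul_one]
    rw [← this]; abel
  have h1 : Fil 1 (U - 1) := by
    rw [e1]; simpa using h0.mul hA
  refine ⟨U, h0, h1, ?_, hU1, hU2⟩
  have : U - 1 - A = (U - 1) * A := by rw [sub_mul, one_mul, ← e1]
  rw [this]
  exact h1.mul hA

/-- Existence of the twisted pair. -/
lemma exists_twist {x y : Matrix (Fin (K+1)) (Fin (K+1)) R} (hx : Fil 1 x) (hy : Fil 1 y) :
    ∃ x' y' : Matrix (Fin (K+1)) (Fin (K+1)) R, Fil 1 x' ∧ Fil 1 y' ∧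
      (1 - x) * y = y' * (1 - x') ∧ x - y = x' - y' := by
  let φ : Matrix (Fin (K+1)) (Fin (K+1)) R → Matrix (Fin (K+1)) (Fin (K+1)) R :=
    fun s => (1 - x) * y + s * (s + x - y)
  have hφ1 : ∀ s, Fil 1 s → Fil 1 (φ s) := by
    intro s hs
    have h1 : Fil (0+1) ((1 - x) * y) := (fil_one.sub (hx.mono (by omega))).mul hy
    have h2 : Fil (1+1) (s * (s + x - y)) := hs.mul ((hs.add hx).sub hy)
    exact (h1.mono (by omega)).add (h2.mono (by omega))
  have hit : ∀ n, Fil 1 (φ^[n] 0) := by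
    intro n
    induction n with
    | zero => exact fil_zero
    | succ n ih => rw [Function.iterate_succ_apply']; exact hφ1 _ ih
  have hd : ∀ n, Fil n (φ^[n+1] 0 - φ^[n] 0) := by
    intro n
    induction n with
    | zero => exact ((hit 1).sub (hit 0)).mono (by omega)
    | succ n ih =>
      have e : φ^[n+1+1] 0 - φ^[n+1] 0 = (φ^[n+1] 0 - φ^[n] 0) * (φ^[n+1] 0 + x - y)
          + φ^[n] 0 * (φ^[n+1] 0 - φ^[n] 0) := by
        rw [Function.iterate_succ_apply' φ (n+1), Function.iterate_succ_apply' φ n]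
        simp only [φ]
        noncomm_ring
      rw [e]
      refine (ih.mul (((hit _).add hx).sub hy)).add ?_
      have h2 := (hit n).mul ih
      exact h2.mono (by omega)
  set s := φ^[K+1] 0 with hs
  have hfix : φ s = s := by
    have := (hd (K+1)).eq_zero le_rfl
    rw [Function.iterate_succ_apply'] at this
    exact sub_eq_zero.mp this
  have hs1 : Fil 1 s := hit _
  refine ⟨s + x - y, s, (hs1.add hx).sub hy, hs1, ?_, by abel⟩
  have : (1 - x) * y = s - s * (s + x - y) := by
    nth_rewrite 1 [← hfix]
    simp only [φ]; abel
  rw [this, mul_sub s 1, mul_one]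

end FilLemmas

/-! ### Words -/

/-- all words of length `d` -/
def wordsOf : ℕ → Finset (List Bool)
  | 0 => {[]}
  | d+1 => (wordsOf d).image (List.cons true) ∪ (wordsOf d).image (List.cons false)

lemma mem_wordsOf {d : ℕ} {W : List Bool} : W ∈ wordsOf d ↔ W.length = d := by
  induction d generalizing W with
  | zero => simp [wordsOf, List.length_eq_zero_iff]
  | succ d ih =>
    simp only [wordsOf, Finset.mem_union, Finset.mem_image, ih]
    cases W with
    | nil => simp
    | cons e W => cases e <;> simp

lemma sum_wordsOf_succ {M : Type*} [AddCommMonoid M] (d : ℕ) (f : List Bool → M) :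
    ∑ W ∈ wordsOf (d+1), f W = ∑ W ∈ wordsOf d, f (true :: W) + ∑ W ∈ wordsOf d, f (false :: W) := by
  rw [wordsOf, Finset.sum_union, Finset.sum_image, Finset.sum_image]
  · intro a _ b _ h; simpa using h
  · intro a _ b _ h; simpa using h
  · rw [Finset.disjoint_left]
    intro a h1 h2
    simp only [Finset.mem_image] at h1 h2
    obtain ⟨u, _, rfl⟩ := h1
    obtain ⟨v, _, hv⟩ := h2
    simp at hv

/-- evaluation of a (reversed) word -/
def ev {M : Type*} [Monoid M] (x y : M) : List Bool → M
  | [] => 1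
  | e :: W => ev x y W * (if e = true then x else y)

lemma ev_append {M : Type*} [Monoid M] (x y : M) (U V : List Bool) :
    ev x y (U ++ V) = ev x y V * ev x y U := by
  induction U with
  | nil => simp [ev]
  | cons e U ih => simp only [List.cons_append, ev, ih, mul_assoc]

/-- multiply a noncommutative series by `(1 - p c)⁻¹` on the right -/
def step (c : Bool) (p : ℝ) (D : List Bool → ℝ) : List Bool → ℝ
  | [] => D []
  | e :: W => D (e :: W) + if e = c then p * step c p D W else 0

/-- partial diamond sums -/
noncomputable def Daux (N : ℕ) : ℕ → List Bool → ℝ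
  | 0 => fun W => if W = [] then 1 else 0
  | j+1 => step false (1 / ((j:ℝ)+1)) (step true (1 / ((N:ℝ) - (j+1))) (Daux N j))

/-- diamond values -/
noncomputable def DD (N : ℕ) : List Bool → ℝ := Daux N (N-1)

section Series
variable {K : ℕ} 

/-- evaluation of a series -/
noncomputable def SS (x y : Matrix (Fin (K+1)) (Fin (K+1)) ℝ) (E : List Bool → ℝ) :
    Matrix (Fin (K+1)) (Fin (K+1)) ℝ :=
  ∑ d ∈ Finset.range (K+1), ∑ W ∈ wordsOf d, E W • ev x y W

lemma fil_ev {R : Type*} [CommRing R] {x y : Matrix (Fin (K+1)) (Fin (K+1)) R} (hx : Fil 1 x)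
    (hy : Fil 1 y) (W : List Bool) : Fil W.length (ev x y W) := by
  induction W with
  | nil => exact fil_one
  | cons e W ih =>
    simp only [ev, List.length_cons]
    refine ih.mul ?_
    split_ifs <;> assumption

lemma SS_step {x y : Matrix (Fin (K+1)) (Fin (K+1)) ℝ} (hx : Fil 1 x) (hy : Fil 1 y)
    (c : Bool) (p : ℝ) (E : List Bool → ℝ) :
    SS x y (step c p E) * (1 - p • (if c = true then x else y)) = SS x y E := by
  set T : ℕ → (List Bool → ℝ) → Matrix (Fin (K+1)) (Fin (K+1)) ℝ :=
    fun d E => ∑ W ∈ wordsOf d, E W • ev x y W with hT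
  set m := (if c = true then x else y) with hm
  have hm1 : Fil 1 m := by rw [hm]; split_ifs <;> assumption
  have h0 : T 0 (step c p E) = T 0 E := by simp [hT, wordsOf, step]
  have h1 : ∀ d, T (d+1) (step c p E) = T (d+1) E + T d (step c p E) * (p • m) := by
    intro d
    simp only [hT]
    rw [sum_wordsOf_succ, sum_wordsOf_succ, Finset.sum_mul]
    cases c <;> simp [step, ev, add_smul, Finset.sum_add_distrib, hm, mul_smul, add_assoc, add_comm, add_left_comm]
  have h2 : ∀ n, ∑ d ∈ Finset.range (n+1), T d (step c p E) =
      ∑ d ∈ Finset.range (n+1), T d E + (∑ d ∈ Finset.range n, T d (step c p E)) * (p • m) := by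
    intro n
    rw [Finset.sum_range_succ', Finset.sum_range_succ', h0, Finset.sum_mul]
    simp only [h1, Finset.sum_add_distrib]
    abel
  have h3 : T K (step c p E) * (p • m) = 0 := by
    have : Fil K (T K (step c p E)) := by
      simp only [hT]
      apply Finset.sum_induction _ (Fil K) (fun a b ha hb => ha.add hb) fil_zero
      intro W hW
      have := fil_ev hx hy W
      rw [mem_wordsOf.mp hW] at this
      exact this.smul _
    exact (this.mul (hm1.smul p)).eq_zero le_rfl
  have h4 := h2 K
  have e1 : SS x y (step c p E) = ∑ d ∈ Finset.range (K+1), T d (step c p E) := rfl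
  have e2 : SS x y E = ∑ d ∈ Finset.range (K+1), T d E := rfl
  have h5 : SS x y (step c p E) * (p • m) =
      (∑ d ∈ Finset.range K, T d (step c p E)) * (p • m) := by
    rw [e1, Finset.sum_range_succ, add_mul, h3, add_zero]
  rw [mul_sub, mul_one, h5, e1, h4, e2, add_sub_cancel_right]

end Series

section Products
variable {K : ℕ}

/-- inverse products -/
noncomputable def Qaux (N : ℕ) (X Y : Matrix (Fin (K+1)) (Fin (K+1)) ℝ) :
    ℕ → Matrix (Fin (K+1)) (Fin (K+1)) ℝ
  | 0 => 1
  | j+1 => (1 - (1 / ((j:ℝ)+1)) • Y) * (1 - (1 / ((N:ℝ) - (j+1))) • X) * Qaux N X Y j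

/-- inverse products in the other order -/
noncomputable def Qaux' (N : ℕ) (X Y : Matrix (Fin (K+1)) (Fin (K+1)) ℝ) :
    ℕ → Matrix (Fin (K+1)) (Fin (K+1)) ℝ
  | 0 => 1
  | j+1 => (1 - (1 / ((N:ℝ) - (j+1))) • X) * (1 - (1 / ((j:ℝ)+1)) • Y) * Qaux' N X Y j

lemma SS_mul_Qaux {X Y : Matrix (Fin (K+1)) (Fin (K+1)) ℝ} (hX : Fil 1 X) (hY : Fil 1 Y)
    (N j : ℕ) : SS X Y (Daux N j) * Qaux N X Y j = 1 := by
  induction j with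
  | zero =>
    simp only [Qaux, mul_one, SS, Daux]
    rw [Finset.sum_range_succ']
    have : ∀ d ∈ Finset.range K, ∑ W ∈ wordsOf (d+1), (if W = [] then (1:ℝ) else 0) • ev X Y W = 0 := by
      intro d _
      rw [sum_wordsOf_succ]; simp
    rw [Finset.sum_eq_zero this]
    simp [wordsOf, ev]
  | succ j ih =>
    have h1 := SS_step hX hY false (1 / ((j:ℝ)+1)) (step true (1 / ((N:ℝ) - (j+1))) (Daux N j))
    have h2 := SS_step hX hY true (1 / ((N:ℝ) - (j+1))) (Daux N j)
    simp only [Bool.false_eq_true, if_false, if_true] at h1 h2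
    simp only [Qaux, Daux]
    rw [← mul_assoc, ← mul_assoc, h1, h2, ih]

lemma Qaux_shift (N j : ℕ) (X Y : Matrix (Fin (K+1)) (Fin (K+1)) ℝ) :
    Qaux (N+1) X Y (j+1) = (1 - (1 / ((j:ℝ)+1)) • Y) * Qaux' N X Y j * (1 - (1 / (N:ℝ)) • X) := by
  induction j with
  | zero => simp [Qaux, Qaux']
  | succ j ih =>
    rw [Qaux, ih, Qaux']
    have : ((N+1:ℕ):ℝ) - (((j+1:ℕ):ℝ)+1) = (N:ℝ) - (j+1) := by push_cast; ring
    rw [this]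
    simp only [mul_assoc]

lemma twist_factor {x y x' y' : Matrix (Fin (K+1)) (Fin (K+1)) ℝ}
    (h1 : (1 - x) * y = y' * (1 - x')) (h2 : x - y = x' - y') {p q s : ℝ} (h : p * q * s = p + q) :
    (1 - p • (s • x)) * (1 - q • (s • y)) = (1 - q • (s • y')) * (1 - p • (s • x')) := by
  have e1 : x * y = y - y' + y' * x' := by
    have : y - x * y = y' - y' * x' := by simpa [sub_mul, mul_sub] using h1
    have h3 : x * y = y - (y - x * y) := by abel
    rw [h3, this]; abel
  have e2 : x' = y' + x - y := by
    have : x' = (x' - y') + y' := by abel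
    rw [this, ← h2]; abel
  have l1 : (1 - p • (s • x)) * (1 - q • (s • y)) =
      1 - (p*s) • x - (q*s) • y + (p*q*s*s) • (x*y) := by
    simp only [sub_mul, mul_sub, one_mul, mul_one, smul_mul_assoc, mul_smul_comm, smul_smul]
    module
  have l2 : (1 - q • (s • y')) * (1 - p • (s • x')) =
      1 - (p*s) • x' - (q*s) • y' + (p*q*s*s) • (y'*x') := by
    simp only [sub_mul, mul_sub, one_mul, mul_one, smul_mul_assoc, mul_smul_comm, smul_smul]
    module
  rw [l1, l2, e1, h]
  generalize y' * x' = m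
  subst e2
  module

lemma Qaux_twist {x y x' y' : Matrix (Fin (K+1)) (Fin (K+1)) ℝ}
    (h1 : (1 - x) * y = y' * (1 - x')) (h2 : x - y = x' - y') (N j : ℕ) (hj : j < N) :
    Qaux' N ((N:ℝ) • x) ((N:ℝ) • y) j = Qaux N ((N:ℝ) • x') ((N:ℝ) • y') j := by
  induction j with
  | zero => rfl
  | succ j ih =>
    rw [Qaux, Qaux', ih (by omega), twist_factor h1 h2]
    have a1 : ((j:ℝ)+1) ≠ 0 := by positivity
    have a2 : (N:ℝ) - (j+1) ≠ 0 := by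
      have : ((j+1:ℕ):ℝ) < N := by exact_mod_cast hj
      push_cast at this
      linarith
    field_simp
    ring

lemma SS_shift {x y x' y' ux uy : Matrix (Fin (K+1)) (Fin (K+1)) ℝ} (hx : Fil 1 x) (hy : Fil 1 y)
    (hx' : Fil 1 x') (hy' : Fil 1 y')
    (h1 : (1 - x) * y = y' * (1 - x')) (h2 : x - y = x' - y')
    (hux : (1 - x) * ux = 1) (huy : (1 - y) * uy = 1) (N : ℕ) (hN : 1 ≤ N) :
    SS ((N:ℝ) • x) ((N:ℝ) • y) (DD (N+1)) = ux * SS ((N:ℝ) • x') ((N:ℝ) • y') (DD N) * uy := by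
  obtain ⟨M, rfl⟩ : ∃ M, N = M + 1 := ⟨N-1, by omega⟩
  have a := SS_mul_Qaux (hx.smul ((M+1:ℕ):ℝ)) (hy.smul ((M+1:ℕ):ℝ)) (M+1+1) (M+1)
  rw [Qaux_shift, Qaux_twist h1 h2 _ _ (Nat.lt_succ_self M)] at a
  have b := SS_mul_Qaux (hx'.smul ((M+1:ℕ):ℝ)) (hy'.smul ((M+1:ℕ):ℝ)) (M+1) M
  have b' := mul_eq_one_comm.mp b
  have n0 : ((M:ℝ)+1) ≠ 0 := by positivity
  have e1 : (1 / ((M:ℝ)+1)) • (((M+1:ℕ):ℝ) • y) = y := by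
    rw [smul_smul]; push_cast; rw [one_div, inv_mul_cancel₀ n0, one_smul]
  have e2 : (1 / ((M+1:ℕ):ℝ)) • (((M+1:ℕ):ℝ) • x) = x := by
    rw [smul_smul]; push_cast; rw [one_div, inv_mul_cancel₀ n0, one_smul]
  rw [e1, e2] at a
  refine left_inv_eq_right_inv a ?_
  simp only [DD, Nat.add_sub_cancel]
  set Q := Qaux (M+1) (((M+1:ℕ):ℝ) • x') (((M+1:ℕ):ℝ) • y') M
  set Z := SS (((M+1:ℕ):ℝ) • x') (((M+1:ℕ):ℝ) • y') (Daux (M+1) M)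
  calc (1 - y) * Q * (1 - x) * (ux * Z * uy) = (1 - y) * (Q * (((1 - x) * ux) * Z)) * uy := by
        simp only [mul_assoc]
    _ = 1 := by rw [hux, one_mul, b', mul_one, huy]

lemma ev_smul {R : Type*} [CommRing R] (s : R) (x y : Matrix (Fin (K+1)) (Fin (K+1)) R) (W : List Bool) :
    ev (s • x) (s • y) W = s ^ W.length • ev x y W := by
  induction W with
  | nil => simp [ev]
  | cons e W ih =>
    simp only [ev, ih, List.length_cons]
    cases e <;> simp [smul_smul, pow_succ, mul_comm]

end Products

/-! ### The representation attached to a word -/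

/-- matrix of the letter `e` in the representation attached to `w` -/
def repM (R : Type*) [CommRing R] (w : List Bool) (e : Bool) :
    Matrix (Fin (w.length+1)) (Fin (w.length+1)) R :=
  fun i j => if i.val = j.val + 1 ∧ w[j.val]? = some e then 1 else 0

lemma fil_repM (R : Type*) [CommRing R] (w : List Bool) (e : Bool) : Fil 1 (repM R w e) := by
  intro i j h
  simp only [repM]
  rw [if_neg]
  omega

lemma ev_repM (R : Type*) [CommRing R] (w W : List Bool) (j : Fin (w.length+1)) :
    ev (repM R w true) (repM R w false) W (Fin.last _) j = if W = w.drop j.val then 1 else 0 := by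
  induction W generalizing j with
  | nil =>
    simp only [ev, Matrix.one_apply]
    congr 1
    rw [eq_comm (a := ([] : List Bool)), List.drop_eq_nil_iff, Fin.ext_iff, Fin.val_last]
    have := j.2
    apply propext
    omega
  | cons e W ih =>
    have he : (if e = true then repM R w true else repM R w false) = repM R w e := by
      cases e <;> simp
    simp only [ev, he, Matrix.mul_apply, ih]
    by_cases hj : j.val < w.length
    · rw [Finset.sum_eq_single (⟨j.val+1, by omega⟩ : Fin (w.length+1))]
      · simp only [repM, true_and]
        rw [List.drop_eq_getElem_cons hj, List.getElem?_eq_getElem hj]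
        have hc : (e :: W = w[j.val] :: List.drop (j.val+1) w) ↔
            (W = List.drop (j.val+1) w ∧ w[j.val] = e) := by
          rw [List.cons.injEq]
          constructor
          · rintro ⟨h, h'⟩; exact ⟨h', h.symm⟩
          · rintro ⟨h, h'⟩; exact ⟨h'.symm, h⟩
        rw [if_congr hc rfl rfl]
        by_cases h1 : W = List.drop (j.val+1) w <;> by_cases h2 : w[j.val] = e <;>
          simp only [h1, h2, Option.some.injEq, if_true, if_false, true_and, and_true, false_and,
            and_false, mul_one, mul_zero]
      · intro b _ hb
        simp only [repM]
        rw [if_neg (c := _ ∧ _), mul_zero]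
        rintro ⟨h, _⟩
        exact hb (Fin.ext h)
      · simp
    · have : w.drop j.val = [] := List.drop_eq_nil_iff.mpr (by omega)
      rw [this]
      simp only [reduceCtorEq, if_false]
      apply Finset.sum_eq_zero
      intro b _
      simp only [repM]
      rw [if_neg (c := _ ∧ _), mul_zero]
      rintro ⟨h, _⟩
      have := b.2
      omega

lemma SS_repM (w : List Bool) (s : ℝ) (E : List Bool → ℝ) :
    SS (s • repM ℝ w true) (s • repM ℝ w false) E (Fin.last _) 0 = s ^ w.length * E w := by
  simp only [SS, Matrix.sum_apply, Matrix.smul_apply, ev_smul, ev_repM, Fin.val_zero, List.drop_zero]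
  rw [Finset.sum_eq_single w.length, Finset.sum_eq_single w]
  · simp [mul_comm]
  · intro b _ hb; simp [hb]
  · intro h; exact absurd (mem_wordsOf.mpr rfl) h
  · intro d _ hd
    apply Finset.sum_eq_zero
    intro W hW
    rw [if_neg]
    · simp
    · rintro rfl
      exact hd (mem_wordsOf.mp hW).symm
  · simp

section Twist
variable {K : ℕ} {R : Type*} [CommRing R] {x y x' y' : Matrix (Fin (K+1)) (Fin (K+1)) R}

lemma ev_conj (hx : Fil 1 x) (hy : Fil 1 y) (hx' : Fil 1 x') (hy' : Fil 1 y')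
    (g : Matrix (Fin (K+1)) (Fin (K+1)) R) {r : ℕ}
    (h1 : Fil (r+1) (x' * g - g * x)) (h2 : Fil (r+1) (y' * g - g * y)) (W : List Bool) :
    Fil (W.length + r) (ev x' y' W * g - g * ev x y W) := by
  induction W with
  | nil => simpa [ev] using fil_zero
  | cons e W ih =>
    have key : ∀ m m', Fil 1 m → Fil (r+1) (m' * g - g * m) →
        Fil (W.length + 1 + r) (ev x' y' W * m' * g - g * (ev x y W * m)) := by
      intro m m' hm hmm
      have e : ev x' y' W * m' * g - g * (ev x y W * m) =
          ev x' y' W * (m' * g - g * m) + (ev x' y' W * g - g * ev x y W) * m := by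
        noncomm_ring
      rw [e]
      exact (((fil_ev hx' hy' W).mul hmm).mono (by omega)).add ((ih.mul hm).mono (by omega))
    cases e
    · simpa [ev] using key y y' hy h2
    · simpa [ev] using key x x' hx h1

lemma twist_diff (hx : Fil 1 x) (hy : Fil 1 y) (hx' : Fil 1 x') (hy' : Fil 1 y')
    (h1 : (1 - x) * y = y' * (1 - x')) (h2 : x - y = x' - y') :
    Fil 2 (x' - x) ∧ Fil 2 (y' - y) ∧ Fil 3 (x' * (1 + y - x) - (1 + y - x) * x) ∧
      Fil 3 (y' * (1 + y - x) - (1 + y - x) * y) := by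
  have e1 : y' - y = y' * x' - x * y := by
    have : y - x * y = y' - y' * x' := by simpa [sub_mul, mul_sub] using h1
    have h3 : y' - y = (y' - y' * x') + y' * x' - y := by abel
    rw [h3, ← this]; abel
  have e2 : x' - x = y' - y := by
    have : x' - x = (x' - y') + y' - x := by abel
    rw [this, ← h2]; abel
  have a1 : Fil 2 (y' - y) := by
    rw [e1]; exact (hy'.mul hx').sub (hx.mul hy)
  have a2 : Fil 2 (x' - x) := e2 ▸ a1
  refine ⟨a2, a1, ?_, ?_⟩
  · have : x' * (1 + y - x) - (1 + y - x) * x =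
        (x' - x) * y + (y' - y) * x' + y * (x' - x) - (x' - x) * x := by
      have h3 : x' * (1 + y - x) - (1 + y - x) * x =
        (x' - x) + x' * (y - x) - (y - x) * x := by noncomm_ring
      refine h3.trans ?_
      have h5 : (x' - x) + x' * (y - x) - (y - x) * x =
          (y' * x' - x * y) + x' * (y - x) - (y - x) * x := by rw [← e2.trans e1]
      refine h5.trans ?_
      noncomm_ring
    rw [this]
    refine Fil.sub (Fil.add (Fil.add ?_ ?_) ?_) ?_
    · exact a2.mul hy
    · exact a1.mul hx'
    · exact hy.mul a2
    · exact a2.mul hx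
  · have : y' * (1 + y - x) - (1 + y - x) * y = y' * (x' - x) + (y' - y) * y := by
      have h3 : y' * (1 + y - x) - (1 + y - x) * y =
        (y' - y) + y' * (y - x) - (y - x) * y := by noncomm_ring
      refine h3.trans ?_
      have h5 : (y' - y) + y' * (y - x) - (y - x) * y =
          (y' * x' - x * y) + y' * (y - x) - (y - x) * y := by rw [← e1]
      refine h5.trans ?_
      noncomm_ring
    rw [this]
    exact (hy'.mul a2).add (a1.mul hy)

lemma coeff_top {ux uy : Matrix (Fin (K+1)) (Fin (K+1)) R}
    (hx : Fil 1 x) (hy : Fil 1 y) (hx' : Fil 1 x') (hy' : Fil 1 y')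
    (h1 : (1 - x) * y = y' * (1 - x')) (h2 : x - y = x' - y')
    (hux : Fil 1 (ux - 1)) (huy : Fil 1 (uy - 1)) (W : List Bool) (hW : W.length = K) :
    ux * ev x' y' W * uy = ev x y W := by
  obtain ⟨a, b, -, -⟩ := twist_diff hx hy hx' hy' h1 h2
  have d := ev_conj hx hy hx' hy' 1 (r := 1) (by simpa using a) (by simpa using b) W
  have d' : ev x' y' W = ev x y W := by
    have := d.eq_zero (by omega)
    simpa [sub_eq_zero] using this
  rw [d']
  have hV := fil_ev hx hy W
  have z1 : (ux - 1) * ev x y W = 0 := (hux.mul hV).eq_zero (by omega)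
  have z2 : ev x y W * (uy - 1) = 0 := (hV.mul huy).eq_zero (by omega)
  rw [sub_mul, one_mul, sub_eq_zero] at z1
  rw [mul_sub, mul_one, sub_eq_zero] at z2
  rw [z1, z2]

lemma coeff_subtop {ux uy : Matrix (Fin (K+1)) (Fin (K+1)) R}
    (hx : Fil 1 x) (hy : Fil 1 y) (hx' : Fil 1 x') (hy' : Fil 1 y')
    (h1 : (1 - x) * y = y' * (1 - x')) (h2 : x - y = x' - y')
    (hux : Fil 1 (ux - 1)) (huy : Fil 1 (uy - 1))
    (hux2 : Fil 2 (ux - 1 - x)) (huy2 : Fil 2 (uy - 1 - y)) (W : List Bool) (hW : W.length + 1 = K) :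
    ux * ev x' y' W * uy = ev x y W + ev x y W * x + y * ev x y W := by
  obtain ⟨a, b, c, d⟩ := twist_diff hx hy hx' hy' h1 h2
  have d1 := ev_conj hx hy hx' hy' 1 (r := 1) (by simpa using a) (by simpa using b) W
  have d2 := (ev_conj hx hy hx' hy' (1 + y - x) (r := 2) c d W).eq_zero (by omega)
  simp only [mul_one, one_mul] at d1
  have hV := fil_ev hx hy W
  have hV' := fil_ev hx' hy' W
  set V := ev x y W
  set V' := ev x' y' W
  have z1 : (ux - 1 - x) * V' = 0 := (hux2.mul hV').eq_zero (by omega)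
  have z2 : V' * (uy - 1 - y) = 0 := (hV'.mul huy2).eq_zero (by omega)
  have z3 : ((ux - 1) * V') * (uy - 1) = 0 := ((hux.mul hV').mul huy).eq_zero (by omega)
  have z4 : x * (V' - V) = 0 := (hx.mul d1).eq_zero (by omega)
  have z5 : (V' - V) * x = 0 := (d1.mul hx).eq_zero (by omega)
  have : ux * V' * uy - (V + V * x + y * V) =
      ((ux - 1) * V') * (uy - 1) + (ux - 1 - x) * V' + V' * (uy - 1 - y)
      + x * (V' - V) + (V' - V) * x + (V' * (1 + y - x) - (1 + y - x) * V) := by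
    noncomm_ring
  rw [z1, z2, z3, z4, z5, d2] at this
  simpa [sub_eq_zero] using this

end Twist

/-- admissible (reversed) words -/
def AdmW (W : List Bool) : Prop := W.head? = some false ∧ W.getLast? = some true

theorem DD_rec (w : List Bool) (hw : AdmW w) :
    ∃ c : List Bool → ℤ, (∀ W, c W ≠ 0 → W = [] ∨ AdmW W) ∧
      ∀ N : ℕ, 1 ≤ N → (N:ℝ)^w.length * DD (N+1) w = (N:ℝ)^w.length * DD N w +
        ∑ d ∈ Finset.range (w.length - 1), ∑ W ∈ wordsOf d, (c W : ℝ) * ((N:ℝ)^d * DD N W) := by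
  set K := w.length with hK
  have hK2 : 2 ≤ K := by
    obtain ⟨h1, h2⟩ := hw
    rcases w with _ | ⟨e, _ | ⟨f, w⟩⟩
    · simp at h1
    · simp at h1 h2; rw [h1] at h2; simp at h2
    · simp [hK]
  set x := repM ℤ w true with hxd
  set y := repM ℤ w false with hyd
  have hx : Fil 1 x := fil_repM _ _ _
  have hy : Fil 1 y := fil_repM _ _ _
  obtain ⟨x', y', hx', hy', h1, h2⟩ := exists_twist hx hy
  obtain ⟨ux, -, hux1, hux2, hux3, hux4⟩ := hx.exists_inv
  obtain ⟨uy, -, huy1, huy2, huy3, huy4⟩ := hy.exists_inv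
  -- vanishing column and row
  have hcol : ∀ i, x i 0 = 0 := by
    intro i
    simp only [hxd, repM]
    rw [if_neg]
    rintro ⟨-, h⟩
    have := hw.1
    rw [List.head?_eq_getElem?] at this
    simp only [Fin.val_zero] at h
    rw [h] at this
    simp at this
  have hrow : ∀ j, y (Fin.last _) j = 0 := by
    intro j
    simp only [hyd, repM]
    rw [if_neg]
    rintro ⟨h0, h⟩
    have := hw.2
    rw [List.getLast?_eq_getElem?] at this
    simp only [Fin.val_last] at h0
    have h3 : w.length - 1 = j.val := by omega
    rw [h3, h] at this
    simp at this
  let c : List Bool → ℤ := fun W => (ux * ev x' y' W * uy) (Fin.last _) 0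
  refine ⟨c, ?_, ?_⟩
  · intro W hc
    by_contra hcon
    push Not at hcon
    obtain ⟨hne, hna⟩ := hcon
    apply hc
    by_cases hh : W.head? = some false
    · have hl : W.getLast? ≠ some true := fun h => hna ⟨hh, h⟩
      have hl' : ∃ U, W = U ++ [false] := by
        rcases List.eq_nil_or_concat W with h | ⟨U, e, h⟩
        · exact absurd h hne
        · rw [h] at hl
          cases e
          · exact ⟨U, by simpa using h⟩
          · simp at hl
      obtain ⟨U, rfl⟩ := hl'
      obtain ⟨u', -, -, -, -, hu'⟩ := hx'.exists_inv
      have e1 : ux * y' = y * u' := by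
        calc ux * y' = ux * (y' * (1 - x')) * u' := by rw [mul_assoc, mul_assoc, hu', mul_one]
          _ = y * u' := by rw [← h1, ← mul_assoc, hux3, one_mul]
      simp only [c]
      have e2 : ux * ev x' y' (U ++ [false]) * uy = y * (u' * ev x' y' U * uy) := by
        rw [ev_append]
        simp only [ev, one_mul, Bool.false_eq_true, if_false]
        rw [← mul_assoc, e1]
        simp only [mul_assoc]
      rw [e2, Matrix.mul_apply]
      apply Finset.sum_eq_zero
      intro j _
      rw [hrow, zero_mul]
    · obtain ⟨U, rfl⟩ : ∃ U, W = true :: U := by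
        rcases W with _ | ⟨e, U⟩
        · exact absurd rfl hne
        · cases e
          · simp at hh
          · exact ⟨U, rfl⟩
      obtain ⟨u', -, -, -, hu', -⟩ := hy'.exists_inv
      have e0 : (1 - y') * x' = x * (1 - y) := by
        have t1 : y - x * y = y' - y' * x' := by simpa [sub_mul, mul_sub] using h1
        calc (1 - y') * x' = (x' - y') + (y' - y' * x') := by noncomm_ring
          _ = (x - y) + (y - x * y) := by rw [h2, t1]
          _ = x * (1 - y) := by noncomm_ring
      have e1 : x' * uy = u' * x := by
        calc x' * uy = u' * ((1 - y') * x') * uy := by rw [← mul_assoc u', hu', one_mul]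
          _ = u' * x * ((1 - y) * uy) := by rw [e0]; simp only [mul_assoc]
          _ = u' * x := by rw [huy4, mul_one]
      simp only [c]
      have e2 : ux * ev x' y' (true :: U) * uy = (ux * ev x' y' U * u') * x := by
        simp only [ev, if_true, mul_assoc, e1]
      rw [e2, Matrix.mul_apply]
      apply Finset.sum_eq_zero
      intro j _
      rw [hcol, mul_zero]
  · intro N hN
    let ρ : Matrix (Fin (w.length+1)) (Fin (w.length+1)) ℤ →+*
      Matrix (Fin (w.length+1)) (Fin (w.length+1)) ℝ := (Int.castRingHom ℝ).mapMatrix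
    have ρa : ∀ A i j, ρ A i j = (A i j : ℝ) := fun A i j => rfl
    have ρf : ∀ {d A}, Fil d A → Fil d (ρ A) := by
      intro d A h i j hij
      rw [ρa, h i j hij, Int.cast_zero]
    have ρr : ∀ e, ρ (repM ℤ w e) = repM ℝ w e := by
      intro e
      ext i j
      rw [ρa]
      simp only [repM]
      split_ifs <;> simp
    have ρe : ∀ W, ev (ρ x') (ρ y') W = ρ (ev x' y' W) := by
      intro W
      induction W with
      | nil => simp [ev]
      | cons e W ih => cases e <;> simp [ev, ih]
    have main := SS_shift (ρf hx) (ρf hy) (ρf hx') (ρf hy') (ux := ρ ux) (uy := ρ uy)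
      (by simpa using congrArg ρ h1) (by simpa using congrArg ρ h2)
      (by simpa using congrArg ρ hux4) (by simpa using congrArg ρ huy4) N hN
    have m2 := congrFun (congrFun main (Fin.last _)) 0
    rw [hxd, hyd, ρr, ρr, SS_repM] at m2
    have m3 : (ρ ux * SS ((N:ℝ) • ρ x') ((N:ℝ) • ρ y') (DD N) * ρ uy) (Fin.last _) 0 =
        ∑ d ∈ Finset.range (K+1), ∑ W ∈ wordsOf d, (c W : ℝ) * ((N:ℝ)^d * DD N W) := by
      simp only [SS, Finset.mul_sum, Finset.sum_mul, Matrix.sum_apply]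
      apply Finset.sum_congr rfl
      intro d _
      apply Finset.sum_congr rfl
      intro W hW
      rw [ev_smul, ρe, mem_wordsOf.mp hW]
      simp only [mul_smul_comm, smul_mul_assoc, Matrix.smul_apply]
      rw [← map_mul, ← map_mul, ρa]
      simp only [smul_eq_mul, c]
      ring
    rw [m3] at m2
    rw [m2]
    obtain ⟨L, hL⟩ : ∃ L, K = L + 2 := ⟨K - 2, by omega⟩
    rw [show K + 1 = (L + 1) + 1 + 1 by omega, Finset.sum_range_succ, Finset.sum_range_succ,
      show K - 1 = L + 1 by omega, show L + 1 + 1 = K by omega]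
    have top : ∑ W ∈ wordsOf K, (c W : ℝ) * ((N:ℝ)^K * DD N W) = (N:ℝ)^K * DD N w := by
      rw [Finset.sum_eq_single w]
      · have : c w = 1 := by
          simp only [c]
          rw [coeff_top hx hy hx' hy' h1 h2 hux1 huy1 w rfl, ev_repM]
          simp
        rw [this]; simp
      · intro W hW hne
        have : c W = 0 := by
          simp only [c]
          rw [coeff_top hx hy hx' hy' h1 h2 hux1 huy1 W (mem_wordsOf.mp hW), ev_repM]
          simp [hne]
        rw [this]; simp
      · intro h; exact absurd (mem_wordsOf.mpr rfl) h
    have sub : ∑ W ∈ wordsOf (L+1), (c W : ℝ) * ((N:ℝ)^(L+1) * DD N W) = 0 := by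
      apply Finset.sum_eq_zero
      intro W hW
      have hWl := mem_wordsOf.mp hW
      have : c W = 0 := by
        simp only [c]
        rw [coeff_subtop hx hy hx' hy' h1 h2 hux1 huy1 hux2 huy2 W (by omega), Matrix.add_apply,
          Matrix.add_apply, ev_repM, Matrix.mul_apply, Matrix.mul_apply]
        rw [Finset.sum_eq_zero (fun j _ => by rw [hcol, mul_zero]),
          Finset.sum_eq_zero (fun j _ => by rw [hrow, zero_mul])]
        rw [if_neg]
        · simp
        · intro h
          rw [h] at hWl
          simp at hWl
          omega
      rw [this]; simp
    rw [top, sub]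
    ring

/-- truncated multiple zeta values (index reversed) -/
noncomputable def zt : List ℕ → ℕ → ℝ
  | [] => fun _ => 1
  | k :: l => fun N => ∑ n ∈ Finset.Ico 1 N, (1 / (n:ℝ)^k) * zt l n

/-- the span of truncated values with entries at least two -/
noncomputable def Sp (k : ℕ) : Submodule ℤ (ℕ → ℝ) :=
  Submodule.span ℤ {f | ∃ l : List ℕ, (∀ y ∈ l, 2 ≤ y) ∧ l.sum = k ∧ f = zt l}

/-- summation operator -/
noncomputable def sumOp (i : ℕ) : (ℕ → ℝ) →ₗ[ℤ] (ℕ → ℝ) where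
  toFun f := fun N => ∑ n ∈ Finset.Ico 1 N, (1 / (n:ℝ)^i) * f n
  map_add' f g := by
    funext N; simp [mul_add, Finset.sum_add_distrib]
  map_smul' c f := by
    funext N
    simp only [Pi.smul_apply, zsmul_eq_mul, RingHom.id_apply, Finset.mul_sum]
    exact Finset.sum_congr rfl fun n _ => by ring

lemma sumOp_mem {i d : ℕ} (hi : 2 ≤ i) {f : ℕ → ℝ} (hf : f ∈ Sp d) : sumOp i f ∈ Sp (d + i) := by
  have : Sp d ≤ (Sp (d+i)).comap (sumOp i) := by
    unfold Sp
    rw [Submodule.span_le]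
    rintro _ ⟨l, h1, h2, rfl⟩
    refine Submodule.subset_span ⟨i :: l, ?_, ?_, rfl⟩
    · intro y hy
      rcases List.mem_cons.1 hy with rfl | hy
      · exact hi
      · exact h1 y hy
    · simp [h2, add_comm]
  exact this hf

lemma step_nil (c p D) : step c p D [] = D [] := rfl

lemma Daux_nil (N j : ℕ) : Daux N j [] = 1 := by
  induction j with
  | zero => simp [Daux]
  | succ j ih => simp [Daux, step_nil, ih]

lemma DD_nil (N : ℕ) : DD N [] = 1 := Daux_nil _ _

theorem DD_mem : ∀ (K : ℕ) (w : List Bool), w.length = K → AdmW w → (fun N => DD N w) ∈ Sp K := by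
  intro K
  induction K using Nat.strong_induction_on with
  | _ K ih =>
  intro w hw hA
  obtain ⟨c, hc, hrec⟩ := DD_rec w hA
  have hne : w ≠ [] := by rintro rfl; simp [AdmW] at hA
  have h0 : DD 0 w = 0 := by simp [DD, Daux, hne]
  have h1 : DD 1 w = 0 := by simp [DD, Daux, hne]
  rw [hw] at hrec
  have hmem : ∀ d ∈ Finset.range (K - 1), ∀ W ∈ wordsOf d,
      (c W) • sumOp (K - d) (fun N => DD N W) ∈ Sp K := by
    intro d hd W hW
    rw [Finset.mem_range] at hd
    have hl : W.length = d := mem_wordsOf.1 hW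
    by_cases h : c W = 0
    · rw [h, zero_smul]; exact Submodule.zero_mem _
    refine Submodule.smul_mem _ _ ?_
    have e : K = d + (K - d) := by omega
    have : (fun N => DD N W) ∈ Sp d := by
      rcases hc W h with rfl | hA'
      · refine Submodule.subset_span ⟨[], by simp, by simpa using hl, ?_⟩
        funext N; simp [DD_nil, zt]
      · exact ih d (by omega) W hl hA'
    have := sumOp_mem (i := K - d) (by omega) this
    rwa [← e] at this
  have key : (fun N => DD N w) = ∑ d ∈ Finset.range (K - 1), ∑ W ∈ wordsOf d,
      (c W) • sumOp (K - d) (fun N => DD N W) := by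
    have inc : ∀ N : ℕ, 1 ≤ N → DD (N+1) w = DD N w + ∑ d ∈ Finset.range (K - 1), ∑ W ∈ wordsOf d,
        (c W : ℝ) * ((1 / (N:ℝ)^(K-d)) * DD N W) := by
      intro N hN
      have hN0 : (N:ℝ) ≠ 0 := by positivity
      have := hrec N hN
      apply mul_left_cancel₀ (pow_ne_zero K hN0)
      rw [this, mul_add, Finset.mul_sum]
      congr 1
      refine Finset.sum_congr rfl fun d hd => ?_
      rw [Finset.mem_range] at hd
      rw [Finset.mul_sum]
      refine Finset.sum_congr rfl fun W _ => ?_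
      have e : (N:ℝ)^K = (N:ℝ)^d * (N:ℝ)^(K-d) := by rw [← pow_add]; congr 1; omega
      rw [e]; field_simp
    have val : ∀ N : ℕ, (∑ d ∈ Finset.range (K - 1), ∑ W ∈ wordsOf d,
        (c W) • sumOp (K - d) (fun N => DD N W)) N = ∑ d ∈ Finset.range (K - 1), ∑ W ∈ wordsOf d,
        (c W : ℝ) * ∑ n ∈ Finset.Ico 1 N, (1 / (n:ℝ)^(K-d)) * DD n W := by
      intro N
      simp [Finset.sum_apply, sumOp]
    funext N
    rw [val]
    induction N with
    | zero => simp [h0]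
    | succ N ihN =>
      rcases Nat.eq_zero_or_pos N with rfl | hN
      · simp [h1]
      · rw [inc N hN, ihN, ← Finset.sum_add_distrib]
        refine Finset.sum_congr rfl fun d _ => ?_
        rw [← Finset.sum_add_distrib]
        refine Finset.sum_congr rfl fun W _ => ?_
        rw [Finset.sum_Ico_succ_top hN]; ring
  rw [key]
  exact Submodule.sum_mem _ fun d hd => Submodule.sum_mem _ fun W hW => hmem d hd W hW

/-- one step of the asymmetric sums -/
def gstep (p q : ℝ) (D : List Bool → ℝ) : List Bool → ℝ
  | [] => D []
  | true :: W => D (true :: W) + p * D W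
  | false :: W => D (false :: W) + q * gstep p q D W

/-- partial asymmetric sums -/
noncomputable def Gaux (N : ℕ) : ℕ → List Bool → ℝ
  | 0 => fun W => if W = [] then 1 else 0
  | j+1 => gstep (1 / ((N:ℝ) - (j+1))) (1 / ((j:ℝ)+1)) (Gaux N j)

/-- coefficients -/
noncomputable def CC : List Bool → ℕ → ℝ
  | [] => fun n => if n = 0 then 1 else 0
  | false :: W => fun n => CC W n / n
  | true :: W => fun n => (∑ i ∈ Finset.range n, CC W i) / n

lemma CC_zero {w : List Bool} (hw : w ≠ []) : CC w 0 = 0 := by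
  rcases w with _ | ⟨_ | _, W⟩
  · simp at hw
  · simp [CC]
  · simp [CC]

lemma Gaux_nil (N j : ℕ) : Gaux N j [] = 1 := by
  induction j with
  | zero => simp [Gaux]
  | succ j ih => simp [Gaux, gstep, ih]

lemma abel_tel (C t : ℕ → ℝ) (M : ℕ) :
    ∑ n ∈ Finset.range M, (∑ i ∈ Finset.range (n+1), C i) * (t n - t (n+1)) =
      ∑ n ∈ Finset.range M, C n * t n - (∑ i ∈ Finset.range M, C i) * t M := by
  induction M with
  | zero => simp
  | succ M ih =>
    rw [Finset.sum_range_succ, ih, Finset.sum_range_succ (fun n => C n * t n),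
      Finset.sum_range_succ C M]
    ring

lemma choose_real (m n : ℕ) : ((m.choose (n+1) : ℕ) : ℝ) * (n+1) = (m.choose n : ℕ) * ((m:ℝ) - n) := by
  rcases le_or_gt n m with h | h
  · have := Nat.choose_succ_right_eq m n
    rw [← Nat.cast_sub h]; exact_mod_cast this
  · rw [Nat.choose_eq_zero_of_lt h, Nat.choose_eq_zero_of_lt (by omega)]; simp

lemma Gaux_formula (M : ℕ) (w : List Bool) (hw : w = [] ∨ w.getLast? = some true) :
    ∀ m ≤ M, Gaux (M+1) m w =
      ∑ n ∈ Finset.range (M+1), CC w n * ((m.choose n : ℕ) / (M.choose n : ℕ) : ℝ) := by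
  induction w with
  | nil =>
    intro m _
    rw [Gaux_nil, Finset.sum_range_succ']
    simp [CC]
  | cons e W ih =>
    intro m
    induction m with
    | zero =>
      intro _
      rw [Finset.sum_range_succ', CC_zero (by simp)]
      simp [Gaux]
    | succ m ihm =>
      intro hm
      have ihm := ihm (by omega)
      cases e with
      | false =>
        have hWne : W ≠ [] := by rintro rfl; simp at hw
        have hW : W = [] ∨ W.getLast? = some true := by
          right
          rcases hw with h | h
          · simp at h
          · rcases W with _ | ⟨a, W⟩
            · simp at hWne
            · simpa [List.getLast?_cons_cons] using h
        have := ih hW (m+1) hm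
        have e1 : Gaux (M+1) (m+1) (false :: W) =
          Gaux (M+1) m (false :: W) + (1 / ((m:ℝ)+1)) * Gaux (M+1) (m+1) W := rfl
        rw [e1, this, ihm, Finset.mul_sum, ← Finset.sum_add_distrib]
        refine Finset.sum_congr rfl fun n hn => ?_
        rcases n with _ | n
        · simp [CC, CC_zero hWne]
        · have hB : ((M.choose (n+1) : ℕ) : ℝ) ≠ 0 := by
            have := Nat.choose_pos (n := M) (k := n+1) (by simp at hn; omega)
            positivity
          have h1 : (((m+1).choose (n+1) : ℕ) : ℝ) = (m.choose n : ℕ) + (m.choose (n+1) : ℕ) := by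
            rw [Nat.choose_succ_succ]; push_cast; rfl
          have h2 : ((m:ℝ)+1) * (m.choose n : ℕ) = (((m+1).choose (n+1) : ℕ) : ℝ) * (n+1) := by
            exact_mod_cast Nat.add_one_mul_choose_eq m n
          have hm0 : ((m:ℝ)+1) ≠ 0 := by positivity
          have hn0 : ((n:ℝ)+1) ≠ 0 := by positivity
          simp only [CC]
          push_cast
          have h3 : (((m+1).choose (n+1) : ℕ) : ℝ) / (m+1) = (m.choose n : ℕ) / ((n:ℝ)+1) := by
            rw [div_eq_div_iff hm0 hn0, ← h2]; ring
          have h4 : 1 / ((m:ℝ)+1) * (CC W (n+1) * ((((m+1).choose (n+1) : ℕ) : ℝ) / (M.choose (n+1) : ℕ)))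
            = CC W (n+1) / (M.choose (n+1) : ℕ) * ((((m+1).choose (n+1) : ℕ) : ℝ) / (m+1)) := by ring
          rw [h4, h3, h1]
          ring
      | true =>
        have hW : W = [] ∨ W.getLast? = some true := by
          rcases W with _ | ⟨a, W⟩
          · simp
          · right
            rcases hw with h | h
            · simp at h
            · simpa [List.getLast?_cons_cons] using h
        have := ih hW m (by omega)
        have e1 : Gaux (M+1) (m+1) (true :: W) =
          Gaux (M+1) m (true :: W) + (1 / (((M+1:ℕ):ℝ) - (m+1))) * Gaux (M+1) m W := rfl
        have hMm : (M:ℝ) - m ≠ 0 := by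
          have : (m:ℝ) + 1 ≤ M := by exact_mod_cast hm
          intro h; linarith
        set t : ℕ → ℝ := fun n => ((m.choose n : ℕ) / (M.choose n : ℕ) : ℝ) / ((M:ℝ) - m) with ht
        have tM : t M = 0 := by
          simp [ht, Nat.choose_eq_zero_of_lt (show m < M by omega)]
        have key := abel_tel (CC W) t M
        rw [tM, mul_zero, sub_zero] at key
        have e2 : (1 / (((M+1:ℕ):ℝ) - (m+1))) * Gaux (M+1) m W =
            ∑ n ∈ Finset.range M, CC W n * t n := by
          rw [this, Finset.mul_sum, Finset.sum_range_succ,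
            Nat.choose_eq_zero_of_lt (show m < M by omega)]
          push_cast
          simp only [zero_div, mul_zero, add_zero]
          refine Finset.sum_congr rfl fun n _ => ?_
          rw [ht]
          have : (M:ℝ) + 1 - (m+1) = M - m := by ring
          rw [this]; ring
        rw [e1, e2, ← key, ihm, Finset.sum_range_succ', Finset.sum_range_succ' (n := M)]
        rw [CC_zero (by simp)]
        simp only [zero_mul, add_zero]
        rw [← Finset.sum_add_distrib]
        refine Finset.sum_congr rfl fun n hn => ?_
        rw [Finset.mem_range] at hn
        have hB : ((M.choose n : ℕ) : ℝ) ≠ 0 := by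
          have := Nat.choose_pos (n := M) (k := n) (by omega)
          positivity
        have hB' : ((M.choose (n+1) : ℕ) : ℝ) ≠ 0 := by
          have := Nat.choose_pos (n := M) (k := n+1) (by omega)
          positivity
        have h1 : (((m+1).choose (n+1) : ℕ) : ℝ) = (m.choose n : ℕ) + (m.choose (n+1) : ℕ) := by
          rw [Nat.choose_succ_succ]; push_cast; rfl
        have hn0 : ((n:ℝ)+1) ≠ 0 := by positivity
        have hMn : (M:ℝ) - n ≠ 0 := by
          have : (n:ℝ) + 1 ≤ M := by exact_mod_cast hn
          intro h; linarith
        have c1 : ((m.choose (n+1) : ℕ) : ℝ) = (m.choose n : ℕ) * ((m:ℝ) - n) / (n+1) := by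
          rw [← choose_real]; field_simp
        have c2 : ((M.choose (n+1) : ℕ) : ℝ) = (M.choose n : ℕ) * ((M:ℝ) - n) / (n+1) := by
          rw [← choose_real]; field_simp
        have h3 : ((m.choose n : ℕ) : ℝ) / (M.choose (n+1) : ℕ) / (n+1) = t n - t (n+1) := by
          simp only [ht]
          rw [c1, c2]
          field_simp
          ring
        rw [← h3, h1]
        simp only [CC]
        push_cast
        ring

/-- the word of an index -/
def wordI : List ℕ → List Bool
  | [] => []
  | k :: l => List.replicate (k-1) false ++ true :: wordI l

lemma CC_replicate (j : ℕ) (W : List Bool) (n : ℕ) :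
    CC (List.replicate j false ++ W) n = CC W n / (n:ℝ)^j := by
  induction j with
  | zero => simp
  | succ j ih => rw [List.replicate_succ, List.cons_append, CC]; beta_reduce; rw [ih, pow_succ, div_div]

lemma sum_CC (l : List ℕ) (hl : ∀ y ∈ l, 1 ≤ y) : ∀ N, 1 ≤ N →
    ∑ n ∈ Finset.range N, CC (wordI l) n = zt l N := by
  induction l with
  | nil =>
    intro N hN
    obtain ⟨M, rfl⟩ : ∃ M, N = M+1 := ⟨N-1, by omega⟩
    rw [Finset.sum_range_succ']
    simp [wordI, CC, zt]
  | cons k l ih =>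
    intro N hN
    have hk : 1 ≤ k := hl k (by simp)
    rw [zt, Finset.range_eq_Ico, Finset.sum_eq_sum_Ico_succ_bot hN, CC_zero (by simp [wordI]), zero_add]
    refine Finset.sum_congr rfl fun n hn => ?_
    rw [Finset.mem_Ico] at hn
    rw [wordI, CC_replicate, CC]; beta_reduce
    rw [ih (fun y hy => hl y (by simp [hy])) n (by omega), div_div, ← pow_succ']
    rw [show k - 1 + 1 = k by omega]; ring

lemma wordI_last (l : List ℕ) : wordI l = [] ∨ (wordI l).getLast? = some true := by
  induction l with
  | nil => simp [wordI]
  | cons k l ih =>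
    right
    rw [wordI, List.getLast?_append]
    rcases ih with h | h
    · simp [h]
    · simp [List.getLast?_cons, h]

theorem Gaux_zt (l : List ℕ) (hl : ∀ y ∈ l, 1 ≤ y) (M : ℕ) :
    Gaux (M+1) M (wordI l) = zt l (M+1) := by
  rw [Gaux_formula M _ (wordI_last l) M le_rfl, ← sum_CC l hl _ (by omega)]
  refine Finset.sum_congr rfl fun n hn => ?_
  rw [Finset.mem_range] at hn
  have : ((M.choose n : ℕ) : ℝ) ≠ 0 := by
    have := Nat.choose_pos (n := M) (k := n) (by omega)
    positivity
  rw [div_self this, mul_one]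

lemma wordI_length (l : List ℕ) (hl : ∀ y ∈ l, 1 ≤ y) : (wordI l).length = l.sum := by
  induction l with
  | nil => simp [wordI]
  | cons k l ih =>
    have hk : 1 ≤ k := hl k (by simp)
    simp [wordI, ih (fun y hy => hl y (by simp [hy]))]; omega

lemma wordI_adm (k : ℕ) (l : List ℕ) (hk : 2 ≤ k) : AdmW (wordI (k :: l)) := by
  refine ⟨?_, ?_⟩
  · rw [wordI, show k - 1 = (k-2)+1 by omega, List.replicate_succ]; simp
  · rcases wordI_last (k :: l) with h | h
    · simp [wordI] at h
    · exact h

/-- harmonic type sum -/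
noncomputable def Lh (N m : ℕ) : ℝ := ∑ j ∈ Finset.range m, (1 / ((N:ℝ) - (j+1)) + 1 / ((j:ℝ)+1))

/-- majorant -/
noncomputable def Hh (N : ℕ) : ℝ := 1 + Lh N (N-1)

section
variable {N : ℕ}

lemma p_pos {j : ℕ} (h : j + 1 < N) : 0 < 1 / ((N:ℝ) - (j+1)) := by
  have : (j:ℝ) + 1 < N := by exact_mod_cast h
  have : 0 < (N:ℝ) - (j+1) := by linarith
  positivity

lemma q_pos (j : ℕ) : 0 < 1 / ((j:ℝ) + 1) := by positivity

lemma Lh_le {m : ℕ} (h : m < N) : Lh N m ≤ Lh N (N-1) := by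
  unfold Lh
  refine Finset.sum_le_sum_of_subset_of_nonneg ?_ ?_
  · intro x hx; simp at hx ⊢; omega
  · intro j hj _
    simp at hj
    exact (add_pos (p_pos (by omega)) (q_pos j)).le

lemma Lh_nonneg {m : ℕ} (h : m < N) : 0 ≤ Lh N m := by
  unfold Lh
  refine Finset.sum_nonneg fun j hj => ?_
  simp at hj
  exact (add_pos (p_pos (by omega)) (q_pos j)).le

lemma Hh_one (h : 0 < N) : 1 ≤ Hh N := by
  have := Lh_nonneg (N := N) (m := N-1) (by omega)
  unfold Hh; linarith

/-- intermediate sums -/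
noncomputable def Uaux (N j : ℕ) : List Bool → ℝ := step true (1 / ((N:ℝ) - (j+1))) (Daux N j)

lemma U_nil (j : ℕ) : Uaux N j [] = 1 := by simp [Uaux, step, Daux_nil]
lemma U_true (j : ℕ) (W) : Uaux N j (true :: W) = Daux N j (true :: W) + (1 / ((N:ℝ) - (j+1))) * Uaux N j W := by
  simp [Uaux, step]
lemma U_false (j : ℕ) (W) : Uaux N j (false :: W) = Daux N j (false :: W) := by
  simp [Uaux, step]
lemma D_true (j : ℕ) (W) : Daux N (j+1) (true :: W) = Daux N j (true :: W) + (1 / ((N:ℝ) - (j+1))) * Uaux N j W := by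
  rw [← U_true]; simp [Daux, step, Uaux]
lemma D_false (j : ℕ) (W) : Daux N (j+1) (false :: W) = Daux N j (false :: W) + (1 / ((j:ℝ)+1)) * Daux N (j+1) W := by
  have := U_false (N := N) j W
  simp only [Uaux] at this
  simp [Daux, step]
lemma D_zero (e W) : Daux N 0 (e :: W) = 0 := by simp [Daux]
lemma G_zero (e W) : Gaux N 0 (e :: W) = 0 := by simp [Gaux]

lemma D_nonneg (W : List Bool) : ∀ m < N, 0 ≤ Daux N m W ∧ (∀ j, m = j+1 → 0 ≤ Uaux N j W ∧ Uaux N j W ≤ Daux N m W) := by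
  induction W with
  | nil => intro m _; simp [Daux_nil, U_nil]
  | cons e W ih =>
    intro m
    induction m with
    | zero => intro _; simp [D_zero]
    | succ m ihm =>
      intro h
      obtain ⟨a, -⟩ := ihm (by omega)
      obtain ⟨b, c⟩ := ih (m+1) h
      obtain ⟨c, d⟩ := c m rfl
      have hp := p_pos h
      have hq := q_pos m
      cases e with
      | false =>
        rw [D_false]
        refine ⟨by positivity, ?_⟩
        intro j hj
        obtain rfl : m = j := by omega
        rw [U_false]
        refine ⟨a, ?_⟩
        have : 0 ≤ 1 / ((m:ℝ)+1) * Daux N (m+1) W := by positivity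
        linarith
      | true =>
        rw [D_true]
        refine ⟨by positivity, ?_⟩
        intro j hj
        obtain rfl : m = j := by omega
        rw [U_true]
        exact ⟨by positivity, le_rfl⟩

lemma D_le (W : List Bool) : ∀ m < N, Daux N m W ≤ Hh N ^ W.length := by
  induction W with
  | nil => intro m _; simp [Daux_nil]
  | cons e W ih =>
    have key : ∀ m < N, Daux N m (e :: W) ≤ Lh N m * Hh N ^ W.length := by
      intro m
      induction m with
      | zero => intro _; simp [D_zero, Lh]
      | succ m ihm =>
        intro h
        have a := ihm (by omega)
        have b := ih (m+1) h
        obtain ⟨c, d⟩ := (D_nonneg W (m+1) h).2 m rfl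
        have hp := p_pos h
        have hq := q_pos m
        have hL : Lh N (m+1) = Lh N m + (1 / ((N:ℝ) - (m+1)) + 1 / ((m:ℝ)+1)) := by
          simp [Lh, Finset.sum_range_succ]
        have hH : 0 ≤ Hh N ^ W.length := pow_nonneg (by linarith [Hh_one (N := N) (by omega)]) _
        rw [hL, add_mul, add_mul]
        have p1 := mul_le_mul_of_nonneg_left b hq.le
        have p2 := mul_le_mul_of_nonneg_left (d.trans b) hp.le
        have p3 := mul_nonneg hq.le hH
        have p4 := mul_nonneg hp.le hH
        cases e with
        | false => rw [D_false]; linarith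
        | true => rw [D_true]; linarith
    intro m h
    refine (key m h).trans ?_
    rw [List.length_cons, pow_succ']
    have hH : 0 ≤ Hh N ^ W.length := pow_nonneg (by linarith [Hh_one (N := N) (by omega)]) _
    refine mul_le_mul_of_nonneg_right ?_ hH
    have := Lh_le h
    unfold Hh; linarith

end

/-- difference -/
noncomputable def EE (N m : ℕ) (W : List Bool) : ℝ := Daux N m W - Gaux N m W

/-- the bound -/
def Bd (K : ℝ) (W : List Bool) : Prop :=
  0 ≤ K ∧ ∀ N m, m < N → 0 ≤ EE N m W ∧ EE N m W ≤ K * Hh N ^ W.length / ((N:ℝ) - m)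

lemma E_false (N j : ℕ) (W) : EE N (j+1) (false :: W) = EE N j (false :: W) + (1 / ((j:ℝ)+1)) * EE N (j+1) W := by
  have : Gaux N (j+1) (false :: W) = Gaux N j (false :: W) + (1 / ((j:ℝ)+1)) * Gaux N (j+1) W := rfl
  simp only [EE]; rw [D_false, this]; ring

lemma E_true (N j : ℕ) (W) : EE N (j+1) (true :: W) = EE N j (true :: W) + (1 / ((N:ℝ) - (j+1))) * (Uaux N j W - Gaux N j W) := by
  have : Gaux N (j+1) (true :: W) = Gaux N j (true :: W) + (1 / ((N:ℝ) - (j+1))) * Gaux N j W := rfl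
  simp only [EE]; rw [D_true, this]; ring

lemma Bd_false_strong {K : ℝ} {W : List Bool} (h : Bd K W) : ∀ N m, m < N →
    0 ≤ EE N m (false :: W) ∧ EE N m (false :: W) ≤ K * Hh N ^ (W.length + 1) / N := by
  obtain ⟨hK, h⟩ := h
  have key : ∀ N m, m < N → 0 ≤ EE N m (false :: W) ∧
      EE N m (false :: W) ≤ K * Hh N ^ W.length / N * Lh N m := by
    intro N m
    induction m with
    | zero => intro _; simp [EE, D_zero, G_zero, Lh]
    | succ m ih =>
      intro hm
      obtain ⟨a, b⟩ := ih (by omega)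
      obtain ⟨c, d⟩ := h N (m+1) hm
      have hq := q_pos m
      rw [E_false]
      refine ⟨by positivity, ?_⟩
      have hL : Lh N (m+1) = Lh N m + (1 / ((N:ℝ) - (m+1)) + 1 / ((m:ℝ)+1)) := by
        simp [Lh, Finset.sum_range_succ]
      have p1 := mul_le_mul_of_nonneg_left d hq.le
      have hN : (N:ℝ) ≠ 0 := by
        have : 0 < N := by omega
        positivity
      have hNm : (N:ℝ) - (m+1) ≠ 0 := by
        have : (m:ℝ) + 1 < N := by exact_mod_cast hm
        intro h; linarith
      have hm0 : (m:ℝ) + 1 ≠ 0 := by positivity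
      have e : 1 / ((m:ℝ)+1) * (K * Hh N ^ W.length / ((N:ℝ) - ((m+1 : ℕ):ℝ))) =
          K * Hh N ^ W.length / N * (1 / ((N:ℝ) - (m+1)) + 1 / ((m:ℝ)+1)) := by
        push_cast
        field_simp
        ring
      rw [hL, mul_add]
      linarith
  intro N m hm
  obtain ⟨a, b⟩ := key N m hm
  refine ⟨a, b.trans ?_⟩
  have hH1 := Hh_one (N := N) (by omega)
  have : Lh N m ≤ Hh N := by have := Lh_le hm; unfold Hh; linarith
  have hH : 0 ≤ K * Hh N ^ W.length / N := by positivity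
  calc _ ≤ K * Hh N ^ W.length / N * Hh N := mul_le_mul_of_nonneg_left this hH
    _ = _ := by rw [pow_succ]; ring

lemma Bd_false {K : ℝ} {W : List Bool} (h : Bd K W) : Bd K (false :: W) := by
  refine ⟨h.1, fun N m hm => ?_⟩
  obtain ⟨a, b⟩ := Bd_false_strong h N m hm
  refine ⟨a, b.trans ?_⟩
  have hH1 := Hh_one (N := N) (by omega)
  have hK := h.1
  have : (m:ℝ) < N := by exact_mod_cast hm
  have h0 : (0:ℝ) ≤ m := by positivity
  rw [List.length_cons]
  apply div_le_div_of_nonneg_left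
  · positivity
  · linarith
  · linarith

lemma Bd_true {K : ℝ} {W : List Bool} (h : Bd K W) : Bd (2 * (K+1)) (true :: W) := by
  obtain ⟨hK, h⟩ := h
  refine ⟨by positivity, fun N m => ?_⟩
  have key : m < N → 0 ≤ EE N m (true :: W) ∧ EE N m (true :: W) ≤ 2 * ((K + 1) * Hh N ^ W.length) / ((N:ℝ) - m) := by
    induction m with
    | zero =>
      intro hN
      simp [EE, D_zero, G_zero]
      have := Hh_one (N := N) (by omega)
      positivity
    | succ m ih =>
      intro hm
      obtain ⟨a, b⟩ := ih (by omega)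
      obtain ⟨c, d⟩ := h N m (by omega)
      have hp := p_pos hm
      have hH1 := Hh_one (N := N) (by omega)
      have hm' : (m:ℝ) + 1 < N := by exact_mod_cast hm
      have hu : 0 ≤ Uaux N m W - Gaux N m W ∧ Uaux N m W - Gaux N m W ≤ EE N m W + 1 / ((N:ℝ) - (m+1)) * Hh N ^ W.length := by
        rcases W with _ | ⟨_ | _, V⟩
        · rw [U_nil, Gaux_nil]; simp [EE, Daux_nil, Gaux_nil]; linarith
        · rw [U_false]
          change 0 ≤ EE N m (false :: V) ∧ EE N m (false :: V) ≤ _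
          have : 0 ≤ 1 / ((N:ℝ) - (m+1)) * Hh N ^ (false :: V).length := by positivity
          exact ⟨c, by linarith⟩
        · rw [U_true]
          obtain ⟨u1, u2⟩ := (D_nonneg V (m+1) hm).2 m rfl
          have u3 := D_le V (m+1) hm
          have u4 : Hh N ^ V.length ≤ Hh N ^ (true :: V).length :=
            pow_le_pow_right₀ hH1 (by simp)
          have u5 := mul_le_mul_of_nonneg_left (u2.trans (u3.trans u4)) hp.le
          have u6 := mul_nonneg hp.le u1
          have : Daux N m (true :: V) + 1 / ((N:ℝ) - (m+1)) * Uaux N m V - Gaux N m (true :: V) =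
            EE N m (true :: V) + 1 / ((N:ℝ) - (m+1)) * Uaux N m V := by unfold EE; ring
          rw [this]
          exact ⟨by linarith, by linarith⟩
      rw [E_true]
      refine ⟨add_nonneg a (mul_nonneg hp.le hu.1), ?_⟩
      set A := Hh N ^ W.length
      have hA : 0 ≤ A := by positivity
      set x : ℝ := (N:ℝ) - (m+1) with hx
      have hx1 : 1 ≤ x := by
        have : (m:ℝ) + 1 + 1 ≤ N := by exact_mod_cast hm
        linarith
      have e1 : (N:ℝ) - m = x + 1 := by rw [hx]; ring
      have e2 : (N:ℝ) - ((m+1:ℕ):ℝ) = x := by rw [hx]; push_cast; ring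
      rw [e1] at b d
      rw [e2]
      have d2 : EE N m W ≤ 1 / x * (K * A) := by
        refine d.trans ?_
        rw [one_div, ← div_eq_inv_mul]
        apply div_le_div_of_nonneg_left <;> first | positivity | linarith
      have d3 : 1 / x * (Uaux N m W - Gaux N m W) ≤ 1 / x * (1 / x * ((K+1) * A)) := by
        refine mul_le_mul_of_nonneg_left ?_ hp.le
        refine hu.2.trans ?_
        have : 1 / x * ((K+1) * A) = 1 / x * (K * A) + 1 / x * A := by ring
        rw [this]; linarith
      set B := (K+1) * A with hB
      have hB0 : 0 ≤ B := by positivity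
      have d4 : 2 * B / (x+1) + 1 / x * (1 / x * B) ≤ 2 * B / x := by
        have hx0 : 0 < x := by linarith
        have : 2 * B / x - (2 * B / (x+1) + 1 / x * (1 / x * B)) = B * (x - 1) / (x^2 * (x+1)) := by
          field_simp; ring
        have h2 : 0 ≤ B * (x - 1) / (x^2 * (x+1)) := by
          have : 0 ≤ x - 1 := by linarith
          positivity
        linarith
      linarith
  intro hm
  obtain ⟨a, b⟩ := key hm
  refine ⟨a, b.trans ?_⟩
  have hH1 := Hh_one (N := N) (by omega)
  have hm' : (m:ℝ) < N := by exact_mod_cast hm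
  have : 0 < (N:ℝ) - m := by linarith
  rw [mul_assoc 2]
  have u4 : Hh N ^ W.length ≤ Hh N ^ (true :: W).length := pow_le_pow_right₀ hH1 (by simp)
  gcongr

lemma exists_Bd (W : List Bool) : ∃ K, Bd K W := by
  induction W with
  | nil => exact ⟨0, le_rfl, fun N m _ => by simp [EE, Daux_nil, Gaux_nil]⟩
  | cons e W ih =>
    obtain ⟨K, h⟩ := ih
    cases e
    · exact ⟨K, Bd_false h⟩
    · exact ⟨_, Bd_true h⟩

lemma Lh_full (M : ℕ) : Lh (M+1) M = 2 * (harmonic M : ℝ) := by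
  unfold Lh
  rw [Finset.sum_add_distrib, two_mul]
  have h : (harmonic M : ℝ) = ∑ j ∈ Finset.range M, 1 / ((j:ℝ)+1) := by
    simp [harmonic]
  rw [h]
  congr 1
  rw [← Finset.sum_range_reflect]
  refine Finset.sum_congr rfl fun j hj => ?_
  rw [Finset.mem_range] at hj
  congr 1
  have : M - 1 - j + (j + 1) = M := by omega
  have : ((M - 1 - j : ℕ):ℝ) + (j + 1) = M := by exact_mod_cast this
  push_cast
  linarith

open Filter Topology in
lemma Hh_tendsto (s : ℕ) : Tendsto (fun M : ℕ => Hh (M+1) ^ s / ((M+1:ℕ):ℝ)) atTop (𝓝 0) := by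
  have h1 : Tendsto (fun x : ℝ => (3 + 2 * Real.log x)^s / x) atTop (𝓝 0) := by
    have h0 : (fun x : ℝ => (3 + 2 * Real.log x)) =O[atTop] Real.log := by
      refine Asymptotics.IsBigO.add ?_ ?_
      · exact ((Asymptotics.isLittleO_const_left).2 (Or.inr (tendsto_norm_atTop_atTop.comp Real.tendsto_log_atTop))).isBigO
      · exact (Asymptotics.isBigO_refl _ _).const_mul_left 2
    have := (h0.pow s).trans_isLittleO (Real.isLittleO_pow_log_id_atTop (n := s))
    exact this.tendsto_div_nhds_zero
  have h2 := h1.comp (tendsto_natCast_atTop_atTop.comp (tendsto_add_atTop_nat 1))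
  refine squeeze_zero (fun M => ?_) (fun M => ?_) h2
  · have := Hh_one (N := M+1) (by omega)
    positivity
  · have hh := Hh_one (N := M+1) (by omega)
    have : Hh (M+1) ≤ 3 + 2 * Real.log ((M+1:ℕ):ℝ) := by
      unfold Hh
      rw [Nat.add_sub_cancel, Lh_full]
      have a := harmonic_le_one_add_log M
      have b : Real.log M ≤ Real.log ((M+1:ℕ):ℝ) := by
        rcases Nat.eq_zero_or_pos M with rfl | h
        · simp
        · apply Real.log_le_log (by exact_mod_cast h); push_cast; linarith
      linarith
    simp only [Function.comp]
    gcongr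

open Filter Topology in
theorem D_sub_zt (k : ℕ) (l : List ℕ) (hk : 2 ≤ k) (hl : ∀ y ∈ l, 1 ≤ y) :
    Tendsto (fun M : ℕ => DD (M+1) (wordI (k :: l)) - zt (k :: l) (M+1)) atTop (𝓝 0) := by
  obtain ⟨W, hW⟩ : ∃ W, wordI (k :: l) = false :: W := by
    rw [wordI, show k - 1 = (k-2)+1 by omega, List.replicate_succ]; exact ⟨_, rfl⟩
  obtain ⟨K, hK⟩ := exists_Bd W
  have hl' : ∀ y ∈ k :: l, 1 ≤ y := by
    intro y hy
    rcases List.mem_cons.1 hy with rfl | hy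
    · omega
    · exact hl y hy
  have e : ∀ M : ℕ, DD (M+1) (wordI (k :: l)) - zt (k :: l) (M+1) = EE (M+1) M (false :: W) := by
    intro M
    rw [← Gaux_zt _ hl', hW]; rfl
  simp only [e]
  have h := (Hh_tendsto (W.length + 1)).const_mul K
  rw [mul_zero] at h
  refine squeeze_zero (fun M => (Bd_false_strong hK _ _ (by omega)).1) (fun M => ?_) h
  have := (Bd_false_strong hK (M+1) M (by omega)).2
  rwa [mul_div_assoc] at this

/-- truncated sums, tail version -/
noncomputable def Tt : List ℕ → ℕ → ℕ → ℝ
  | [] => fun _ _ => 1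
  | a :: k => fun M N => ∑ n ∈ Finset.Ico (M+1) N, (1 / (n:ℝ)^a) * Tt k n N

lemma Tt_cons (a k M N) : Tt (a :: k) M N = ∑ n ∈ Finset.Ico (M+1) N, (1 / (n:ℝ)^a) * Tt k n N := rfl

lemma Tt_snoc (a : ℕ) (k : List ℕ) : ∀ M N, Tt (k ++ [a]) M N =
    ∑ n ∈ Finset.Ico (M+1) N, (1 / (n:ℝ)^a) * Tt k M n := by
  induction k with
  | nil => intro M N; simp [Tt]
  | cons b k ih =>
    intro M N
    rw [List.cons_append, Tt_cons]
    simp only [ih, Tt_cons, Finset.mul_sum]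
    rw [Finset.sum_Ico_Ico_comm']
    refine Finset.sum_congr rfl fun n _ => Finset.sum_congr rfl fun m _ => by ring

lemma Tt_reverse (l : List ℕ) : ∀ N, Tt l.reverse 0 N = zt l N := by
  induction l with
  | nil => intro N; simp [Tt, zt]
  | cons a l ih => intro N; rw [List.reverse_cons, Tt_snoc, zt]; simp [ih]

/-- finite sets of increasing tuples -/
noncomputable def Sf (r M N : ℕ) : Finset (Fin r → ℕ) :=
  (Fintype.piFinset (fun _ => Finset.range N)).filter (fun n => StrictMono n ∧ ∀ i, M < n i)

lemma mem_Sf {r M N : ℕ} {n : Fin r → ℕ} :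
    n ∈ Sf r M N ↔ (∀ i, n i < N) ∧ StrictMono n ∧ ∀ i, M < n i := by
  simp [Sf]

lemma sMono_cons {r a : ℕ} {f : Fin r → ℕ} :
    StrictMono (Fin.cons a f : Fin (r+1) → ℕ) ↔ StrictMono f ∧ ∀ i, a < f i := by
  constructor
  · intro h
    refine ⟨fun i j hij => ?_, fun i => ?_⟩
    · have := h (Fin.succ_lt_succ_iff.2 hij); simpa using this
    · have := h (Fin.succ_pos i); simpa using this
  · rintro ⟨h1, h2⟩ i j hij
    induction i using Fin.cases with
    | zero =>
      induction j using Fin.cases with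
      | zero => simp at hij
      | succ j => simpa using h2 j
    | succ i =>
      induction j using Fin.cases with
      | zero => simp at hij
      | succ j => simpa using h1 (Fin.succ_lt_succ_iff.1 hij)

lemma mem_Sf_cons {r M N a : ℕ} {f : Fin r → ℕ} :
    (Fin.cons a f : Fin (r+1) → ℕ) ∈ Sf (r+1) M N ↔ a ∈ Finset.Ico (M+1) N ∧ f ∈ Sf r a N := by
  rw [mem_Sf, mem_Sf, sMono_cons, Fin.forall_fin_succ, Fin.forall_fin_succ, Finset.mem_Ico]
  simp only [Fin.cons_zero, Fin.cons_succ]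
  constructor
  · rintro ⟨⟨a1, a2⟩, ⟨a3, a4⟩, a5, a6⟩
    exact ⟨⟨a5, a1⟩, a2, a3, a4⟩
  · rintro ⟨⟨a5, a1⟩, a2, a3, a4⟩
    exact ⟨⟨a1, a2⟩, ⟨a3, a4⟩, a5, fun i => lt_trans a5 (a4 i)⟩

lemma sum_Sf (k : List ℕ) : ∀ M N, ∑ n ∈ Sf k.length M N, ∏ i, (1:ℝ) / ((n i : ℝ) ^ k.get i) =
    Tt k M N := by
  induction k with
  | nil =>
    intro M N
    have : Sf ([] : List ℕ).length M N = {fun i => i.elim0} := by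
      ext n
      simp only [mem_Sf, Finset.mem_singleton]
      constructor
      · intro _; funext i; exact i.elim0
      · rintro rfl; exact ⟨fun i => i.elim0, fun i => i.elim0, fun i => i.elim0⟩
    rw [this]; simp [Tt]
  | cons a k ih =>
    intro M N
    rw [Tt_cons]
    simp only [← ih, Finset.mul_sum]
    rw [Finset.sum_sigma']
    refine Finset.sum_bij' (fun n _ => (⟨n 0, Fin.tail n⟩ : Σ _ : ℕ, (Fin k.length → ℕ)))
      (fun p _ => (Fin.cons p.1 p.2 : Fin (k.length+1) → ℕ)) ?_ ?_ ?_ ?_ ?_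
    · intro n hn
      rw [Finset.mem_sigma]
      rw [← Fin.cons_self_tail n] at hn
      exact mem_Sf_cons.1 hn
    · intro p hp
      rw [Finset.mem_sigma] at hp
      exact mem_Sf_cons.2 hp
    · intro n _; exact Fin.cons_self_tail n
    · rintro ⟨p, q⟩ _; simp
    · intro n _
      exact Fin.prod_univ_succ (n := k.length) (fun i => (1:ℝ) / ((n i : ℝ) ^ (a :: k).get i))

open Filter Topology in
theorem mzvL_of_tendsto (l : List ℕ) (L : ℝ) (h : Tendsto (zt l) atTop (𝓝 L)) :
    mzvL l.reverse = L := by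
  set k := l.reverse with hk
  set f : {n : Fin k.length → ℕ // StrictMono n ∧ ∀ i, 0 < n i} → ℝ :=
    fun n => ∏ i, (1 : ℝ) / ((n.1 i : ℝ) ^ k.get i) with hf
  have hf0 : ∀ n, 0 ≤ f n := fun n => Finset.prod_nonneg fun i _ => by positivity
  set s : ℕ → Finset {n : Fin k.length → ℕ // StrictMono n ∧ ∀ i, 0 < n i} :=
    fun N => (Sf k.length 0 N).subtype _ with hs
  have hsum : ∀ N, ∑ n ∈ s N, f n = zt l N := by
    intro N
    rw [← Tt_reverse, ← sum_Sf]
    rw [hs]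
    refine Finset.sum_subtype_of_mem (p := fun n : Fin k.length → ℕ => StrictMono n ∧ ∀ i, 0 < n i)
      (fun n => ∏ i, (1 : ℝ) / ((n i : ℝ) ^ k.get i)) ?_
    intro n hn; exact (mem_Sf.1 hn).2
  have hmono : Monotone s := by
    intro N N' hN n hn
    simp only [hs, Finset.mem_subtype, mem_Sf] at hn ⊢
    exact ⟨fun i => (hn.1 i).trans_le hN, hn.2⟩
  have hex : ∀ n, ∃ N, n ∈ s N := by
    intro n
    refine ⟨(∑ i, n.1 i) + 1, ?_⟩
    simp only [hs, Finset.mem_subtype, mem_Sf]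
    refine ⟨fun i => ?_, n.2⟩
    have := Finset.single_le_sum (f := n.1) (fun i _ => Nat.zero_le _) (Finset.mem_univ i)
    omega
  have hs_top := tendsto_atTop_finset_of_monotone hmono hex
  have hzm : Monotone (zt l) := by
    intro N N' hN
    rw [← hsum, ← hsum]
    exact Finset.sum_le_sum_of_subset_of_nonneg (hmono hN) fun n _ _ => hf0 n
  have hsm : Summable f := by
    refine summable_of_sum_le (c := L) hf0 fun u => ?_
    obtain ⟨N, hN⟩ := (hs_top.eventually (eventually_ge_atTop u)).exists
    calc ∑ x ∈ u, f x ≤ ∑ x ∈ s N, f x :=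
          Finset.sum_le_sum_of_subset_of_nonneg hN fun n _ _ => hf0 n
      _ = zt l N := hsum N
      _ ≤ L := hzm.ge_of_tendsto h N
  have h2 : Tendsto (fun N => ∑ n ∈ s N, f n) atTop (𝓝 (∑' n, f n)) := hsm.hasSum.comp hs_top
  simp only [hsum] at h2
  exact tendsto_nhds_unique h2 h

lemma zt_nonneg (l : List ℕ) : ∀ N, 0 ≤ zt l N := by
  induction l with
  | nil => intro N; simp [zt]
  | cons k l ih => intro N; exact Finset.sum_nonneg fun n _ => mul_nonneg (by positivity) (ih n)

lemma zt_mono (l : List ℕ) : Monotone (zt l) := by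
  rcases l with _ | ⟨k, l⟩
  · intro _ _ _; simp [zt]
  · intro N N' h
    refine Finset.sum_le_sum_of_subset_of_nonneg (Finset.Ico_subset_Ico le_rfl h) fun n _ _ => ?_
    exact mul_nonneg (by positivity) (zt_nonneg l n)

lemma zt_bdd (l : List ℕ) (hl : ∀ y ∈ l, 2 ≤ y) : ∃ B, ∀ N, zt l N ≤ B := by
  induction l with
  | nil => exact ⟨1, fun N => by simp [zt]⟩
  | cons k l ih =>
    obtain ⟨B, hB⟩ := ih (fun y hy => hl y (by simp [hy]))
    have hB0 : 0 ≤ B := (zt_nonneg l 0).trans (hB 0)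
    have hk : 2 ≤ k := hl k (by simp)
    have hsm : Summable (fun n : ℕ => 1 / (n:ℝ)^k) := Real.summable_one_div_nat_pow.2 (by omega)
    refine ⟨(∑' n : ℕ, 1 / (n:ℝ)^k) * B, fun N => ?_⟩
    calc zt (k :: l) N ≤ ∑ n ∈ Finset.Ico 1 N, (1 / (n:ℝ)^k) * B :=
          Finset.sum_le_sum fun n _ => mul_le_mul_of_nonneg_left (hB n) (by positivity)
      _ = (∑ n ∈ Finset.Ico 1 N, (1 / (n:ℝ)^k)) * B := by rw [Finset.sum_mul]
      _ ≤ _ := mul_le_mul_of_nonneg_right (hsm.sum_le_tsum _ fun n _ => by positivity) hB0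

/-- span of the values with entries at least two -/
noncomputable def Zs (k : ℕ) : Submodule ℤ ℝ :=
  Submodule.span ℤ {x | ∃ j : List ℕ, (∀ y ∈ j, 2 ≤ y) ∧ j.sum = k ∧ x = mzvL j}

open Filter Topology in
lemma Sp_tendsto {k : ℕ} {f : ℕ → ℝ} (hf : f ∈ Sp k) : ∃ L ∈ Zs k, Tendsto f atTop (𝓝 L) := by
  unfold Sp at hf
  induction hf using Submodule.span_induction with
  | mem f hf =>
    obtain ⟨l, h1, h2, rfl⟩ := hf
    obtain ⟨B, hB⟩ := zt_bdd l h1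
    have ht := tendsto_atTop_ciSup (zt_mono l) ⟨B, by rintro _ ⟨N, rfl⟩; exact hB N⟩
    refine ⟨_, Submodule.subset_span ⟨l.reverse, ?_, ?_, ?_⟩, ht⟩
    · intro y hy; exact h1 y (List.mem_reverse.1 hy)
    · rw [List.sum_reverse, h2]
    · exact (mzvL_of_tendsto l _ ht).symm
  | zero => exact ⟨0, Submodule.zero_mem _, tendsto_const_nhds⟩
  | add f g _ _ h1 h2 =>
    obtain ⟨L, a, b⟩ := h1
    obtain ⟨L', a', b'⟩ := h2
    exact ⟨L + L', Submodule.add_mem _ a a', b.add b'⟩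
  | smul c f _ h =>
    obtain ⟨L, a, b⟩ := h
    exact ⟨c • L, Submodule.smul_mem _ c a, b.const_smul c⟩

open Filter Topology in
theorem mzvL_adm_mem (a : ℕ) (l : List ℕ) (ha : 2 ≤ a) (hl : ∀ y ∈ l, 1 ≤ y) :
    mzvL (a :: l).reverse ∈ Zs (a :: l).sum := by
  have hl' : ∀ y ∈ a :: l, 1 ≤ y := by
    intro y hy
    rcases List.mem_cons.1 hy with rfl | hy
    · omega
    · exact hl y hy
  obtain ⟨L, hL, ht⟩ := Sp_tendsto (DD_mem _ _ (wordI_length _ hl') (wordI_adm a l ha))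
  have h1 := (ht.comp (tendsto_add_atTop_nat 1)).sub (D_sub_zt a l ha hl)
  rw [sub_zero] at h1
  have h2 : Tendsto (fun M => zt (a :: l) (M+1)) atTop (𝓝 L) := by
    refine h1.congr fun M => ?_
    simp [Function.comp]
  rw [mzvL_of_tendsto _ L ((tendsto_add_atTop_iff_nat 1).1 h2)]
  exact hL

/-- admissible lists -/
def AdmL (k : List ℕ) : Prop := (∀ y ∈ k, 1 ≤ y) ∧ ∃ m, k.getLast? = some m ∧ 2 ≤ m

lemma mzvL_adm {k : List ℕ} (h : AdmL k) : mzvL k ∈ Zs k.sum := by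
  obtain ⟨h1, m, h2, h3⟩ := h
  obtain ⟨l, rfl⟩ := List.getLast?_eq_some_iff.1 h2
  have := mzvL_adm_mem m l.reverse h3 (fun y hy => h1 y (by simp at hy; simp [hy]))
  simpa [add_comm] using this

lemma coars_adm (k : List ℕ) (h : AdmL k) : ∀ l ∈ coarsenings k, AdmL l ∧ l.sum = k.sum := by
  induction k with
  | nil => simp [AdmL] at h
  | cons a k ih =>
    obtain ⟨h1, m, h2, h3⟩ := h
    have ha : 1 ≤ a := h1 a (by simp)
    rcases k with _ | ⟨b, k⟩
    · intro l hl
      simp [coarsenings] at hl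
      subst hl
      exact ⟨⟨h1, m, h2, h3⟩, rfl⟩
    · have hb : AdmL (b :: k) := ⟨fun y hy => h1 y (by simp [List.mem_cons.1 hy]), m, by
        simpa [List.getLast?_cons_cons] using h2, h3⟩
      intro l hl
      rw [coarsenings, Finset.mem_union, Finset.mem_image, Finset.mem_image] at hl
      rcases hl with ⟨l, hl, rfl⟩ | ⟨l, hl, rfl⟩
      · obtain ⟨⟨p, m', q, r⟩, s⟩ := ih hb l hl
        rcases l with _ | ⟨c, t⟩
        · simp at q
        · refine ⟨⟨?_, m', ?_, r⟩, ?_⟩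
          · intro y hy
            rcases List.mem_cons.1 hy with rfl | hy
            · exact ha
            · exact p y hy
          · simpa [List.getLast?_cons_cons] using q
          · simp at s ⊢; omega
      · obtain ⟨⟨p, m', q, r⟩, s⟩ := ih hb l hl
        rcases l with _ | ⟨c, t⟩
        · simp at q
        · refine ⟨⟨?_, ?_⟩, ?_⟩
          · intro y hy
            rcases List.mem_cons.1 hy with rfl | hy
            · omega
            · exact p y (by simp [hy])
          · rcases t with _ | ⟨d, t⟩
            · simp at q; subst q; exact ⟨a + c, by simp, by omega⟩
            · exact ⟨m', by simpa [List.getLast?_cons_cons] using q, r⟩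
          · simp at s ⊢; omega

lemma coars_two (k : List ℕ) (h : ∀ y ∈ k, 2 ≤ y) : ∀ l ∈ coarsenings k,
    (∀ y ∈ l, 2 ≤ y) ∧ l.sum = k.sum ∧ (l = k ∨ l.length < k.length) := by
  induction k with
  | nil => intro l hl; simp [coarsenings] at hl; subst hl; simp
  | cons a k ih =>
    have ha : 2 ≤ a := h a (by simp)
    have ih := ih (fun y hy => h y (by simp [hy]))
    intro l hl
    rw [coarsenings, Finset.mem_union, Finset.mem_image, Finset.mem_image] at hl
    rcases hl with ⟨l, hl, rfl⟩ | ⟨l, hl, rfl⟩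
    · obtain ⟨p, q, r⟩ := ih l hl
      refine ⟨?_, by simp [q], ?_⟩
      · intro y hy
        rcases List.mem_cons.1 hy with rfl | hy
        · exact ha
        · exact p y hy
      · rcases r with rfl | r
        · left; rfl
        · right; simpa using r
    · obtain ⟨p, q, r⟩ := ih l hl
      rcases l with _ | ⟨c, t⟩
      · refine ⟨?_, ?_, ?_⟩
        · intro y hy; simp at hy; omega
        · simp at q ⊢; omega
        · rcases r with rfl | r
          · left; rfl
          · right; simpa using r
      · refine ⟨?_, ?_, ?_⟩
        · intro y hy
          rcases List.mem_cons.1 hy with rfl | hy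
          · omega
          · exact p y (by simp [hy])
        · simp at q ⊢; omega
        · right
          rcases r with rfl | r
          · simp
          · simp at r ⊢; omega

lemma self_coars (k : List ℕ) : k ∈ coarsenings k := by
  induction k with
  | nil => simp [coarsenings]
  | cons a k ih =>
    rw [coarsenings, Finset.mem_union, Finset.mem_image]
    exact Or.inl ⟨k, ih, rfl⟩

lemma mzvL_mem_star (k : ℕ) : ∀ (r : ℕ) (j : List ℕ), j.length = r → (∀ y ∈ j, 2 ≤ y) → j.sum = k →
    mzvL j ∈ Submodule.span ℤ {x : ℝ | ∃ l : Composition k, (∀ y ∈ l.blocks, 2 ≤ y) ∧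
      x = mzvStarL l.blocks} := by
  intro r
  induction r using Nat.strong_induction_on with
  | _ r ih =>
  intro j hr h2 hs
  have e : mzvL j = mzvStarL j - ∑ l ∈ (coarsenings j).erase j, mzvL l := by
    rw [mzvStarL, ← Finset.add_sum_erase _ _ (self_coars j)]; ring
  rw [e]
  refine Submodule.sub_mem _ ?_ (Submodule.sum_mem _ fun l hl => ?_)
  · exact Submodule.subset_span ⟨⟨j, fun {i} hi => lt_of_lt_of_le two_pos (h2 i hi), hs⟩, h2, rfl⟩
  · rw [Finset.mem_erase] at hl
    obtain ⟨p, q, s⟩ := coars_two j h2 l hl.2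
    rcases s with s | s
    · exact absurd s hl.1
    · exact ih l.length (by omega) l rfl p (q.trans hs)

/-- For every integer `k ≥ 2`, the `ℤ`-submodule of `ℝ` spanned by the
`ζ⋆(κ)` for `κ` admissible of weight `k` equals the `ℤ`-submodule spanned by the
`ζ⋆(l)` for `l` of weight `k` with all entries `≥ 2`. -/
theorem span_mzvStar_eq (k : ℕ) (hk : 2 ≤ k) :
    Submodule.span ℤ {x : ℝ | ∃ κ : Composition k,
        (∃ m, κ.blocks.getLast? = some m ∧ 2 ≤ m) ∧ x = mzvStarL κ.blocks} =
      Submodule.span ℤ {x : ℝ | ∃ l : Composition k,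
        (∀ y ∈ l.blocks, 2 ≤ y) ∧ x = mzvStarL l.blocks} := by
  apply le_antisymm
  · rw [Submodule.span_le]
    rintro _ ⟨κ, h, rfl⟩
    have hA : AdmL κ.blocks := ⟨fun y hy => κ.blocks_pos hy, h⟩
    have hZ : Zs k ≤ Submodule.span ℤ {x : ℝ | ∃ l : Composition k,
        (∀ y ∈ l.blocks, 2 ≤ y) ∧ x = mzvStarL l.blocks} := by
      unfold Zs
      rw [Submodule.span_le]
      rintro _ ⟨j, h1, h2, rfl⟩
      exact mzvL_mem_star k _ j rfl h1 h2
    refine Submodule.sum_mem _ fun l hl => hZ ?_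
    obtain ⟨h1, h2⟩ := coars_adm _ hA l hl
    have := mzvL_adm h1
    rwa [h2, κ.blocks_sum] at this
  · rw [Submodule.span_le]
    rintro _ ⟨l, h, rfl⟩
    refine Submodule.subset_span ⟨l, ?_, rfl⟩
    have hne : l.blocks ≠ [] := by
      intro h0
      have := l.blocks_sum
      rw [h0] at this; simp at this; omega
    exact ⟨_, List.getLast?_eq_some_getLast hne, h _ (List.getLast_mem hne)⟩
end

section
/- For every admissible index k, the sequence (ζ^◇_N(k))_{N≥1} of rational numbers converges to the multiple zeta value ζ(k) as N → ∞. -/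
open scoped Classical

/-- The modified multiple harmonic sum `ζ◇_N(k)`:
`ζ◇_N(k) = ∑_{A ⊂ [r]¹_k} ∑_{(n₁,…,n_r) ∈ S_{r,N}(A)} (∏_{i∈A} 1/(N-nᵢ)) (∏_{i∉A} 1/nᵢ^{kᵢ})`,
where `[r]¹_k` is the set of positions with entry `1`, and `S_{r,N}(A)` consists of the
tuples in `{1,…,N-1}^r` with `nᵢ ≤ nᵢ₊₁` for `i ∈ A` and `nᵢ < nᵢ₊₁` otherwise. -/
noncomputable def zdiaL (N : ℕ) (k : List ℕ) : ℚ :=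
  ∑ A : Finset (Fin k.length),
    if ∀ i ∈ A, k.get i = 1 then
      ∑ n ∈ Finset.univ.filter (fun n : Fin k.length → Fin N =>
        (∀ i, 0 < (n i : ℕ)) ∧
        ∀ (i : Fin k.length) (h : (i : ℕ) + 1 < k.length),
          if i ∈ A then n i ≤ n ⟨(i : ℕ) + 1, h⟩ else n i < n ⟨(i : ℕ) + 1, h⟩),
        ∏ i : Fin k.length,
          if i ∈ A then (1 : ℚ) / ((N : ℚ) - ((n i : ℕ) : ℚ))
          else (1 : ℚ) / (((n i : ℕ) : ℚ) ^ k.get i)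
    else 0


open Filter Topology

/-- A step-monotone function on `Fin r` is monotone. -/
lemma zd_mono {r : ℕ} {α : Type*} [Preorder α] (n : Fin r → α)
    (h : ∀ (i : Fin r) (h : (i : ℕ) + 1 < r), n i ≤ n ⟨(i : ℕ) + 1, h⟩)
    (i j : Fin r) (hij : i ≤ j) : n i ≤ n j := by
  obtain ⟨i, hi⟩ := i
  obtain ⟨j, hj⟩ := j
  have hij' : i ≤ j := hij
  clear hij
  induction j, hij' using Nat.le_induction with
  | base => exact le_refl _
  | succ m hm ih => exact (ih (by omega)).trans (h ⟨m, by omega⟩ hj)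

lemma zd_strictMono {r : ℕ} {α : Type*} [Preorder α] (n : Fin r → α)
    (h : ∀ (i : Fin r) (h : (i : ℕ) + 1 < r), n i < n ⟨(i : ℕ) + 1, h⟩) :
    StrictMono n := by
  intro i j hij
  have hlt : (i : ℕ) < j := hij
  have h1 : (i : ℕ) + 1 < r := by have := j.2; omega
  refine (h i h1).trans_le (zd_mono n (fun i h' => (h i h').le) _ _ ?_)
  show (i : ℕ) + 1 ≤ j
  omega

lemma zd_last (k : List ℕ) (hadm : ∃ m, k.getLast? = some m ∧ 2 ≤ m) :
    ∃ l : Fin k.length, 2 ≤ k.get l ∧ ∀ i, i ≤ l := by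
  obtain ⟨m, hm, h2⟩ := hadm
  rw [List.getLast?_eq_getElem?] at hm
  obtain ⟨h, he⟩ := List.getElem?_eq_some_iff.1 hm
  refine ⟨⟨k.length - 1, h⟩, ?_, ?_⟩
  · simpa [he] using h2
  · intro i
    show (i : ℕ) ≤ k.length - 1
    have := i.2
    omega

/-- one term of the sum -/
noncomputable def zdT (N : ℕ) (k : List ℕ) (A : Finset (Fin k.length)) : ℝ :=
  ∑ n ∈ Finset.univ.filter (fun n : Fin k.length → Fin N =>
        (∀ i, 0 < (n i : ℕ)) ∧
        ∀ (i : Fin k.length) (h : (i : ℕ) + 1 < k.length),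
          if i ∈ A then n i ≤ n ⟨(i : ℕ) + 1, h⟩ else n i < n ⟨(i : ℕ) + 1, h⟩),
        ∏ i : Fin k.length,
          if i ∈ A then (1 : ℝ) / ((N : ℝ) - ((n i : ℕ) : ℝ))
          else (1 : ℝ) / (((n i : ℕ) : ℝ) ^ k.get i)

lemma zd_cast (N : ℕ) (k : List ℕ) : ((zdiaL N k : ℚ) : ℝ) =
    ∑ A : Finset (Fin k.length), if ∀ i ∈ A, k.get i = 1 then zdT N k A else 0 := by
  unfold zdiaL zdT
  push_cast
  refine Finset.sum_congr rfl fun A _ => ?_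
  split_ifs with h
  · push_cast
    refine Finset.sum_congr rfl fun n _ => ?_
    refine Finset.prod_congr rfl fun i _ => ?_
    split_ifs <;> push_cast <;> rfl
  · simp

noncomputable def zdg (N : ℕ) (n : ℕ) : ℝ := 1 / (n : ℝ) + 1 / ((N : ℝ) - n)

lemma zdg_sum (N : ℕ) : ∑ n : Fin N, zdg N n ≤ 2 * (1 + Real.log N) := by
  have h0 : (∑ i ∈ Finset.range N, (1 : ℝ) / ((i : ℝ) + 1)) ≤ 1 + Real.log N := by
    have := harmonic_le_one_add_log N
    simpa [harmonic] using this
  have h1 : ∑ n ∈ Finset.range N, (1 : ℝ) / (n : ℝ) ≤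
      ∑ i ∈ Finset.range N, (1 : ℝ) / ((i : ℝ) + 1) := by
    cases N with
    | zero => simp
    | succ N =>
      rw [Finset.sum_range_succ' , Finset.sum_range_succ]
      have : (0 : ℝ) ≤ 1 / ((N : ℝ) + 1) := by positivity
      simpa using this
  have h2 : ∑ n ∈ Finset.range N, (1 : ℝ) / ((N : ℝ) - n) =
      ∑ i ∈ Finset.range N, (1 : ℝ) / ((i : ℝ) + 1) := by
    rw [← Finset.sum_range_reflect]
    refine Finset.sum_congr rfl fun i hi => ?_
    have hi := Finset.mem_range.1 hi
    rw [show N - 1 - i = N - (i + 1) by omega, Nat.cast_sub (by omega)]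
    push_cast
    congr 1
    ring
  rw [Fin.sum_univ_eq_sum_range (fun n => zdg N n)]
  simp only [zdg, Finset.sum_add_distrib]
  linarith

lemma zd_pt (N : ℕ) (k : List ℕ) (hpos : ∀ i, 0 < k.get i) (l : Fin k.length)
    (hl : 2 ≤ k.get l) (A : Finset (Fin k.length)) (hA : ∀ i ∈ A, k.get i = 1)
    (i : Fin k.length) (hi : i ∈ A) (n : Fin k.length → Fin N)
    (hn : ∀ i, 0 < (n i : ℕ)) (hil : (n i : ℕ) ≤ n l) :
    (∏ i : Fin k.length,
          if i ∈ A then (1 : ℝ) / ((N : ℝ) - ((n i : ℕ) : ℝ))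
          else (1 : ℝ) / (((n i : ℕ) : ℝ) ^ k.get i)) ≤ 1 / (N : ℝ) * ∏ i, zdg N (n i) := by
  have hn1 : ∀ j, (1 : ℝ) ≤ ((n j : ℕ) : ℝ) := fun j => by exact_mod_cast hn j
  have hnN : ∀ j, (0 : ℝ) < (N : ℝ) - ((n j : ℕ) : ℝ) := fun j => by
    have : ((n j : ℕ) : ℝ) < N := by exact_mod_cast (n j).2
    linarith
  have hlA : l ∉ A := fun h => by have := hA l h; omega
  have hne : l ≠ i := fun h => hlA (h ▸ hi)
  have hg : ∀ j, 0 ≤ zdg N (n j) := fun j => by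
    have := hnN j
    have := hn1 j
    unfold zdg
    positivity
  have ht0 : ∀ j, 0 ≤ (if j ∈ A then (1 : ℝ) / ((N : ℝ) - ((n j : ℕ) : ℝ))
          else (1 : ℝ) / (((n j : ℕ) : ℝ) ^ k.get j)) := fun j => by
    have := hnN j
    have := hn1 j
    split_ifs <;> positivity
  have ht : ∀ j, (if j ∈ A then (1 : ℝ) / ((N : ℝ) - ((n j : ℕ) : ℝ))
          else (1 : ℝ) / (((n j : ℕ) : ℝ) ^ k.get j)) ≤ zdg N (n j) := fun j => by
    have h1 := hnN j
    have h2 := hn1 j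
    unfold zdg
    split_ifs
    · have : (0 : ℝ) ≤ 1 / ((n j : ℕ) : ℝ) := by positivity
      linarith
    · have h3 : (1 : ℝ) / (((n j : ℕ) : ℝ) ^ k.get j) ≤ 1 / ((n j : ℕ) : ℝ) := by
        apply one_div_le_one_div_of_le (by linarith)
        exact le_self_pow₀ h2 (hpos j).ne'
      have : (0 : ℝ) ≤ 1 / ((N : ℝ) - ((n j : ℕ) : ℝ)) := by positivity
      linarith
  have hmem : l ∈ Finset.univ.erase i := by simp [hne]
  rw [← Finset.mul_prod_erase _ _ (Finset.mem_univ i), ← Finset.mul_prod_erase _ _ hmem,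
    ← Finset.mul_prod_erase _ (fun j => zdg N (n j)) (Finset.mem_univ i),
    ← Finset.mul_prod_erase _ (fun j => zdg N (n j)) hmem, ← mul_assoc, ← mul_assoc, ← mul_assoc]
  have hP := Finset.prod_le_prod (s := (Finset.univ.erase i).erase l)
    (fun j _ => ht0 j) (fun j _ => ht j)
  refine mul_le_mul ?_ hP (Finset.prod_nonneg fun j _ => ht0 j) ?_
  · rw [if_pos hi, if_neg hlA]
    have a1 := hnN i
    have a2 := hn1 i
    have b1 := hnN l
    have b2 := hn1 l
    have hil' : ((n i : ℕ) : ℝ) ≤ ((n l : ℕ) : ℝ) := by exact_mod_cast hil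
    have hN : (0 : ℝ) < N := by linarith
    have c1 : (1 : ℝ) / (((n l : ℕ) : ℝ) ^ k.get l) ≤
        1 / ((n i : ℕ) : ℝ) * (1 / ((n l : ℕ) : ℝ)) := by
      rw [one_div_mul_one_div]
      apply one_div_le_one_div_of_le (by positivity)
      calc ((n i : ℕ) : ℝ) * ((n l : ℕ) : ℝ) ≤ ((n l : ℕ) : ℝ) ^ 2 := by nlinarith
        _ ≤ _ := pow_le_pow_right₀ b2 hl
    have c2 : 1 / ((N : ℝ) - ((n i : ℕ) : ℝ)) * (1 / ((n i : ℕ) : ℝ)) =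
        1 / (N : ℝ) * zdg N (n i) := by
      unfold zdg
      have : ((n i : ℕ) : ℝ) ≠ 0 := by positivity
      field_simp
      ring
    have c3 : 1 / ((n l : ℕ) : ℝ) ≤ zdg N (n l) := by
      unfold zdg
      have : (0 : ℝ) ≤ 1 / ((N : ℝ) - ((n l : ℕ) : ℝ)) := by positivity
      linarith
    calc _ ≤ 1 / ((N : ℝ) - ((n i : ℕ) : ℝ)) * (1 / ((n i : ℕ) : ℝ) * (1 / ((n l : ℕ) : ℝ))) := by
          gcongr
      _ = 1 / (N : ℝ) * zdg N (n i) * (1 / ((n l : ℕ) : ℝ)) := by rw [← mul_assoc, c2]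
      _ ≤ _ := by
        have := hg i
        gcongr
  · have := hg i
    have := hg l
    positivity

lemma zd_zero (k : List ℕ) (hpos : ∀ i, 0 < k.get i) (l : Fin k.length)
    (hl : 2 ≤ k.get l) (hlast : ∀ i, i ≤ l) (A : Finset (Fin k.length))
    (hA : ∀ i ∈ A, k.get i = 1) (hne : A.Nonempty) :
    Tendsto (fun N => zdT N k A) atTop (𝓝 0) := by
  obtain ⟨i, hi⟩ := hne
  have hlim : Tendsto (fun N : ℕ => 2 ^ k.length * ((1 + Real.log N) ^ k.length / (N : ℝ)))
      atTop (𝓝 0) := by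
    have h := Real.tendsto_pow_log_div_mul_add_atTop (Real.exp 1)⁻¹ 0 k.length (by positivity)
    have h2 : Tendsto (fun N : ℕ => Real.exp 1 * (N : ℝ)) atTop atTop :=
      tendsto_natCast_atTop_atTop.const_mul_atTop (by positivity)
    have h3 := (h.comp h2).const_mul ((2 : ℝ) ^ k.length)
    rw [mul_zero] at h3
    refine h3.congr' ?_
    filter_upwards [eventually_gt_atTop 0] with N hN
    have : (0 : ℝ) < N := by exact_mod_cast hN
    have he := Real.exp_pos 1
    simp only [Function.comp]
    rw [Real.log_mul he.ne' this.ne', Real.log_exp, add_zero, inv_mul_cancel_left₀ he.ne']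
  have hg : ∀ N : ℕ, ∀ j : Fin N, 0 ≤ zdg N j := fun N j => by
    have : (0 : ℝ) < (N : ℝ) - ((j : ℕ) : ℝ) := by
      have : ((j : ℕ) : ℝ) < N := by exact_mod_cast j.2
      linarith
    unfold zdg
    positivity
  refine squeeze_zero (fun N => ?_) (fun N => ?_) hlim
  · refine Finset.sum_nonneg fun n hn => Finset.prod_nonneg fun j _ => ?_
    have : (0 : ℝ) < (N : ℝ) - ((n j : ℕ) : ℝ) := by
      have : ((n j : ℕ) : ℝ) < N := by exact_mod_cast (n j).2
      linarith
    split_ifs <;> positivity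
  · calc zdT N k A ≤ ∑ n : Fin k.length → Fin N, 1 / (N : ℝ) * ∏ i, zdg N (n i) := by
          unfold zdT
          refine (Finset.sum_le_sum fun n hn => ?_).trans
            (Finset.sum_le_sum_of_subset_of_nonneg (Finset.filter_subset _ _) fun n _ _ => ?_)
          · obtain ⟨-, h1, h2⟩ := Finset.mem_filter.1 hn
            refine zd_pt N k hpos l hl A hA i hi n h1 ?_
            have := zd_mono n (fun j hj => by
              have := h2 j hj
              split_ifs at this
              · exact this
              · exact this.le) i l (hlast i)
            exact this
          · exact mul_nonneg (by positivity) (Finset.prod_nonneg fun j _ => hg N _)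
      _ = 1 / (N : ℝ) * (∑ n : Fin N, zdg N n) ^ k.length := by
          rw [← Finset.mul_sum, Fintype.sum_pow]
      _ ≤ 1 / (N : ℝ) * (2 * (1 + Real.log N)) ^ k.length := by
          have h0 : 0 ≤ ∑ n : Fin N, zdg N n := Finset.sum_nonneg fun j _ => hg N j
          gcongr
          exact zdg_sum N
      _ = _ := by rw [mul_pow]; ring

lemma zd_summable (k : List ℕ) (hpos : ∀ i, 0 < k.get i) (l : Fin k.length)
    (hl : 2 ≤ k.get l) (hlast : ∀ i, i ≤ l) :
    Summable ({n : Fin k.length → ℕ | StrictMono n ∧ ∀ i, 0 < n i}.indicator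
      fun n => ∏ i, (1 : ℝ) / ((n i : ℝ) ^ k.get i)) := by
  have hr : 0 < k.length := l.pos
  have hr' : (0 : ℝ) < k.length := by exact_mod_cast hr
  set p : ℝ := 1 + 1 / (k.length : ℝ) with hp
  have hp1 : 1 < p := by
    have : (0 : ℝ) < 1 / (k.length : ℝ) := by positivity
    linarith
  have hs : Summable (fun n : ℕ => 1 / (n : ℝ) ^ p) := Real.summable_one_div_nat_rpow.2 hp1
  have hnn : ∀ n : ℕ, 0 ≤ 1 / (n : ℝ) ^ p := fun n => by positivity
  have hbd : ∀ n : Fin k.length → ℕ, ({n : Fin k.length → ℕ | StrictMono n ∧ ∀ i, 0 < n i}.indicator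
      (fun n => ∏ i, (1 : ℝ) / ((n i : ℝ) ^ k.get i))) n ≤ ∏ i, 1 / (n i : ℝ) ^ p := by
    intro n
    by_cases hn : n ∈ {n : Fin k.length → ℕ | StrictMono n ∧ ∀ i, 0 < n i}
    · rw [Set.indicator_of_mem hn]
      obtain ⟨hm, h0⟩ := hn
      have hn1 : ∀ j, (1 : ℝ) ≤ (n j : ℝ) := fun j => by exact_mod_cast h0 j
      have hn0 : ∀ j, (0 : ℝ) < (n j : ℝ) := fun j => by linarith [hn1 j]
      simp only [one_div, Finset.prod_inv_distrib]
      apply inv_anti₀ (Finset.prod_pos fun j _ => Real.rpow_pos_of_pos (hn0 j) _)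
      have e1 : ∏ j, (n j : ℝ) ^ p = (∏ j, (n j : ℝ)) * ∏ j, (n j : ℝ) ^ (1 / (k.length : ℝ)) := by
        rw [← Finset.prod_mul_distrib]
        refine Finset.prod_congr rfl fun j _ => ?_
        rw [hp, Real.rpow_add (hn0 j), Real.rpow_one]
      have e2 : ∏ j, (n j : ℝ) ^ (1 / (k.length : ℝ)) ≤ (n l : ℝ) := by
        calc ∏ j, (n j : ℝ) ^ (1 / (k.length : ℝ)) ≤
            ∏ j : Fin k.length, (n l : ℝ) ^ (1 / (k.length : ℝ)) := by
              refine Finset.prod_le_prod (fun j _ => by positivity) fun j _ => ?_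
              have : (n j : ℝ) ≤ n l := by exact_mod_cast hm.monotone (hlast j)
              gcongr
          _ = n l := by
              rw [Finset.prod_const, Finset.card_univ, Fintype.card_fin, one_div,
                Real.rpow_inv_natCast_pow (hn0 l).le hr.ne']
      rw [e1]
      calc (∏ j, (n j : ℝ)) * ∏ j, (n j : ℝ) ^ (1 / (k.length : ℝ))
          ≤ (∏ j, (n j : ℝ)) * n l := by gcongr
        _ = ((n l : ℝ) ^ 2) * ∏ j ∈ Finset.univ.erase l, (n j : ℝ) := by
            rw [← Finset.mul_prod_erase _ _ (Finset.mem_univ l)]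
            ring
        _ ≤ ((n l : ℝ) ^ k.get l) * ∏ j ∈ Finset.univ.erase l, (n j : ℝ) ^ k.get j := by
            refine mul_le_mul (pow_le_pow_right₀ (hn1 l) hl) ?_ (by positivity) (by positivity)
            exact Finset.prod_le_prod (fun j _ => (hn0 j).le) fun j _ =>
              le_self_pow₀ (hn1 j) (hpos j).ne'
        _ = _ := Finset.mul_prod_erase _ (fun j => (n j : ℝ) ^ k.get j) (Finset.mem_univ l)
    · rw [Set.indicator_of_notMem hn]
      exact Finset.prod_nonneg fun j _ => hnn _
  refine summable_of_sum_le (c := (∑' n : ℕ, 1 / (n : ℝ) ^ p) ^ k.length)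
    (fun n => Set.indicator_nonneg (fun n _ => Finset.prod_nonneg fun j _ => by positivity) n)
    fun u => ?_
  set U : Finset ℕ := u.biUnion fun n => Finset.univ.image n
  calc _ ≤ ∑ n ∈ u, ∏ i, 1 / (n i : ℝ) ^ p := Finset.sum_le_sum fun n _ => hbd n
    _ ≤ ∑ n ∈ Fintype.piFinset (fun _ : Fin k.length => U), ∏ i, 1 / (n i : ℝ) ^ p := by
        refine Finset.sum_le_sum_of_subset_of_nonneg (fun n hn => ?_)
          fun n _ _ => Finset.prod_nonneg fun j _ => hnn _
        rw [Fintype.mem_piFinset]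
        intro j
        exact Finset.mem_biUnion.2 ⟨n, hn, Finset.mem_image_of_mem _ (Finset.mem_univ j)⟩
    _ = (∑ m ∈ U, 1 / (m : ℝ) ^ p) ^ k.length := by
        rw [Finset.sum_prod_piFinset U (fun _ m => 1 / (m : ℝ) ^ p)]
        simp
    _ ≤ _ := by
        have h1 : ∑ m ∈ U, 1 / (m : ℝ) ^ p ≤ ∑' n : ℕ, 1 / (n : ℝ) ^ p :=
          hs.sum_le_tsum U fun n _ => hnn n
        have h0 : 0 ≤ ∑ m ∈ U, 1 / (m : ℝ) ^ p := Finset.sum_nonneg fun n _ => hnn n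
        gcongr

lemma zd_empty (k : List ℕ) (hpos : ∀ i, 0 < k.get i) (l : Fin k.length)
    (hl : 2 ≤ k.get l) (hlast : ∀ i, i ≤ l) :
    Tendsto (fun N => zdT N k ∅) atTop (𝓝 (mzvL k)) := by
  have hs := (zd_summable k hpos l hl hlast).hasSum
  have hb : Tendsto (fun N : ℕ => Fintype.piFinset fun _ : Fin k.length => Finset.range N)
      atTop atTop := by
    refine tendsto_atTop_finset_of_monotone (fun a b hab => ?_) fun n => ?_
    · exact Fintype.piFinset_subset _ _ fun _ => Finset.range_mono hab
    · refine ⟨(∑ i, n i) + 1, ?_⟩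
      rw [Fintype.mem_piFinset]
      intro i
      have := Finset.single_le_sum (f := n) (fun _ _ => Nat.zero_le _) (Finset.mem_univ i)
      simp only [Finset.mem_range]
      omega
  have h := Tendsto.comp hs hb
  have hm : mzvL k = ∑' n, ({n : Fin k.length → ℕ | StrictMono n ∧ ∀ i, 0 < n i}.indicator
      fun n => ∏ i, (1 : ℝ) / ((n i : ℝ) ^ k.get i)) n := by
    rw [← tsum_subtype]
    rfl
  rw [hm]
  refine h.congr fun N => ?_
  simp only [Function.comp]
  unfold zdT
  simp only [Set.indicator_apply, ← Finset.sum_filter]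
  symm
  refine Finset.sum_bij (fun n _ j => (n j : ℕ)) ?_ ?_ ?_ ?_
  · intro n hn
    obtain ⟨-, h1, h2⟩ := Finset.mem_filter.1 hn
    refine Finset.mem_filter.2 ⟨?_, ?_, h1⟩
    · simp [Fintype.mem_piFinset]
    · have := zd_strictMono n (fun j hj => by simpa using h2 j hj)
      exact fun a b hab => this hab
  · intro a _ b _ hab
    funext j
    exact Fin.ext (congrFun hab j)
  · intro n hn
    obtain ⟨h0, h1, h2⟩ := Finset.mem_filter.1 hn
    rw [Fintype.mem_piFinset] at h0
    refine ⟨fun j => ⟨n j, Finset.mem_range.1 (h0 j)⟩, ?_, rfl⟩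
    refine Finset.mem_filter.2 ⟨Finset.mem_univ _, h2, fun j hj => ?_⟩
    rw [if_neg (Finset.notMem_empty _)]
    show n _ < n _
    apply h1
    show (j : ℕ) < j + 1
    omega
  · intro n _
    simp

/-- For every admissible index `k` (entries positive, last entry `≥ 2`), the sequence
`(ζ◇_N(k))_N` converges to the multiple zeta value `ζ(k)` as `N → ∞`. -/
theorem zdia_tendsto_mzv (k : List ℕ) (hpos : ∀ x ∈ k, 0 < x)
    (hadm : ∃ m, k.getLast? = some m ∧ 2 ≤ m) :
    Filter.Tendsto (fun N : ℕ => ((zdiaL N k : ℚ) : ℝ)) Filter.atTop (nhds (mzvL k)) := by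
  obtain ⟨l, hl, hlast⟩ := zd_last k hadm
  have hpos' : ∀ i, 0 < k.get i := fun i => hpos _ (List.get_mem k i)
  simp only [zd_cast]
  have h : Filter.Tendsto (fun N : ℕ => ∑ A : Finset (Fin k.length),
      if ∀ i ∈ A, k.get i = 1 then zdT N k A else 0) Filter.atTop
      (nhds (∑ A : Finset (Fin k.length), if A = ∅ then mzvL k else 0)) := by
    refine tendsto_finsetSum _ fun A _ => ?_
    by_cases hA : A = ∅
    · subst hA
      simpa using zd_empty k hpos' l hl hlast
    · rw [if_neg hA]
      by_cases hA1 : ∀ i ∈ A, k.get i = 1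
      · simp only [if_pos hA1]
        exact zd_zero k hpos' l hl hlast A hA1 (Finset.nonempty_iff_ne_empty.2 hA)
      · simp only [if_neg hA1]
        exact tendsto_const_nhds
  simpa using h
end

section
/- Let N be a positive integer, r ≥ 1, and let k=(k_1,…,k_r) and l=(l_1,…,l_r) be tuples of positive integers of the same length. Define ζ_N(l;k) := Σ over all integers m_{j,1},…,m_{j,l_j} (j ∈ {1,…,r}) satisfying 0 < m_{j,1} ≤ ⋯ ≤ m_{j,l_j} < N for each j and m_{j,l_j} < m_{j+1,1} for j ∈ {1,…,r−1}, of Π_{j=1}^r 1/((N−m_{j,1})(N−m_{j,2})⋯(N−m_{j,l_j−1})·m_{j,l_j}^{k_j}). Define ζ^♭_N(l;k) := Σ over all integers n_{i,1},…,n_{i,k_i} (i ∈ {1,…,r}) satisfying 0 < n_{i,1} ≤ ⋯ ≤ n_{i,k_i} < N for each i and n_{i,k_i} < n_{i+1,1} for i ∈ {1,…,r−1}, of Π_{i=1}^r 1/((N−n_{i,1})^{l_i}·n_{i,2}⋯n_{i,k_i}). Then ζ_N(l;k) = ζ^♭_N(l;k). -/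
open scoped Classical


/-- connector -/
noncomputable def conn (N x m : ℕ) : ℚ := (x.choose m : ℚ) / ((N-1).choose m : ℚ)

lemma choose_succ_q (p q : ℕ) : (p.choose (q+1) : ℚ) * (q+1) = p.choose q * ((p:ℚ) - q) := by
  have h := Nat.choose_succ_right_eq p q
  rcases le_or_gt q p with hq | hq
  · have : ((p - q : ℕ) : ℚ) = (p:ℚ) - q := Nat.cast_sub hq
    rw [← this]; exact_mod_cast h
  · rw [Nat.choose_eq_zero_of_lt hq, Nat.choose_eq_zero_of_lt (by omega)]; simp

lemma conn_succ (N p q : ℕ) (hq : q + 1 < N) :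
    conn N p (q+1) * ((N:ℚ) - 1 - q) = conn N p q * ((p:ℚ) - q) := by
  have h1 := choose_succ_q p q
  have h2 := choose_succ_q (N-1) q
  have hN : ((N - 1 : ℕ) : ℚ) = (N:ℚ) - 1 := by
    rw [Nat.cast_sub (by omega)]; simp
  rw [hN] at h2
  have p1 : ((N-1).choose q : ℚ) ≠ 0 := by
    have := Nat.choose_pos (n := N-1) (k := q) (by omega)
    positivity
  have p2 : ((N-1).choose (q+1) : ℚ) ≠ 0 := by
    have := Nat.choose_pos (n := N-1) (k := q+1) (by omega)
    positivity
  have p3 : ((q:ℚ)+1) ≠ 0 := by positivity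
  unfold conn
  rw [div_mul_eq_mul_div, div_mul_eq_mul_div, div_eq_div_iff p2 p1]
  apply mul_right_cancel₀ p3
  linear_combination ((N:ℚ)-1-q) * ((N-1).choose q : ℚ) * h1 - (p.choose q : ℚ) * ((p:ℚ)-q) * h2

lemma conn_sumA (N m x : ℕ) (hm : 1 ≤ m) :
    ∑ n ∈ Finset.Ico 1 (x+1), 1 / (n:ℚ) * conn N n m = 1 / (m:ℚ) * conn N x m := by
  obtain ⟨q, rfl⟩ : ∃ q, m = q + 1 := ⟨m-1, by omega⟩
  induction x with
  | zero => simp [conn]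
  | succ x ih =>
    rw [Finset.sum_Ico_succ_top (by omega), ih]
    have h := Nat.add_one_mul_choose_eq x q
    have h' : ((x:ℚ)+1) * x.choose q = (x+1).choose (q+1) * (q+1) := by exact_mod_cast h
    have hp : ((x+1).choose (q+1) : ℚ) = x.choose q + x.choose (q+1) := by
      exact_mod_cast Nat.choose_succ_succ x q
    unfold conn
    have : ((x+1:ℕ):ℚ) ≠ 0 := by positivity
    have : ((q+1:ℕ):ℚ) ≠ 0 := by positivity
    have key : 1 / ((q+1:ℕ):ℚ) * (x.choose (q+1) : ℚ) + 1 / ((x+1:ℕ):ℚ) * ((x+1).choose (q+1) : ℚ)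
      = 1 / ((q+1:ℕ):ℚ) * ((x+1).choose (q+1) : ℚ) := by
      field_simp
      push_cast
      linear_combination (-(x:ℚ)-1) * hp - h'
    rw [← mul_div_assoc, ← mul_div_assoc, ← mul_div_assoc, ← add_div, key]

lemma conn_shift (N n m : ℕ) (hn : 1 ≤ n) (hm : 1 ≤ m) (hmN : m < N) :
    1 / (n:ℚ) * conn N n m = 1 / ((N:ℚ) - m) * conn N (n-1) (m-1) := by
  obtain ⟨q, rfl⟩ : ∃ q, m = q + 1 := ⟨m-1, by omega⟩
  obtain ⟨p, rfl⟩ : ∃ q, n = q + 1 := ⟨n-1, by omega⟩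
  have h' : ((p:ℚ)+1) * p.choose q = (p+1).choose (q+1) * (q+1) := by
    exact_mod_cast Nat.add_one_mul_choose_eq p q
  have h2 := choose_succ_q (N-1) q
  have hN : ((N - 1 : ℕ) : ℚ) = (N:ℚ) - 1 := by
    rw [Nat.cast_sub (by omega)]; simp
  rw [hN] at h2
  have p1 : ((N-1).choose q : ℚ) ≠ 0 := by
    have := Nat.choose_pos (n := N-1) (k := q) (by omega)
    positivity
  have p2 : ((N-1).choose (q+1) : ℚ) ≠ 0 := by
    have := Nat.choose_pos (n := N-1) (k := q+1) (by omega)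
    positivity
  have p3 : ((q:ℚ)+1) ≠ 0 := by positivity
  have p4 : ((p:ℚ)+1) ≠ 0 := by positivity
  have p5 : (N:ℚ) - (q+1) ≠ 0 := by
    have : ((q+1:ℕ):ℚ) < N := by exact_mod_cast hmN
    push_cast at this
    linarith
  unfold conn
  simp only [Nat.add_sub_cancel]
  push_cast
  rw [div_mul_div_comm, div_mul_div_comm, div_eq_div_iff (by positivity) (by positivity)]
  apply mul_right_cancel₀ p3
  linear_combination -((N:ℚ)-(q+1)) * ((N-1).choose q : ℚ) * h' - (p.choose q : ℚ) * ((p:ℚ)+1) * h2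

lemma conn_sumB (N n a : ℕ) (hn : 1 ≤ n) (hnN : n < N) (ha : a < N) :
    ∑ m ∈ Finset.Ico (a+1) N, 1 / ((N:ℚ) - m) * conn N (n-1) (m-1)
      = 1 / ((N:ℚ) - n) * conn N (n-1) a := by
  obtain ⟨p, rfl⟩ : ∃ q, n = q + 1 := ⟨n-1, by omega⟩
  obtain ⟨d, hd⟩ : ∃ d, N = a + 1 + d := ⟨N - (a+1), by omega⟩
  induction d generalizing a with
  | zero =>
    subst hd
    simp [conn]
    right
    exact Nat.choose_eq_zero_of_lt (by omega)
  | succ d ih =>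
    rw [Finset.sum_eq_sum_Ico_succ_bot (by omega), ih (a+1) (by omega) (by omega)]
    have h := conn_succ N p a (by omega)
    have p5 : (N:ℚ) - (a+1) ≠ 0 := by
      have : ((a+1:ℕ):ℚ) < N := by exact_mod_cast (by omega)
      push_cast at this
      linarith
    have p6 : (N:ℚ) - (p+1) ≠ 0 := by
      have : ((p+1:ℕ):ℚ) < N := by exact_mod_cast hnN
      push_cast at this
      linarith
    simp only [Nat.add_sub_cancel]
    push_cast
    field_simp
    linear_combination h

noncomputable def SA (N k l : ℕ) (g : ℕ → ℚ) (a : ℕ) : ℚ :=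
  ∑ m : Fin (l+1) → Fin N, if (∀ c d, c < d → m c ≤ m d) ∧ ∀ c, a < (m c : ℕ) then
    (∏ c : Fin (l+1), if (c:ℕ) + 1 < l + 1 then (1:ℚ) / ((N:ℚ) - ((m c : ℕ) : ℚ))
      else (1:ℚ) / (((m c : ℕ) : ℚ) ^ k)) * g (m (Fin.last l)) else 0

noncomputable def SB (N L k : ℕ) (f : ℕ → ℚ) (x : ℕ) : ℚ :=
  ∑ n : Fin (k+1) → Fin N, if (∀ c d, c < d → n c ≤ n d) ∧ ∀ c, 0 < (n c : ℕ) ∧ (n c : ℕ) < x then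
    (∏ c : Fin (k+1), if (c:ℕ) = 0 then ((1:ℚ) / ((N:ℚ) - ((n c : ℕ) : ℚ))) ^ L
      else (1:ℚ) / ((n c : ℕ) : ℚ)) * f (n 0) else 0

lemma sum_fin_Ico (N a x : ℕ) (hx : x ≤ N) (F : ℕ → ℚ) :
    (∑ m : Fin N, if a < (m:ℕ) ∧ (m:ℕ) < x then F m else 0) = ∑ m ∈ Finset.Ico (a+1) x, F m := by
  rw [← Finset.sum_range (fun m => if a < m ∧ m < x then F m else 0), ← Finset.sum_filter]
  apply Finset.sum_congr _ (fun _ _ => rfl)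
  ext m; simp; omega

lemma SA_zero (N k : ℕ) (g : ℕ → ℚ) (a : ℕ) :
    SA N k 0 g a = ∑ m ∈ Finset.Ico (a+1) N, 1 / (m:ℚ)^k * g m := by
  rw [← sum_fin_Ico N a N le_rfl (fun m => 1 / (m:ℚ)^k * g m), SA,
    ← (Equiv.funUnique (Fin 1) (Fin N)).symm.sum_comp]
  refine Finset.sum_congr rfl fun m _ => ?_
  have : ∀ c d : Fin 1, ¬ c < d := by decide
  simp [this]

lemma SA_succ (N k l : ℕ) (g : ℕ → ℚ) (a : ℕ) :
    SA N k (l+1) g a = ∑ m ∈ Finset.Ico (a+1) N, 1 / ((N:ℚ) - m) * SA N k l g (m-1) := by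
  rw [← sum_fin_Ico N a N le_rfl (fun m => 1 / ((N:ℚ) - m) * SA N k l g (m-1)), SA,
    ← (Fin.consEquiv (fun _ => Fin N)).sum_comp, Fintype.sum_prod_type]
  refine Finset.sum_congr rfl fun m _ => ?_
  by_cases h : a < (m:ℕ)
  · rw [if_pos ⟨h, m.2⟩, SA, Finset.mul_sum]
    refine Finset.sum_congr rfl fun m' _ => ?_
    have hl : (Fin.last (l+1)) = (Fin.last l).succ := rfl
    rw [Fin.prod_univ_succ, hl]
    simp only [Fin.consEquiv_apply, Fin.cons_succ, Fin.cons_zero, Fin.val_succ, Fin.val_zero,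
      add_lt_add_iff_right]
    rw [if_pos (by omega : 0 < l + 1), mul_ite, mul_zero]
    apply if_congr
    · simp only [Fin.forall_fin_succ (n := l+1), Fin.cons_succ, Fin.cons_zero, Fin.succ_lt_succ_iff,
        Fin.succ_pos, Fin.not_lt_zero, lt_irrefl, false_imp_iff, true_imp_iff, true_and,
        Fin.le_def]
      constructor
      · rintro ⟨⟨h1, h2⟩, h3, h4⟩
        exact ⟨h2, fun c => by have := h1 c; omega⟩
      · rintro ⟨h1, h2⟩
        exact ⟨⟨fun c => by have := h2 c; omega, h1⟩, h, fun c => by have := h2 c; omega⟩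
    · simp only [add_lt_add_iff_right, mul_assoc]
    · rfl
  · rw [if_neg (by tauto)]
    refine Finset.sum_eq_zero fun m' _ => if_neg ?_
    rintro ⟨_, h2⟩
    exact h (by simpa using h2 0)

lemma SB_zero (N L : ℕ) (f : ℕ → ℚ) (x : ℕ) (hx : x ≤ N) :
    SB N L 0 f x = ∑ n ∈ Finset.Ico 1 x, (1 / ((N:ℚ) - n))^L * f n := by
  rw [← sum_fin_Ico N 0 x hx (fun n => (1 / ((N:ℚ) - n))^L * f n), SB,
    ← (Equiv.funUnique (Fin 1) (Fin N)).symm.sum_comp]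
  refine Finset.sum_congr rfl fun m _ => ?_
  have : ∀ c d : Fin 1, ¬ c < d := by decide
  simp [this]

lemma SB_succ (N L k : ℕ) (f : ℕ → ℚ) (x : ℕ) (hx : x ≤ N) :
    SB N L (k+1) f x = ∑ n ∈ Finset.Ico 1 x, 1 / (n:ℚ) * SB N L k f (n+1) := by
  rw [← sum_fin_Ico N 0 x hx (fun n => 1 / (n:ℚ) * SB N L k f (n+1)), SB,
    ← (Fin.snocEquiv (fun _ => Fin N)).sum_comp, Fintype.sum_prod_type]
  refine Finset.sum_congr rfl fun m _ => ?_
  by_cases h : 0 < (m:ℕ) ∧ (m:ℕ) < x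
  · rw [if_pos h, SB, Finset.mul_sum]
    refine Finset.sum_congr rfl fun m' _ => ?_
    have hl : (0 : Fin (k+2)) = (0 : Fin (k+1)).castSucc := rfl
    rw [Fin.prod_univ_castSucc, hl]
    simp only [Fin.snocEquiv_apply, Fin.snoc_castSucc, Fin.snoc_last, Fin.val_castSucc, Fin.val_last]
    rw [if_neg (by omega : ¬ (k + 1 = 0)), mul_ite, mul_zero]
    apply if_congr
    · simp only [Fin.forall_fin_succ' (n := k+1), Fin.snoc_castSucc, Fin.snoc_last,
        Fin.castSucc_lt_castSucc_iff, Fin.castSucc_lt_last, lt_irrefl, false_imp_iff, true_imp_iff,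
        and_true, Fin.le_def, Fin.lt_def]
      constructor
      · rintro ⟨⟨h1, h2⟩, h3, h4⟩
        exact ⟨fun c d hcd => (h1 c).1 d hcd, fun c => by have := (h1 c).2 (by simp [c.2]); have := h3 c; omega⟩
      · rintro ⟨h1, h2⟩
        refine ⟨⟨fun c => ⟨fun d hcd => h1 c d hcd, fun _ => by have := h2 c; omega⟩, fun c hc => ?_⟩, fun c => by have := h2 c; omega, h⟩
        simp at hc; omega
    · ring
    · rfl
  · rw [if_neg h]
    refine Finset.sum_eq_zero fun m' _ => if_neg ?_
    rintro ⟨_, h2⟩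
    exact h (by simpa using h2 (Fin.last _))

lemma SA_congr (N k l : ℕ) (g g' : ℕ → ℚ) (a : ℕ) (h : ∀ m < N, g m = g' m) :
    SA N k l g a = SA N k l g' a := by
  unfold SA
  refine Finset.sum_congr rfl fun m _ => ?_
  rw [h _ (Fin.is_lt _)]

lemma SA_lin (N k l : ℕ) {ι : Type} (s : Finset ι) (c : ι → ℚ) (h : ι → ℕ → ℚ) (a : ℕ) :
    SA N k l (fun m => ∑ i ∈ s, c i * h i m) a = ∑ i ∈ s, c i * SA N k l (h i) a := by
  unfold SA
  simp only [Finset.mul_sum]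
  rw [Finset.sum_comm]
  refine Finset.sum_congr rfl fun m _ => ?_
  split_ifs
  · exact Finset.sum_congr rfl fun i _ => by ring
  · simp

lemma SB_congr (N L k : ℕ) (f f' : ℕ → ℚ) (x : ℕ) (h : ∀ m, 1 ≤ m → m < N → f m = f' m) :
    SB N L k f x = SB N L k f' x := by
  unfold SB
  refine Finset.sum_congr rfl fun m _ => ?_
  split_ifs with hc
  · rw [h _ (hc.2 0).1 (Fin.is_lt _)]
  · rfl

lemma SB_lin (N L k : ℕ) {ι : Type} (s : Finset ι) (c : ι → ℚ) (h : ι → ℕ → ℚ) (a : ℕ) :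
    SB N L k (fun m => ∑ i ∈ s, c i * h i m) a = ∑ i ∈ s, c i * SB N L k (h i) a := by
  unfold SB
  simp only [Finset.mul_sum]
  rw [Finset.sum_comm]
  refine Finset.sum_congr rfl fun m _ => ?_
  split_ifs
  · exact Finset.sum_congr rfl fun i _ => by ring
  · simp

lemma SB_pow (N L k : ℕ) (f : ℕ → ℚ) (x : ℕ) :
    SB N (L+1) k f x = SB N L k (fun n => 1 / ((N:ℚ) - n) * f n) x := by
  unfold SB
  refine Finset.sum_congr rfl fun m _ => ?_
  simp only [Fin.prod_univ_succ, Fin.val_zero, Fin.val_succ]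
  by_cases h : (∀ c d, c < d → m c ≤ m d) ∧ ∀ c, 0 < (m c : ℕ) ∧ (m c : ℕ) < x
  · rw [if_pos h, if_pos h]
    simp only [Nat.add_eq_zero_iff, one_ne_zero, and_false, if_false, if_true]
    ring
  · rw [if_neg h, if_neg h]

lemma block (N k l x a : ℕ) (hx : 1 ≤ x) (hxN : x ≤ N) (ha : a < N) :
    SA N (k+1) l (conn N (x-1)) a = SB N (l+1) k (fun y => conn N (y-1) a) x := by
  induction l generalizing a with
  | zero =>
    induction k generalizing x with
    | zero =>
      rw [SA_zero, SB_zero _ _ _ _ hxN]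
      have : ∀ m ∈ Finset.Ico (a+1) N, 1 / (m:ℚ)^(0+1) * conn N (x-1) m
          = ∑ n ∈ Finset.Ico 1 x, 1 / ((N:ℚ) - m) * conn N (n-1) (m-1) := by
        intro m hm
        rw [Finset.mem_Ico] at hm
        rw [zero_add, pow_one, ← conn_sumA N m (x-1) (by omega), Nat.sub_add_cancel hx]
        refine Finset.sum_congr rfl fun n hn => ?_
        rw [Finset.mem_Ico] at hn
        exact conn_shift N n m hn.1 (by omega) hm.2
      rw [Finset.sum_congr rfl this, Finset.sum_comm]
      refine Finset.sum_congr rfl fun n hn => ?_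
      rw [Finset.mem_Ico] at hn
      rw [conn_sumB N n a hn.1 (by omega) ha, zero_add, pow_one]
    | succ k ih =>
      rw [SB_succ _ _ _ _ _ hxN]
      have : ∀ n ∈ Finset.Ico 1 x, 1 / (n:ℚ) * SB N (0+1) k (fun y => conn N (y-1) a) (n+1)
         = ∑ m ∈ Finset.Ico (a+1) N, 1 / (m:ℚ)^(k+1) * (1 / (n:ℚ) * conn N n m) := by
        intro n hn
        rw [Finset.mem_Ico] at hn
        rw [← ih (n+1) (by omega) (by omega), SA_zero, Finset.mul_sum, Nat.add_sub_cancel]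
        exact Finset.sum_congr rfl fun m _ => by ring
      rw [Finset.sum_congr rfl this, Finset.sum_comm, SA_zero]
      refine Finset.sum_congr rfl fun m hm => ?_
      rw [Finset.mem_Ico] at hm
      have h := conn_sumA N m (x-1) (by omega)
      rw [Nat.sub_add_cancel hx] at h
      rw [← Finset.mul_sum, h, pow_succ (m:ℚ) (k+1)]
      rw [← mul_assoc, one_div_mul_one_div]
  | succ l ih =>
    rw [SA_succ, SB_pow]
    rw [SB_congr N (l+1) k _ (fun n => ∑ m ∈ Finset.Ico (a+1) N, 1 / ((N:ℚ) - m) * conn N (n-1) (m-1)) x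
      (fun n h1 h2 => (conn_sumB N n a h1 h2 ha).symm)]
    rw [SB_lin N (l+1) k _ (fun m : ℕ => 1 / ((N:ℚ) - m)) (fun m n => conn N (n-1) (m-1))]
    refine Finset.sum_congr rfl fun m hm => ?_
    rw [Finset.mem_Ico] at hm
    rw [ih _ (by omega)]

noncomputable def FA (N : ℕ) : (r : ℕ) → (k l : Fin r → ℕ) → (ℕ → ℚ) → ℕ → ℚ
  | 0, _, _, g => g
  | r+1, k, l, g => SA N (k 0) (l 0) (FA N r (fun i => k i.succ) (fun i => l i.succ) g)

noncomputable def FB (N : ℕ) : (r : ℕ) → (L k : Fin r → ℕ) → (ℕ → ℚ) → ℕ → ℚ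
  | 0, _, _, f => f
  | r+1, L, k, f => SB N (L (Fin.last r)) (k (Fin.last r))
      (FB N r (fun i => L i.castSucc) (fun i => k i.castSucc) f)

lemma FA_snoc (N r : ℕ) (k l : Fin (r+1) → ℕ) (g : ℕ → ℚ) :
    FA N (r+1) k l g = FA N r (fun i => k i.castSucc) (fun i => l i.castSucc)
      (SA N (k (Fin.last r)) (l (Fin.last r)) g) := by
  induction r with
  | zero => rfl
  | succ r ih =>
    rw [FA, ih]
    rfl

lemma FA_congr (N r : ℕ) (k l : Fin r → ℕ) (g g' : ℕ → ℚ) (h : ∀ m < N, g m = g' m) :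
    ∀ a < N, FA N r k l g a = FA N r k l g' a := by
  induction r with
  | zero => exact h
  | succ r ih =>
    intro a _
    exact SA_congr _ _ _ _ _ _ (ih _ _)

lemma FA_lin (N r : ℕ) (k l : Fin r → ℕ) {ι : Type} (s : Finset ι) (c : ι → ℚ) (h : ι → ℕ → ℚ) :
    FA N r k l (fun m => ∑ i ∈ s, c i * h i m) = fun a => ∑ i ∈ s, c i * FA N r k l (h i) a := by
  induction r with
  | zero => rfl
  | succ r ih =>
    funext a
    rw [FA, ih, SA_lin]
    rfl

lemma SB_repr (N L k : ℕ) (f : ℕ → ℚ) (x : ℕ) : SB N L k f x =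
    ∑ n : Fin (k+1) → Fin N, (if (∀ c d, c < d → n c ≤ n d) ∧ ∀ c, 0 < (n c : ℕ) ∧ (n c : ℕ) < x then
    (∏ c : Fin (k+1), if (c:ℕ) = 0 then ((1:ℚ) / ((N:ℚ) - ((n c : ℕ) : ℚ))) ^ L
      else (1:ℚ) / ((n c : ℕ) : ℚ)) else 0) * f (n 0) := by
  unfold SB
  simp only [ite_mul, zero_mul]

lemma FA_FB (N r : ℕ) (k l : Fin r → ℕ) (x a : ℕ) (hx : 1 ≤ x) (hxN : x ≤ N) (ha : a < N) :
    FA N r (fun i => k i + 1) l (conn N (x-1)) a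
      = FB N r (fun i => l i + 1) k (fun y => conn N (y-1) a) x := by
  induction r generalizing x with
  | zero => rfl
  | succ r ih =>
    rw [FA_snoc, FB]
    rw [FA_congr N r _ _ _ (fun m => SB N (l (Fin.last r) + 1) (k (Fin.last r))
      (fun y => conn N (y-1) m) x) (fun m hm => block N _ _ x m hx hxN hm) a ha]
    rw [← SB_congr _ _ _ _ _ x (fun y h1 h2 => ih (fun i => k i.castSucc) (fun i => l i.castSucc) y h1 h2.le)]
    simp only [SB_repr]
    rw [FA_lin N r _ _ _ _ (fun (n : Fin (k (Fin.last r) + 1) → Fin N) m => conn N ((n 0 : ℕ) - 1) m)]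

lemma FA_eq (N r : ℕ) (k l : Fin r → ℕ) (a : ℕ) :
    (∑ m : ∀ j : Fin r, Fin (l j + 1) → Fin N,
      if (∀ j, ∀ c d, c < d → m j c ≤ m j d) ∧ (∀ j c, a < (m j c : ℕ)) ∧
        (∀ j j', j < j' → ∀ c d, (m j c : ℕ) < m j' d) then
      ∏ j : Fin r, ∏ c : Fin (l j + 1), (if (c:ℕ) + 1 < l j + 1 then (1:ℚ) / ((N:ℚ) - ((m j c : ℕ) : ℚ))
        else (1:ℚ) / (((m j c : ℕ) : ℚ) ^ k j)) else 0) = FA N r k l (fun _ => 1) a := by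
  induction r generalizing a with
  | zero => simp [FA]
  | succ r ih =>
    rw [FA, SA, ← (Fin.consEquiv (fun j => Fin (l j + 1) → Fin N)).sum_comp, Fintype.sum_prod_type]
    refine Finset.sum_congr rfl fun m _ => ?_
    rw [← ih]
    by_cases h : (∀ c d, c < d → m c ≤ m d) ∧ ∀ c, a < (m c : ℕ)
    · rw [if_pos h, Finset.mul_sum]
      refine Finset.sum_congr rfl fun m' _ => ?_
      rw [Fin.prod_univ_succ, mul_ite, mul_zero]
      simp only [Fin.consEquiv_apply, Fin.cons_succ, Fin.cons_zero]
      apply if_congr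
      · simp only [Fin.forall_fin_succ (n := r), Fin.cons_succ, Fin.cons_zero,
          Fin.succ_lt_succ_iff, Fin.succ_pos, Fin.not_lt_zero, lt_irrefl, false_imp_iff,
          true_imp_iff, true_and]
        constructor
        · rintro ⟨⟨h1, h2⟩, ⟨h3, h4⟩, h5, h6⟩
          exact ⟨h2, fun j c => h5 j _ c, h6⟩
        · rintro ⟨h1, h2, h3⟩
          have hm : ∀ c, (m c : ℕ) ≤ m (Fin.last _) := by
            intro c
            rcases (Fin.le_last c).lt_or_eq with hc | hc
            · exact h.1 _ _ hc
            · rw [hc]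
          exact ⟨⟨h.1, h1⟩, ⟨h.2, fun j c => (h.2 _).trans (h2 j c)⟩,
            fun j c d => (hm c).trans_lt (h2 j d), h3⟩
      · rfl
      · rfl
    · rw [if_neg h]
      refine Finset.sum_eq_zero fun m' _ => if_neg ?_
      rintro ⟨h1, h2, _⟩
      exact h ⟨by simpa using h1 0, by simpa using h2 0⟩

lemma FB_eq (N r : ℕ) (k l : Fin r → ℕ) (x : ℕ) :
    (∑ n : ∀ j : Fin r, Fin (k j + 1) → Fin N,
      if (∀ j, ∀ c d, c < d → n j c ≤ n j d) ∧ (∀ j c, 0 < (n j c : ℕ) ∧ (n j c : ℕ) < x) ∧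
        (∀ j j', j < j' → ∀ c d, (n j c : ℕ) < n j' d) then
      ∏ j : Fin r, ∏ c : Fin (k j + 1), (if (c:ℕ) = 0 then ((1:ℚ) / ((N:ℚ) - ((n j c : ℕ) : ℚ))) ^ l j
        else (1:ℚ) / ((n j c : ℕ) : ℚ)) else 0) = FB N r l k (fun _ => 1) x := by
  induction r generalizing x with
  | zero => simp [FB]
  | succ r ih =>
    rw [FB, SB, ← (Fin.snocEquiv (fun j => Fin (k j + 1) → Fin N)).sum_comp, Fintype.sum_prod_type]
    refine Finset.sum_congr rfl fun m _ => ?_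
    rw [← ih]
    by_cases h : (∀ c d, c < d → m c ≤ m d) ∧ ∀ c, 0 < (m c : ℕ) ∧ (m c : ℕ) < x
    · rw [if_pos h, Finset.mul_sum]
      refine Finset.sum_congr rfl fun m' _ => ?_
      rw [Fin.prod_univ_castSucc, mul_ite, mul_zero]
      simp only [Fin.snocEquiv_apply, Fin.snoc_castSucc, Fin.snoc_last]
      apply if_congr
      · simp only [Fin.forall_fin_succ' (n := r), Fin.snoc_castSucc, Fin.snoc_last,
          Fin.castSucc_lt_castSucc_iff, Fin.castSucc_lt_last, lt_irrefl, false_imp_iff,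
          true_imp_iff, and_true]
        constructor
        · rintro ⟨⟨h1, h2⟩, ⟨h3, h4⟩, h5, h6⟩
          exact ⟨h1, fun j c => ⟨(h3 j c).1, (h5 j).2 c 0⟩, fun j => (h5 j).1⟩
        · rintro ⟨h1, h2, h3⟩
          have hm : ∀ c, (m 0 : ℕ) ≤ m c := by
            intro c
            rcases (Fin.zero_le c).lt_or_eq with hc | hc
            · exact h.1 _ _ hc
            · rw [hc]
          refine ⟨⟨h1, h.1⟩, ⟨fun j c => ⟨(h2 j c).1, (h2 j c).2.trans (h.2 0).2⟩, h.2⟩,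
            fun j => ⟨h3 j, fun c d => (h2 j c).2.trans_le (hm d)⟩, fun j hj => ?_⟩
          exact absurd hj (by simp [Fin.lt_def])
      · rw [mul_comm]
      · rfl
    · rw [if_neg h]
      refine Finset.sum_eq_zero fun m' _ => if_neg ?_
      rintro ⟨h1, h2, _⟩
      exact h ⟨by simpa using h1 (Fin.last r), by simpa using h2 (Fin.last r)⟩

lemma chain_iff (N r : ℕ) (l : Fin r → ℕ) (m : ∀ j : Fin r, Fin (l j + 1) → Fin N)
    (hm : ∀ j, Monotone (m j)) :
    (∀ (j : Fin r) (h : (j : ℕ) + 1 < r),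
          (m j ⟨l j + 1 - 1, Nat.sub_lt (Nat.succ_pos _) Nat.one_pos⟩ : ℕ)
            < (m ⟨(j : ℕ) + 1, h⟩ ⟨0, Nat.succ_pos _⟩ : ℕ)) ↔
    (∀ j j', j < j' → ∀ c d, (m j c : ℕ) < m j' d) := by
  constructor
  · intro H
    have key : ∀ (t : ℕ) (j : Fin r) (h : (j:ℕ) + 1 + t < r), ∀ c d,
        (m j c : ℕ) < m ⟨(j:ℕ) + 1 + t, h⟩ d := by
      intro t
      induction t with
      | zero =>
        intro j h c d
        refine lt_of_le_of_lt ?_ (lt_of_lt_of_le (H j h) ?_)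
        · exact hm j (Fin.le_def.2 (by simp; omega))
        · exact hm _ (Fin.le_def.2 (by simp))
      | succ t ih =>
        intro j h c d
        refine (ih j (by omega) c 0).trans ?_
        refine lt_of_le_of_lt ?_ (lt_of_lt_of_le (H ⟨(j:ℕ)+1+t, by omega⟩ h) ?_)
        · exact hm _ (Fin.le_def.2 (by simp))
        · exact hm _ (Fin.le_def.2 (by simp))
    intro j j' hj c d
    obtain ⟨j', hj'⟩ := j'
    obtain ⟨t, rfl⟩ : ∃ t, j' = (j:ℕ) + 1 + t := ⟨j' - (j+1), by simp [Fin.lt_def] at hj; omega⟩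
    exact key t j hj' c d
  · intro H j h
    exact H _ _ (by simp [Fin.lt_def]) _ _

lemma mono_iff {N l : ℕ} (m : Fin l → Fin N) : Monotone m ↔ ∀ c d, c < d → m c ≤ m d :=
  ⟨fun h _ _ hcd => h hcd.le, fun h c d hcd => hcd.lt_or_eq.elim (h c d) (fun e => by rw [e])⟩

/-- **Generalized MSW duality** `ζ_N(l;k) = ζ♭_N(l;k)`.
Here `k = (k₁,…,k_r)` and `l = (l₁,…,l_r)` are tuples of positive integers of the
same length `r ≥ 1`, and `N` is a positive integer.  The left-hand side is
`ζ_N(l;k) = ∑ ∏_j 1/((N-m_{j,1})⋯(N-m_{j,l_j-1})·m_{j,l_j}^{k_j})`, the sum being over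
integers `0 < m_{j,1} ≤ ⋯ ≤ m_{j,l_j} < N` with `m_{j,l_j} < m_{j+1,1}`; the right-hand
side is `ζ♭_N(l;k) = ∑ ∏_i 1/((N-n_{i,1})^{l_i}·n_{i,2}⋯n_{i,k_i})`, the sum being over
integers `0 < n_{i,1} ≤ ⋯ ≤ n_{i,k_i} < N` with `n_{i,k_i} < n_{i+1,1}`. -/
theorem flat_duality (N : ℕ) (hN : 0 < N) (r : ℕ) (hr : 1 ≤ r)
    (k l : Fin r → ℕ) (hk : ∀ i, 0 < k i) (hl : ∀ i, 0 < l i) :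
    (∑ m ∈ Finset.univ.filter (fun m : ∀ j : Fin r, Fin (l j) → Fin N =>
        (∀ j, Monotone (m j)) ∧ (∀ j a, 0 < (m j a : ℕ)) ∧
        (∀ (j : Fin r) (h : (j : ℕ) + 1 < r),
          (m j ⟨l j - 1, Nat.sub_lt (hl j) Nat.one_pos⟩ : ℕ)
            < (m ⟨(j : ℕ) + 1, h⟩ ⟨0, hl ⟨(j : ℕ) + 1, h⟩⟩ : ℕ))),
      ∏ j : Fin r, ∏ a : Fin (l j),
        if (a : ℕ) + 1 < l j then (1 : ℚ) / ((N : ℚ) - ((m j a : ℕ) : ℚ))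
        else (1 : ℚ) / (((m j a : ℕ) : ℚ) ^ k j)) =
    (∑ n ∈ Finset.univ.filter (fun n : ∀ i : Fin r, Fin (k i) → Fin N =>
        (∀ i, Monotone (n i)) ∧ (∀ i a, 0 < (n i a : ℕ)) ∧
        (∀ (i : Fin r) (h : (i : ℕ) + 1 < r),
          (n i ⟨k i - 1, Nat.sub_lt (hk i) Nat.one_pos⟩ : ℕ)
            < (n ⟨(i : ℕ) + 1, h⟩ ⟨0, hk ⟨(i : ℕ) + 1, h⟩⟩ : ℕ))),
      ∏ i : Fin r, ∏ a : Fin (k i),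
        if (a : ℕ) = 0 then ((1 : ℚ) / ((N : ℚ) - ((n i a : ℕ) : ℚ))) ^ l i
        else (1 : ℚ) / ((n i a : ℕ) : ℚ)) := by

  obtain ⟨k, rfl⟩ : ∃ k' : Fin r → ℕ, k = fun j => k' j + 1 :=
    ⟨fun j => k j - 1, funext fun j => (Nat.sub_add_cancel (hk j)).symm⟩
  obtain ⟨l, rfl⟩ : ∃ l' : Fin r → ℕ, l = fun j => l' j + 1 :=
    ⟨fun j => l j - 1, funext fun j => (Nat.sub_add_cancel (hl j)).symm⟩
  have e := FA_FB N r k l N 0 hN le_rfl hN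
  rw [FA_congr N r _ _ _ (fun _ => 1) (fun m hm => by
    have := Nat.choose_pos (n := N-1) (k := m) (by omega)
    exact div_self (by positivity)) 0 hN] at e
  have e2 : (fun y => conn N (y-1) 0) = fun _ => (1:ℚ) := by
    funext y; simp [conn]
  rw [e2, ← FA_eq, ← FB_eq] at e
  rw [Finset.sum_filter, Finset.sum_filter]
  refine Eq.trans (Finset.sum_congr rfl fun m _ => ?_) (e.trans (Finset.sum_congr rfl fun n _ => ?_))
  · refine if_congr ?_ rfl rfl
    simp only [← mono_iff]
    refine and_congr_right fun h1 => and_congr_right fun _ => chain_iff N r l m h1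
  · refine if_congr ?_ rfl rfl
    simp only [← mono_iff, Fin.is_lt, and_true]
    refine and_congr_right fun h1 => and_congr_right fun _ => (chain_iff N r k n h1).symm
end

section
/- For every positive integer N and every admissible index k=(k_1,…,k_r): ζ^◇_N(k) = ζ^◇♭_N(k), where ζ^◇♭_N(k) := Σ over all integers n_{i,1},…,n_{i,k_i} (i ∈ {1,…,r}) satisfying 0 < n_{i,1} ≤ ⋯ ≤ n_{i,k_i} < N for each i, n_{i,k_i} ≤ n_{i+1,1} for each i ∈ {1,…,r−1} with k_i = 1, and n_{i,k_i} < n_{i+1,1} for each i ∈ {1,…,r−1} with k_i ≥ 2, of Π_{i=1}^r 1/((N−n_{i,1})·n_{i,2}⋯n_{i,k_i}). -/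
open scoped Classical

/-- The modified multiple harmonic sum `ζ◇_N(k)` for an index given as a tuple. -/
noncomputable def zdiaF (N : ℕ) {r : ℕ} (k : Fin r → ℕ) : ℚ :=
  ∑ A : Finset (Fin r),
    if ∀ i ∈ A, k i = 1 then
      ∑ n ∈ Finset.univ.filter (fun n : Fin r → Fin N =>
        (∀ i, 0 < (n i : ℕ)) ∧
        ∀ (i : Fin r) (h : (i : ℕ) + 1 < r),
          if i ∈ A then n i ≤ n ⟨(i : ℕ) + 1, h⟩ else n i < n ⟨(i : ℕ) + 1, h⟩),
        ∏ i : Fin r,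
          if i ∈ A then (1 : ℚ) / ((N : ℚ) - ((n i : ℕ) : ℚ))
          else (1 : ℚ) / (((n i : ℕ) : ℚ) ^ k i)
    else 0

noncomputable def cc (N n m : ℕ) : ℚ := (m.choose n : ℚ) / ((N-1).choose n : ℚ)

lemma cc_diff (N n b : ℕ) :
    cc N (n+1) (b+1) - cc N (n+1) b = (n+1) * (cc N (n+1) (b+1) / (b+1)) := by
  unfold cc
  have h1 : ((b+1).choose (n+1) : ℚ) * (n+1) = (b+1) * (b.choose n) := by
    have := Nat.add_one_mul_choose_eq b n
    exact_mod_cast this.symm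
  have h2 : ((b+1).choose (n+1) : ℚ) = b.choose n + b.choose (n+1) := by
    exact_mod_cast Nat.choose_succ_succ b n
  have hb : (b+1:ℚ) ≠ 0 := by positivity
  have h3 : (b.choose n : ℚ) = ((b+1).choose (n+1) : ℚ) * (n+1) / (b+1) := by
    rw [h1]; field_simp
  rw [← sub_div, show ((b+1).choose (n+1) : ℚ) - b.choose (n+1) = b.choose n by rw [h2]; ring, h3]
  ring

lemma cc_shift (N n b : ℕ) (hn : n + 1 < N) :
    cc N (n+1) (b+1) / (b+1) * ((N:ℚ) - (n+1)) = cc N n b := by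
  unfold cc
  obtain ⟨M, rfl⟩ : ∃ M, N = M + 1 := ⟨N-1, by omega⟩
  simp only [Nat.add_sub_cancel]
  have h1 : ((b+1).choose (n+1) : ℚ) * (n+1) = (b+1) * (b.choose n) := by
    have := Nat.add_one_mul_choose_eq b n
    exact_mod_cast this.symm
  have h2 : (M.choose (n+1) : ℚ) * (n+1) = M.choose n * ((M:ℚ) - n) := by
    have := Nat.choose_succ_right_eq M n
    have h : ((M - n : ℕ) : ℚ) = (M:ℚ) - n := by rw [Nat.cast_sub (by omega)]
    rw [← h]; exact_mod_cast this
  have e1 : (M.choose (n+1) : ℚ) ≠ 0 := by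
    have := Nat.choose_pos (n := M) (k := n+1) (by omega)
    positivity
  have e2 : (M.choose n : ℚ) ≠ 0 := by
    have := Nat.choose_pos (n := M) (k := n) (by omega)
    positivity
  have hb : (b+1:ℚ) ≠ 0 := by positivity
  have hn1 : (n+1:ℚ) ≠ 0 := by positivity
  have hM : (M:ℚ) - n ≠ 0 := by
    have : (n:ℚ) < M := by exact_mod_cast (by omega : n < M)
    linarith
  have h3 : (b.choose n : ℚ) = ((b+1).choose (n+1) : ℚ) * (n+1) / (b+1) := by
    rw [h1]; field_simp
  have h4 : (M.choose n : ℚ) = M.choose (n+1) * (n+1) / ((M:ℚ)-n) := by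
    rw [h2]; field_simp
  rw [h3, h4]
  push_cast
  field_simp
  ring

lemma cc_tele (N b : ℕ) (hb : b + 1 < N) : ∀ j n : ℕ, n + j + 1 = N →
    ∑ a ∈ Finset.range N, (if n < a then cc N a (b+1) / (b+1) else 0)
      = cc N n b / ((N:ℚ) - (b+1)) := by
  have hNb : (N:ℚ) - (b+1) ≠ 0 := by
    have : ((b+1 : ℕ):ℚ) < N := by exact_mod_cast hb
    push_cast at this; linarith
  intro j
  induction j with
  | zero =>
    intro n hn
    rw [Finset.sum_eq_zero]
    · unfold cc
      rw [Nat.choose_eq_zero_of_lt (by omega : b < n)]; simp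
    · intro a ha
      rw [if_neg]
      have := Finset.mem_range.mp ha
      omega
  | succ j ih =>
    intro n hn
    have h := ih (n+1) (by omega)
    have h0 : ∑ a ∈ Finset.range N, (if n < a then cc N a (b+1) / ((b:ℚ)+1) else 0)
      = ∑ a ∈ Finset.range N, (if n+1 < a then cc N a (b+1) / ((b:ℚ)+1) else 0)
        + ∑ a ∈ Finset.range N, (if n+1 = a then cc N a (b+1) / ((b:ℚ)+1) else 0) := by
      rw [← Finset.sum_add_distrib]
      refine Finset.sum_congr rfl fun a _ => ?_
      rcases lt_trichotomy (n+1) a with h | h | h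
      · rw [if_pos (by omega), if_pos h, if_neg (by omega)]; ring
      · rw [if_pos (by omega), if_neg (by omega), if_pos h]; ring
      · rw [if_neg (by omega), if_neg (by omega), if_neg (by omega)]; ring
    rw [h0, h, Finset.sum_ite_eq, if_pos (Finset.mem_range.mpr (by omega))]
    have e1 := cc_shift N n b (by omega)
    have e2 := cc_diff N n b
    have e3 : cc N n b = cc N (n+1) b + ((N:ℚ) - (b+1)) * (cc N (n+1) (b+1) / (b+1)) := by
      rw [← e1]
      have e4 : cc N (n+1) b = cc N (n+1) (b+1) - (n+1) * (cc N (n+1) (b+1) / (b+1)) := by linarith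
      rw [e4]; field_simp; ring
    rw [e3]; field_simp

lemma cc_sum (N n : ℕ) : ∀ m : ℕ,
    ∑ c ∈ Finset.range (m+1), (if 0 < c then cc N (n+1) c / c else 0) = cc N (n+1) m / (n+1) := by
  intro m
  have hn1 : (n+1:ℚ) ≠ 0 := by positivity
  induction m with
  | zero => simp [cc]
  | succ m ih =>
    rw [Finset.sum_range_succ, ih, if_pos (by omega)]
    have := cc_diff N n m
    push_cast
    field_simp
    field_simp at this
    linarith

def ZRel (N : ℕ) (s P : ℕ → ℚ) : Prop := ∀ b, b + 1 < N →
  P (b+1) / ((N:ℚ) - (b+1)) = ∑ n ∈ Finset.range N, if 0 < n then s n * (cc N n (b+1) / (b+1)) else 0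

noncomputable def blk (N k : ℕ) (P : ℕ → ℚ) (m : ℕ) : ℚ :=
  ∑ x : Fin k → Fin N, if Monotone x ∧ (∀ a, 0 < (x a : ℕ)) ∧ (∀ a, (x a : ℕ) ≤ m) then
    ∏ a : Fin k, (if (a:ℕ) = 0 then P (x a) / ((N:ℚ) - ((x a : ℕ) : ℚ)) else 1 / ((x a : ℕ) : ℚ))
    else 0

lemma blk_zero (N : ℕ) (P : ℕ → ℚ) (m : ℕ) : blk N 0 P m = 1 := by
  unfold blk
  rw [Fintype.sum_unique, if_pos ⟨fun a => a.elim0, fun a => a.elim0, fun a => a.elim0⟩]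
  simp

lemma sum_fin_le (N m : ℕ) (hm : m < N) (f : ℕ → ℚ) :
    ∑ c : Fin N, (if 0 < (c:ℕ) ∧ (c:ℕ) ≤ m then f c else 0)
      = ∑ c ∈ Finset.range (m+1), if 0 < c then f c else 0 := by
  rw [Fin.sum_univ_eq_sum_range (fun c => if 0 < c ∧ c ≤ m then f c else 0)]
  rw [← Finset.sum_subset (s₁ := Finset.range (m+1))]
  · refine Finset.sum_congr rfl fun c hc => ?_
    have := Finset.mem_range.mp hc
    have h : c ≤ m := by omega
    simp [h]
  · intro a; simp only [Finset.mem_range]; omega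
  · intro a _ h
    simp only [Finset.mem_range] at h
    rw [if_neg (by omega)]

lemma blk_succ (N k : ℕ) (P : ℕ → ℚ) (m : ℕ) (hm : m < N) :
    blk N (k+1) P m = ∑ c ∈ Finset.range (m+1), if 0 < c then
      blk N k P c * (if k = 0 then P c / ((N:ℚ) - c) else 1 / (c:ℚ)) else 0 := by
  rw [← sum_fin_le N m hm (fun c => blk N k P c * (if k = 0 then P c / ((N:ℚ) - c) else 1 / (c:ℚ)))]
  unfold blk
  rw [← (Fin.snocEquiv (fun _ => Fin N)).sum_comp, Fintype.sum_prod_type]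
  refine Finset.sum_congr rfl fun c _ => ?_
  by_cases hc : 0 < (c:ℕ) ∧ (c:ℕ) ≤ m
  · rw [if_pos hc, Finset.sum_mul]
    refine Finset.sum_congr rfl fun x _ => ?_
    have hiff : (Monotone (Fin.snocEquiv (fun _ => Fin N) (c, x)) ∧
        (∀ a, 0 < (Fin.snocEquiv (fun _ => Fin N) (c, x) a : ℕ)) ∧
        (∀ a, (Fin.snocEquiv (fun _ => Fin N) (c, x) a : ℕ) ≤ m)) ↔
        (Monotone x ∧ (∀ a, 0 < (x a : ℕ)) ∧ (∀ a, (x a : ℕ) ≤ c)) := by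
      constructor
      · rintro ⟨h1, h2, h3⟩
        refine ⟨fun a b hab => ?_, fun a => ?_, fun a => ?_⟩
        · have := h1 (Fin.castSucc_le_castSucc_iff.mpr hab)
          simpa [Fin.snocEquiv] using this
        · have := h2 a.castSucc
          simpa [Fin.snocEquiv] using this
        · have := h1 (Fin.le_last a.castSucc)
          simpa [Fin.snocEquiv] using this
      · rintro ⟨h1, h2, h3⟩
        refine ⟨fun a b hab => ?_, fun a => ?_, fun a => ?_⟩
        · induction b using Fin.lastCases with
          | last =>
            induction a using Fin.lastCases with
            | last => simp
            | cast a => simpa [Fin.snocEquiv] using h3 a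
          | cast b =>
            induction a using Fin.lastCases with
            | last =>
              exfalso
              have := Fin.castSucc_lt_last b
              exact absurd hab (not_le.mpr this)
            | cast a => simpa [Fin.snocEquiv] using h1 (Fin.castSucc_le_castSucc_iff.mp hab)
        · induction a using Fin.lastCases with
          | last => simpa [Fin.snocEquiv] using hc.1
          | cast a => simpa [Fin.snocEquiv] using h2 a
        · induction a using Fin.lastCases with
          | last => simpa [Fin.snocEquiv] using hc.2
          | cast a => simpa [Fin.snocEquiv] using (h3 a).trans hc.2
    by_cases hx : (Monotone x ∧ (∀ a, 0 < (x a : ℕ)) ∧ (∀ a, (x a : ℕ) ≤ c))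
    · rw [if_pos hx, if_pos (hiff.mpr hx), Fin.prod_univ_castSucc]
      simp [Fin.snocEquiv]
    · rw [if_neg hx, if_neg (fun h => hx (hiff.mp h)), zero_mul]
  · rw [if_neg hc]
    refine Finset.sum_eq_zero fun x _ => ?_
    rw [if_neg]
    rintro ⟨_, h2, h3⟩
    apply hc
    have h2' := h2 (Fin.last k)
    have h3' := h3 (Fin.last k)
    constructor
    · simpa [Fin.snocEquiv] using h2'
    · simpa [Fin.snocEquiv] using h3'

lemma blk_eq (N : ℕ) (s P : ℕ → ℚ) (h : ZRel N s P) (k : ℕ) : ∀ m, m < N →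
    blk N (k+1) P m = ∑ n ∈ Finset.range N, if 0 < n then s n / (n:ℚ)^(k+1) * cc N n m else 0 := by
  have key : ∀ (t : ℕ → ℚ) (m : ℕ), ∑ c ∈ Finset.range (m+1), (if 0 < c then
      ∑ n ∈ Finset.range N, (if 0 < n then t n * (cc N n c / c) else 0) else 0)
      = ∑ n ∈ Finset.range N, if 0 < n then t n / n * cc N n m else 0 := by
    intro t m
    have : ∀ c ∈ Finset.range (m+1), (if 0 < c then
      ∑ n ∈ Finset.range N, (if 0 < n then t n * (cc N n c / c) else 0) else 0)
      = ∑ n ∈ Finset.range N, (if 0 < n then t n * (if 0 < c then cc N n c / c else 0) else 0) := by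
      intro c _
      split_ifs with hc
      · rfl
      · simp
    rw [Finset.sum_congr rfl this, Finset.sum_comm]
    refine Finset.sum_congr rfl fun n _ => ?_
    split_ifs with hn
    · obtain ⟨n, rfl⟩ : ∃ n', n = n' + 1 := ⟨n-1, by omega⟩
      rw [← Finset.mul_sum, cc_sum]
      push_cast; ring
    · simp
  induction k with
  | zero =>
    intro m hm
    rw [blk_succ N 0 P m hm, zero_add]
    simp only [pow_one]
    rw [← key s m]
    refine Finset.sum_congr rfl fun c hc => ?_
    split_ifs with h0
    · obtain ⟨c, rfl⟩ : ∃ n', c = n' + 1 := ⟨c-1, by omega⟩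
      have := Finset.mem_range.mp hc
      have h' := h c (by omega)
      push_cast
      rw [h']
      simp [blk_zero]
    · rfl
  | succ k ih =>
    intro m hm
    rw [blk_succ N (k+1) P m hm]
    have := key (fun n => s n / (n:ℚ)^(k+1)) m
    simp only [div_div, ← pow_succ] at this ⊢
    rw [← this]
    refine Finset.sum_congr rfl fun c hc => ?_
    have hc' := Finset.mem_range.mp hc
    rw [if_neg (Nat.succ_ne_zero k)]
    split_ifs with h0
    · rw [ih c (by omega), Finset.sum_mul]
      refine Finset.sum_congr rfl fun n _ => ?_
      split_ifs
      · ring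
      · ring
    · rfl

noncomputable def nextS (N k : ℕ) (s : ℕ → ℚ) (a : ℕ) : ℚ :=
  ∑ n ∈ Finset.range N, if 0 < n then
    (if n < a then s n / (n:ℚ)^k else 0) + (if k = 1 ∧ n ≤ a then s n / ((N:ℚ) - n) else 0) else 0

noncomputable def nextP (N k : ℕ) (P : ℕ → ℚ) (b : ℕ) : ℚ :=
  if k = 1 then blk N k P b else blk N k P (b-1)

lemma rel_next (N k : ℕ) (hk : 0 < k) (s P : ℕ → ℚ) (h : ZRel N s P) :
    ZRel N (nextS N k s) (nextP N k P) := by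
  obtain ⟨k, rfl⟩ : ∃ k', k = k' + 1 := ⟨k-1, by omega⟩
  intro b hb
  have aux1 : blk N (k+1) P b / ((N:ℚ) - (b+1)) = ∑ n ∈ Finset.range N, if 0 < n then
      ∑ a ∈ Finset.range N, (if n < a then s n / (n:ℚ)^(k+1) * (cc N a (b+1) / (b+1)) else 0)
      else 0 := by
    rw [blk_eq N s P h k b (by omega), Finset.sum_div]
    refine Finset.sum_congr rfl fun n hn => ?_
    have hn' := Finset.mem_range.mp hn
    split_ifs with h0
    · rw [mul_div_assoc, ← cc_tele N b hb (N-1-n) n (by omega), Finset.mul_sum]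
      simp only [mul_ite, mul_zero]
    · simp
  have aux2 : P (b+1) / ((N:ℚ) - (b+1)) / ((N:ℚ) - (b+1)) = ∑ n ∈ Finset.range N, if 0 < n then
      ∑ a ∈ Finset.range N, (if n ≤ a then s n / ((N:ℚ) - n) * (cc N a (b+1) / (b+1)) else 0)
      else 0 := by
    rw [h b hb, Finset.sum_div]
    refine Finset.sum_congr rfl fun n hn => ?_
    have hn' := Finset.mem_range.mp hn
    split_ifs with h0
    · obtain ⟨n, rfl⟩ : ∃ n', n = n' + 1 := ⟨n-1, by omega⟩
      have e := cc_tele N b hb (N-1-n) n (by omega)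
      rw [← cc_shift N n b hn'] at e
      have hne : (N:ℚ) - (n+1) ≠ 0 := by
        have : ((n+1 : ℕ):ℚ) < N := by exact_mod_cast hn'
        push_cast at this; linarith
      have e2 : s (n+1) * (cc N (n+1) (b+1) / (b+1)) / ((N:ℚ) - (b+1))
        = s (n+1) / ((N:ℚ) - (n+1)) *
          (cc N (n+1) (b+1) / (b+1) * ((N:ℚ) - (n+1)) / ((N:ℚ) - (b+1))) := by
        field_simp
      rw [e2, ← e, Finset.mul_sum]
      refine Finset.sum_congr rfl fun a _ => ?_
      simp only [Nat.succ_le_iff, mul_ite, mul_zero, Nat.cast_add, Nat.cast_one]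
    · simp
  have rhs : ∑ a ∈ Finset.range N, (if 0 < a then nextS N (k+1) s a * (cc N a (b+1) / ((b:ℚ)+1)) else 0)
     = (∑ n ∈ Finset.range N, if 0 < n then
      ∑ a ∈ Finset.range N, (if n < a then s n / (n:ℚ)^(k+1) * (cc N a (b+1) / (b+1)) else 0)
      else 0) + (if k = 0 then ∑ n ∈ Finset.range N, if 0 < n then
      ∑ a ∈ Finset.range N, (if n ≤ a then s n / ((N:ℚ) - n) * (cc N a (b+1) / (b+1)) else 0)
      else 0 else 0) := by
    have e1 : ∀ a ∈ Finset.range N,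
      (if 0 < a then nextS N (k+1) s a * (cc N a (b+1) / ((b:ℚ)+1)) else 0)
       = ∑ n ∈ Finset.range N, if 0 < n then
        ((if n < a then s n / (n:ℚ)^(k+1) * (cc N a (b+1) / (b+1)) else 0) +
        (if k = 0 ∧ n ≤ a then s n / ((N:ℚ) - n) * (cc N a (b+1) / (b+1)) else 0)) else 0 := by
      intro a _
      split_ifs with ha
      · unfold nextS
        rw [Finset.sum_mul]
        refine Finset.sum_congr rfl fun n _ => ?_
        simp only [ite_mul, zero_mul, add_mul, Nat.add_eq_right]
      · symm
        refine Finset.sum_eq_zero fun n _ => ?_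
        split_ifs <;> first | omega | simp
    rw [Finset.sum_congr rfl e1, Finset.sum_comm]
    by_cases hk0 : k = 0
    · rw [if_pos hk0, ← Finset.sum_add_distrib]
      refine Finset.sum_congr rfl fun n _ => ?_
      split_ifs with hn
      · rw [← Finset.sum_add_distrib]
        simp only [hk0, true_and]
      · simp
    · rw [if_neg hk0, add_zero]
      refine Finset.sum_congr rfl fun n _ => ?_
      split_ifs with hn
      · simp only [hk0, false_and, if_false, add_zero]
      · simp
  rw [rhs, ← aux1]
  unfold nextP
  by_cases hk0 : k = 0
  · subst hk0
    rw [if_pos rfl, if_pos rfl, ← aux2]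
    have e : blk N (0+1) P (b+1) = blk N (0+1) P b + P (b+1) / ((N:ℚ) - (b+1)) := by
      rw [blk_succ N 0 P (b+1) hb, Finset.sum_range_succ, blk_succ N 0 P b (by omega)]
      simp [blk_zero]
    rw [e]; ring
  · rw [if_neg (by omega), if_neg hk0, Nat.add_sub_cancel, add_zero]

lemma rel_init (N : ℕ) : ZRel N (fun _ => 1) (fun _ => 1) := by
  intro b hb
  have := cc_tele N b hb (N-1) 0 (by omega)
  simp only [one_mul]
  rw [this]
  simp [cc]

noncomputable def Lsum (N : ℕ) {r : ℕ} (k : Fin r → ℕ) (s : ℕ → ℚ) : ℚ :=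
  ∑ A : Fin r → Bool, ∑ n : Fin r → Fin N,
    if (∀ i, A i = true → k i = 1) ∧ (∀ i, 0 < (n i : ℕ)) ∧
      (∀ i j : Fin r, (i:ℕ) + 1 = j → if A i = true then (n i:ℕ) ≤ n j else (n i:ℕ) < n j) then
      ∏ i : Fin r, (if (i:ℕ) = 0 then s (n i) else 1) *
        (if A i = true then (1:ℚ) / ((N:ℚ) - ((n i : ℕ):ℚ)) else 1 / ((n i : ℕ):ℚ) ^ k i)
    else 0

noncomputable def Rsum (N : ℕ) {r : ℕ} (k : Fin r → ℕ) (P : ℕ → ℚ) : ℚ :=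
  ∑ n : (∀ i : Fin r, Fin (k i) → Fin N),
    if (∀ i, Monotone (n i)) ∧ (∀ i a, 0 < (n i a : ℕ)) ∧
      (∀ i j : Fin r, (i:ℕ) + 1 = j →
        if k i = 1 then ∀ a b, (n i a:ℕ) ≤ n j b else ∀ a b, (n i a:ℕ) < n j b) then
      ∏ i : Fin r, ∏ a : Fin (k i), (if (a:ℕ) = 0 then
        (if (i:ℕ) = 0 then P (n i a) else 1) / ((N:ℚ) - ((n i a : ℕ):ℚ)) else 1 / ((n i a : ℕ):ℚ))
    else 0

lemma Lsum_succ (N : ℕ) {r : ℕ} (k : Fin (r+2) → ℕ) (s : ℕ → ℚ) :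
    Lsum N k s = Lsum N (fun i => k i.succ) (nextS N (k 0) s) := by
  unfold Lsum
  rw [← (Fin.consEquiv (fun _ => Bool)).sum_comp, Fintype.sum_prod_type, Finset.sum_comm]
  refine Finset.sum_congr rfl fun A _ => ?_
  have e : ∀ a : Bool, ∀ F : (Fin (r+2) → Fin N) → ℚ, ∑ n, F n =
      ∑ n : Fin (r+1) → Fin N, ∑ c : Fin N, F (Fin.cons c n) := by
    intro a F
    rw [← (Fin.consEquiv (fun _ => Fin N)).sum_comp, Fintype.sum_prod_type, Finset.sum_comm]
    rfl
  rw [Finset.sum_congr rfl (fun a _ => e a _), Finset.sum_comm]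
  refine Finset.sum_congr rfl fun n _ => ?_
  have hiff : ∀ (a : Bool) (c : Fin N),
    ((∀ i, (Fin.consEquiv (fun _ => Bool) (a, A)) i = true → k i = 1) ∧
     (∀ i, 0 < ((Fin.cons c n : Fin (r+2) → Fin N) i : ℕ)) ∧
      (∀ i j : Fin (r+2), (i:ℕ) + 1 = j → if (Fin.consEquiv (fun _ => Bool) (a, A)) i = true then
        ((Fin.cons c n : Fin (r+2) → Fin N) i:ℕ) ≤ (Fin.cons c n : Fin (r+2) → Fin N) j
        else ((Fin.cons c n : Fin (r+2) → Fin N) i:ℕ) < (Fin.cons c n : Fin (r+2) → Fin N) j)) ↔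
    ((∀ i, A i = true → k i.succ = 1) ∧ (∀ i, 0 < (n i : ℕ)) ∧
      (∀ i j : Fin (r+1), (i:ℕ) + 1 = j → if A i = true then (n i:ℕ) ≤ n j else (n i:ℕ) < n j)) ∧
    (0 < (c:ℕ) ∧ (a = true → k 0 = 1) ∧ (if a = true then (c:ℕ) ≤ n 0 else (c:ℕ) < n 0)) := by
    intro a c
    have h1 : (∀ i j : Fin (r+2), (i:ℕ) + 1 = j → if (Fin.consEquiv (fun _ => Bool) (a, A)) i = true then
        ((Fin.cons c n : Fin (r+2) → Fin N) i:ℕ) ≤ (Fin.cons c n : Fin (r+2) → Fin N) j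
        else ((Fin.cons c n : Fin (r+2) → Fin N) i:ℕ) < (Fin.cons c n : Fin (r+2) → Fin N) j) ↔
      (if a = true then (c:ℕ) ≤ n 0 else (c:ℕ) < n 0) ∧
      (∀ i j : Fin (r+1), (i:ℕ) + 1 = j → if A i = true then (n i:ℕ) ≤ n j else (n i:ℕ) < n j) := by
      constructor
      · intro h
        refine ⟨by simpa using h 0 (Fin.succ 0) (by simp), fun i j hij => ?_⟩
        simpa using h i.succ j.succ (by simp [hij])
      · rintro ⟨h1, h2⟩ i j hij
        cases j using Fin.cases with
        | zero => simp at hij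
        | succ j =>
          cases i using Fin.cases with
          | zero =>
            have : j = 0 := by ext; simp at hij; simp [← hij]
            subst this
            simpa using h1
          | succ i =>
            simpa using h2 i j (by simpa using hij)
    rw [h1, Fin.forall_fin_succ, Fin.forall_fin_succ (P := fun i => 0 < ((Fin.cons c n : Fin (r+2) → Fin N) i : ℕ))]
    simp only [Fin.consEquiv_apply, Fin.cons_zero, Fin.cons_succ]
    tauto
  simp only [hiff]
  by_cases hc : ((∀ i, A i = true → k i.succ = 1) ∧ (∀ i, 0 < (n i : ℕ)) ∧
      (∀ i j : Fin (r+1), (i:ℕ) + 1 = j → if A i = true then (n i:ℕ) ≤ n j else (n i:ℕ) < n j))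
  · rw [if_pos hc]
    simp only [eq_true hc, true_and]
    rw [Fin.prod_univ_succ (n := r)]
    simp only [Fin.prod_univ_succ (n := r+1), Fin.prod_univ_succ (n := r)]
    simp only [Fin.consEquiv_apply, Fin.cons_zero, Fin.cons_succ, Fin.val_zero, Fin.val_succ,
      Nat.add_eq_zero_iff, one_ne_zero, and_false, if_false, if_true, one_mul]
    unfold nextS
    rw [← Fin.sum_univ_eq_sum_range (fun m => if 0 < m then
      (if m < (n 0 : ℕ) then s m / (m:ℚ)^(k 0) else 0) +
        (if k 0 = 1 ∧ m ≤ (n 0:ℕ) then s m / ((N:ℚ) - m) else 0) else 0)]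
    rw [mul_assoc, Finset.sum_mul, Fintype.sum_bool]
    rw [← Finset.sum_add_distrib]
    refine Finset.sum_congr rfl fun c _ => ?_
    generalize ((if A 0 = true then (1:ℚ) / ((N:ℚ) - ((n 0 : ℕ):ℚ)) else 1 / ((n 0 : ℕ):ℚ) ^ k (Fin.succ 0)) *
      ∏ x : Fin r, (if A x.succ = true then (1:ℚ) / ((N:ℚ) - ((n x.succ : ℕ):ℚ))
        else 1 / ((n x.succ : ℕ):ℚ) ^ k x.succ.succ)) = T
    by_cases h0 : 0 < (c:ℕ) <;> by_cases h1 : k 0 = 1 <;> by_cases h2 : (c:ℕ) ≤ n 0 <;>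
      by_cases h3 : (c:ℕ) < n 0 <;> simp [h0, h1, h2, h3] <;> first | (left; ring1) | ring1 | omega
  · simp only [hc, false_and, if_false, Finset.sum_const_zero]

lemma Lsum_one (N : ℕ) (k : Fin 1 → ℕ) (hk : 2 ≤ k 0) (s : ℕ → ℚ) :
    Lsum N k s = ∑ n ∈ Finset.range N, if 0 < n then s n / (n:ℚ)^(k 0) else 0 := by
  unfold Lsum
  rw [← (Equiv.funUnique (Fin 1) Bool).symm.sum_comp, Fintype.sum_bool]
  rw [← (Equiv.funUnique (Fin 1) (Fin N)).symm.sum_comp, ← (Equiv.funUnique (Fin 1) (Fin N)).symm.sum_comp]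
  rw [← Fin.sum_univ_eq_sum_range (fun m => if 0 < m then s m / (m:ℚ)^(k 0) else 0)]
  have : k 0 ≠ 1 := by omega
  simp [this, div_eq_mul_inv]

lemma prod_head (N m : ℕ) (hm : 0 < m) (Q : ℕ → ℚ) (x : Fin m → Fin N) :
    ∏ a : Fin m, (if (a:ℕ) = 0 then Q (x a) / ((N:ℚ) - ((x a : ℕ):ℚ)) else 1 / ((x a : ℕ):ℚ)) =
    Q (x ⟨0, hm⟩) * ∏ a : Fin m, (if (a:ℕ) = 0 then 1 / ((N:ℚ) - ((x a : ℕ):ℚ)) else 1 / ((x a : ℕ):ℚ)) := by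
  obtain ⟨m, rfl⟩ : ∃ k', m = k' + 1 := ⟨m-1, by omega⟩
  rw [Fin.prod_univ_succ, Fin.prod_univ_succ]
  simp
  ring

lemma Rsum_one (N : ℕ) (k : Fin 1 → ℕ) (P : ℕ → ℚ) :
    Rsum N k P = blk N (k 0) P (N-1) := by
  unfold Rsum blk
  rw [← (Fin.consEquiv (fun i : Fin 1 => Fin (k i) → Fin N)).sum_comp, Fintype.sum_prod_type]
  refine Finset.sum_congr rfl fun x _ => ?_
  have : ∀ a, (x a : ℕ) ≤ N - 1 := fun a => by have := (x a).2; omega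
  simp [Fin.forall_fin_one, this, Fin.consEquiv]

lemma Rsum_succ (N : ℕ) {r : ℕ} (k : Fin (r+2) → ℕ) (hk : ∀ i, 0 < k i) (P : ℕ → ℚ) :
    Rsum N k P = Rsum N (fun i => k i.succ) (nextP N (k 0) P) := by
  unfold Rsum
  rw [← (Fin.consEquiv (fun i => Fin (k i) → Fin N)).sum_comp, Fintype.sum_prod_type, Finset.sum_comm]
  refine Finset.sum_congr rfl fun n _ => ?_
  have hiff : ∀ x : Fin (k 0) → Fin N,
    ((∀ i, Monotone (Fin.consEquiv (fun i => Fin (k i) → Fin N) (x, n) i)) ∧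
     (∀ i a, 0 < (Fin.consEquiv (fun i => Fin (k i) → Fin N) (x, n) i a : ℕ)) ∧
      (∀ i j : Fin (r+2), (i:ℕ) + 1 = j →
        if k i = 1 then ∀ a b, (Fin.consEquiv (fun i => Fin (k i) → Fin N) (x, n) i a:ℕ)
            ≤ Fin.consEquiv (fun i => Fin (k i) → Fin N) (x, n) j b
          else ∀ a b, (Fin.consEquiv (fun i => Fin (k i) → Fin N) (x, n) i a:ℕ)
            < Fin.consEquiv (fun i => Fin (k i) → Fin N) (x, n) j b)) ↔
    ((∀ i, Monotone (n i)) ∧ (∀ i a, 0 < (n i a : ℕ)) ∧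
      (∀ i j : Fin (r+1), (i:ℕ) + 1 = j →
        if k i.succ = 1 then ∀ a b, (n i a:ℕ) ≤ n j b else ∀ a b, (n i a:ℕ) < n j b)) ∧
    (Monotone x ∧ (∀ a, 0 < (x a:ℕ)) ∧
      if k 0 = 1 then ∀ a b, (x a : ℕ) ≤ n 0 b else ∀ a b, (x a : ℕ) < n 0 b) := by
    intro x
    constructor
    · rintro ⟨h1, h2, h3⟩
      exact ⟨⟨fun i => h1 i.succ, fun i => h2 i.succ, fun i j hij => h3 i.succ j.succ (by simp [hij])⟩,
        h1 0, h2 0, h3 0 (Fin.succ 0) (by simp)⟩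
    · rintro ⟨⟨h1, h2, h3⟩, h4, h5, h6⟩
      refine ⟨fun i => ?_, fun i => ?_, fun i j hij => ?_⟩
      · cases i using Fin.cases with
        | zero => exact h4
        | succ i => exact h1 i
      · cases i using Fin.cases with
        | zero => exact h5
        | succ i => exact h2 i
      · cases j using Fin.cases with
        | zero => simp at hij
        | succ j =>
          cases i using Fin.cases with
          | zero =>
            have : j = 0 := by ext; simp at hij; simp [← hij]
            subst this
            exact h6
          | succ i => exact h3 i j (by simpa using hij)
  simp only [hiff]
  by_cases hc : ((∀ i, Monotone (n i)) ∧ (∀ i a, 0 < (n i a : ℕ)) ∧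
      (∀ i j : Fin (r+1), (i:ℕ) + 1 = j →
        if k i.succ = 1 then ∀ a b, (n i a:ℕ) ≤ n j b else ∀ a b, (n i a:ℕ) < n j b))
  · rw [if_pos hc]
    simp only [eq_true hc, true_and]
    rw [Fin.prod_univ_succ (n := r)]
    simp only [Fin.prod_univ_succ (n := r+1), Fin.prod_univ_succ (n := r)]
    simp only [Fin.consEquiv_apply, Fin.cons_zero, Fin.cons_succ, Fin.val_zero, Fin.val_succ,
      Nat.add_eq_zero_iff, one_ne_zero, and_false, if_false, if_true]
    rw [prod_head N _ (hk _) (nextP N (k 0) P) (n 0), mul_assoc]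
    have hP : nextP N (k 0) P (n 0 ⟨0, hk _⟩) = ∑ x : Fin (k 0) → Fin N,
      if (Monotone x ∧ (∀ a, 0 < (x a:ℕ)) ∧
        if k 0 = 1 then ∀ a b, (x a : ℕ) ≤ n 0 b else ∀ a b, (x a : ℕ) < n 0 b) then
      ∏ a : Fin (k 0), (if (a:ℕ) = 0 then P (x a) / ((N:ℚ) - ((x a : ℕ) : ℚ)) else 1 / ((x a : ℕ) : ℚ))
      else 0 := by
      have hmin : ∀ b, (n 0 ⟨0, hk _⟩ : ℕ) ≤ n 0 b := fun b =>
        hc.1 0 (Fin.mk_le_of_le_val (Nat.zero_le _))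
      have hpos : 0 < (n 0 ⟨0, hk _⟩ : ℕ) := hc.2.1 0 _
      unfold nextP blk
      split_ifs with h1
      · refine Finset.sum_congr rfl fun x _ => ?_
        congr 1
        apply propext
        refine and_congr_right fun _ => and_congr_right fun _ => ?_
        exact ⟨fun h a b => (h a).trans (hmin b), fun h a => h a _⟩
      · refine Finset.sum_congr rfl fun x _ => ?_
        congr 1
        apply propext
        refine and_congr_right fun _ => and_congr_right fun _ => ?_
        refine ⟨fun h a b => ?_, fun h a => ?_⟩
        · have := h a; have := hmin b; omega
        · have := h a ⟨0, hk _⟩; omega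
    rw [hP, Finset.sum_mul]
    refine Finset.sum_congr rfl fun x _ => ?_
    rw [ite_mul, zero_mul]
  · simp only [hc, false_and, if_false, Finset.sum_const_zero]

lemma main_rec (N : ℕ) (hN : 0 < N) : ∀ (r : ℕ) (k : Fin (r+1) → ℕ) (_ : ∀ i, 0 < k i)
    (_ : 2 ≤ k (Fin.last r)) (s P : ℕ → ℚ) (_ : ZRel N s P), Lsum N k s = Rsum N k P := by
  intro r
  induction r with
  | zero =>
    intro k hk h2 s P h
    have h2' : 2 ≤ k 0 := h2
    rw [Lsum_one N k h2' s, Rsum_one]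
    obtain ⟨m, hm⟩ : ∃ k', k 0 = k' + 1 := ⟨k 0-1, by omega⟩
    rw [hm, blk_eq N s P h m (N-1) (by omega)]
    refine Finset.sum_congr rfl fun n hn => ?_
    have hn' := Finset.mem_range.mp hn
    have : cc N n (N-1) = 1 := by
      unfold cc
      have := Nat.choose_pos (n := N-1) (k := n) (by omega)
      exact div_self (by positivity)
    rw [this, mul_one]
  | succ r ih =>
    intro k hk h2 s P h
    rw [Lsum_succ, Rsum_succ N k hk]
    exact ih (fun i => k i.succ) (fun i => hk _) h2 _ _ (rel_next N _ (hk 0) s P h)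

lemma zdiaF_eq (N : ℕ) {r : ℕ} (k : Fin r → ℕ) : zdiaF N k = Lsum N k (fun _ => 1) := by
  unfold zdiaF Lsum
  let e : Finset (Fin r) ≃ (Fin r → Bool) :=
    { toFun := fun A i => decide (i ∈ A)
      invFun := fun f => Finset.univ.filter (fun i => f i = true)
      left_inv := fun A => by ext; simp
      right_inv := fun f => by ext; simp }
  rw [← e.sum_comp]
  refine Finset.sum_congr rfl fun A _ => ?_
  have he : ∀ i, (e A i = true) ↔ i ∈ A := fun i => by simp [e]
  simp only [he]
  by_cases hA : ∀ i ∈ A, k i = 1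
  · rw [if_pos hA, Finset.sum_filter]
    refine Finset.sum_congr rfl fun n _ => ?_
    simp only [eq_true hA, true_and, ite_self, one_mul]
    congr 1
    apply propext
    refine and_congr_right fun _ => ⟨fun h i j hij => ?_, fun h i hi => h i ⟨i+1, hi⟩ rfl⟩
    have : j = ⟨(i:ℕ)+1, by rw [hij]; exact j.2⟩ := Fin.ext hij.symm
    rw [this]
    exact h i _
  · rw [if_neg hA]
    simp only [eq_false hA, false_and, if_false, Finset.sum_const_zero]

/-- **Discrete iterated integral expression of `ζ◇_N`.**  For every positive integer `N`
and every admissible index `k = (k₁,…,k_r)`, `ζ◇_N(k) = ζ◇♭_N(k)`, where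
`ζ◇♭_N(k) = ∑ ∏_{i} 1/((N-n_{i,1})·n_{i,2}⋯n_{i,k_i})`, the sum being over integers
`0 < n_{i,1} ≤ ⋯ ≤ n_{i,k_i} < N` with `n_{i,k_i} ≤ n_{i+1,1}` when `k_i = 1` and
`n_{i,k_i} < n_{i+1,1}` when `k_i ≥ 2`. -/
theorem zdia_flat (N : ℕ) (hN : 0 < N) (r : ℕ) (hr : 0 < r) (k : Fin r → ℕ)
    (hk : ∀ i, 0 < k i) (hadm : ∀ i : Fin r, (i : ℕ) + 1 = r → 2 ≤ k i) :
    zdiaF N k =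
      ∑ n ∈ Finset.univ.filter (fun n : ∀ i : Fin r, Fin (k i) → Fin N =>
          (∀ i, Monotone (n i)) ∧ (∀ i a, 0 < (n i a : ℕ)) ∧
          (∀ (i : Fin r) (h : (i : ℕ) + 1 < r),
            if k i = 1 then
              (n i ⟨k i - 1, Nat.sub_lt (hk i) Nat.one_pos⟩ : ℕ)
                ≤ (n ⟨(i : ℕ) + 1, h⟩ ⟨0, hk ⟨(i : ℕ) + 1, h⟩⟩ : ℕ)
            else
              (n i ⟨k i - 1, Nat.sub_lt (hk i) Nat.one_pos⟩ : ℕ)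
                < (n ⟨(i : ℕ) + 1, h⟩ ⟨0, hk ⟨(i : ℕ) + 1, h⟩⟩ : ℕ))),
        ∏ i : Fin r, ∏ a : Fin (k i),
          if (a : ℕ) = 0 then (1 : ℚ) / ((N : ℚ) - ((n i a : ℕ) : ℚ))
          else (1 : ℚ) / ((n i a : ℕ) : ℚ) := by
  rw [zdiaF_eq]
  obtain ⟨q, rfl⟩ : ∃ q, r = q + 1 := ⟨r - 1, by omega⟩
  rw [main_rec N hN q k hk (hadm _ (by simp)) _ _ (rel_init N), Finset.sum_filter]
  unfold Rsum
  refine Finset.sum_congr rfl fun n _ => ?_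
  simp only [ite_self]
  congr 1
  apply propext
  refine and_congr_right fun hmono => and_congr_right fun _ => ?_
  have hmin : ∀ i b, (n i ⟨0, hk _⟩ : ℕ) ≤ n i b := fun i b =>
    hmono i (Fin.mk_le_of_le_val (Nat.zero_le _))
  have hmax : ∀ i b, (n i b : ℕ) ≤ n i ⟨k i - 1, Nat.sub_lt (hk i) Nat.one_pos⟩ := fun i b =>
    hmono i (Fin.le_def.mpr (by have := b.2; simp only; omega))
  constructor
  · intro h i hi
    have h' := h i ⟨i+1, hi⟩ rfl
    split_ifs at h' ⊢ with h1
    · exact h' _ _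
    · exact h' _ _
  · intro h i j hij
    obtain ⟨j, hj⟩ := j
    simp only at hij
    subst hij
    have h' := h i hj
    split_ifs at h' ⊢ with h1
    · intro a b
      exact (hmax i a).trans (h'.trans (hmin _ b))
    · intro a b
      exact (hmax i a).trans_lt (h'.trans_le (hmin _ b))
end
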